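/- arXiv:2305.18987 — 2 statements merged into one kernel-verified Lean document; each statement's English description precedes it below -/
import Mathlib

section
/- Let 0 < α ≤ 2. There exist a constant K_α > 0 depending only on α and an absolute constant c ≥ 1 such that for all K ≥ K_α and all integers s with c ≤ s ≤ p, there exists a constant c' > 0 depending only on α and K such that inf over all measurable tests φ of R_{G_{α,K}^⊗}(ρ,φ) is at least 1/2 whenever ρ² ≤ c'·[min(s·log^{2/α}(ep/s), √(p·(log log(8n))^{ω₁})) + log log(8n)], where ω₁ := 1 if s > √(p·log log(8n)) and ω₁ := 0 otherwise. -/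
open MeasureTheory
open scoped Classical

namespace ChangePoint

noncomputable section

/-- The `i`-th column (0-based) of the data matrix, with out-of-range guard. -/
def col (p n : ℕ) (X : Fin n → Fin p → ℝ) (i : ℕ) : Fin p → ℝ :=
  if h : i < n then X ⟨i, h⟩ else 0

/-- ℓ₀-"norm": the number of nonzero coordinates. -/
def l0 (p : ℕ) (v : Fin p → ℝ) : ℕ :=
  (Finset.univ.filter fun j : Fin p => v j ≠ 0).card

/-- Squared Euclidean norm on `ℝ^p`. -/
def sqnorm (p : ℕ) (v : Fin p → ℝ) : ℝ := ∑ j, v j ^ 2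

/-- The iterated logarithm `log log (8 n)`. -/
def LL (n : ℕ) : ℝ := Real.log (Real.log (8 * n))

/-- The sub-Weibull class `𝒢_{α,K}` of distributions on `ℝ`:
mean `0`, variance `1` and `𝔼 exp (|W/K|^α) ≤ 2`. -/
def memG (α K : ℝ) (ν : Measure ℝ) : Prop :=
  IsProbabilityMeasure ν ∧ Integrable id ν ∧ (∫ x, x ∂ν) = 0 ∧
    (∫⁻ x, ENNReal.ofReal (x ^ 2) ∂ν) = 1 ∧
    (∫⁻ x, ENNReal.ofReal (Real.exp (|x / K| ^ α)) ∂ν) ≤ 2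

/-- The polynomially-tailed class `𝒫_{α,K}` of distributions on `ℝ`:
mean `0`, variance `1` and `𝔼 |W/K|^α ≤ 1`. -/
def memP (α K : ℝ) (ν : Measure ℝ) : Prop :=
  IsProbabilityMeasure ν ∧ Integrable id ν ∧ (∫ x, x ∂ν) = 0 ∧
    (∫⁻ x, ENNReal.ofReal (x ^ 2) ∂ν) = 1 ∧
    (∫⁻ x, ENNReal.ofReal (|x / K| ^ α) ∂ν) ≤ 1

/-- `P` is the joint law on `ℝ^{p×n}` of `p·n` independent entries with marginal laws `ν t j`
(characterised on measurable rectangles). -/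
def IsEntrywiseProduct (p n : ℕ) (P : Measure (Fin n → Fin p → ℝ))
    (ν : Fin n → Fin p → Measure ℝ) : Prop :=
  IsProbabilityMeasure P ∧
    ∀ s : Fin n → Fin p → Set ℝ, (∀ t j, MeasurableSet (s t j)) →
      P {x | ∀ t j, x t j ∈ s t j} = ∏ t, ∏ j, ν t j (s t j)

/-- The class `𝒢_{α,K}^⊗` of noise distributions. -/
def Gclass (p n : ℕ) (α K : ℝ) : Set (Measure (Fin n → Fin p → ℝ)) :=
  {P | ∃ ν : Fin n → Fin p → Measure ℝ, (∀ t j, memG α K (ν t j)) ∧ IsEntrywiseProduct p n P ν}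

/-- The class `𝒫_{α,K}^⊗` of noise distributions. -/
def Pclass (p n : ℕ) (α K : ℝ) : Set (Measure (Fin n → Fin p → ℝ)) :=
  {P | ∃ ν : Fin n → Fin p → Measure ℝ, (∀ t j, memP α K (ν t j)) ∧ IsEntrywiseProduct p n P ν}

/-- The null parameter space `Θ₀(p,n)`: constant signal. -/
def Theta0 (p n : ℕ) : Set (Fin n → Fin p → ℝ) :=
  {θ | ∃ μ : Fin p → ℝ, ∀ t, θ t = μ}

/-- `Θ^{(t₀)}(p,n,s,ρ)`: a single mean change at (1-based) time `t0` of sparsity `s` and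
normalized signal strength at least `ρ`. -/
def ThetaAt (p n t0 s : ℕ) (ρ : ℝ) : Set (Fin n → Fin p → ℝ) :=
  {θ | ∃ μ₁ μ₂ : Fin p → ℝ,
    (∀ t : Fin n, (t : ℕ) < t0 → θ t = μ₁) ∧
    (∀ t : Fin n, t0 ≤ (t : ℕ) → θ t = μ₂) ∧
    l0 p (fun j => μ₁ j - μ₂ j) ≤ s ∧
    ρ ^ 2 ≤ (t0 : ℝ) * ((n : ℝ) - (t0 : ℝ)) / (n : ℝ) * sqnorm p (fun j => μ₁ j - μ₂ j)}

/-- The single-change-point alternative `Θ(p,n,s,ρ)`. -/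
def Theta1 (p n s : ℕ) (ρ : ℝ) : Set (Fin n → Fin p → ℝ) :=
  ⋃ t0 ∈ Finset.Icc 1 (n - 1), ThetaAt p n t0 s ρ

/-- A (randomized-free) test: a measurable `{0,1}`-valued function of the data. -/
def IsTest (p n : ℕ) (φ : (Fin n → Fin p → ℝ) → ℝ) : Prop :=
  Measurable φ ∧ ∀ x, φ x = 0 ∨ φ x = 1

/-- The worst-case testing error of the test `φ` for null `Θ₀(p,n)` against the
alternative `Θalt`, over the noise class `Q`. -/
def risk (p n : ℕ) (Q : Set (Measure (Fin n → Fin p → ℝ)))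
    (Θalt : Set (Fin n → Fin p → ℝ)) (φ : (Fin n → Fin p → ℝ) → ℝ) : ℝ :=
  (⨆ P ∈ Q, ⨆ θ ∈ Theta0 p n, ∫ E, φ (θ + E) ∂P) +
  (⨆ P ∈ Q, ⨆ θ ∈ Θalt, ∫ E, (1 - φ (θ + E)) ∂P)

/-- The dyadic grid `𝒯 = {1,2,4,…,2^{⌊log₂(n/2)⌋}}`. -/
def Tgrid (n : ℕ) : Finset ℕ :=
  (Finset.range (Nat.log 2 (n / 2) + 1)).image fun k => 2 ^ k

/-- The CUSUM-type statistic `Y_t`. -/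
def Yt (p n : ℕ) (X : Fin n → Fin p → ℝ) (t : ℕ) (j : Fin p) : ℝ :=
  (∑ i ∈ Finset.range t, (col p n X i j - col p n X (n - 1 - i) j)) / Real.sqrt (2 * t)

/-- `A_t = ∑_j (Y_t(j)² − 1)`. -/
def At (p n : ℕ) (X : Fin n → Fin p → ℝ) (t : ℕ) : ℝ :=
  ∑ j, (Yt p n X t j ^ 2 - 1)

/-- The dense sub-Weibull test `φ_{𝒢,dense}` with threshold `r`. -/
def phiGdense (p n : ℕ) (r : ℝ) (X : Fin n → Fin p → ℝ) : ℝ :=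
  if ∃ t ∈ Tgrid n, r < At p n X t then 1 else 0

/-- Sample-splitting statistic `Y_{t,1}` (odd-indexed observations). -/
def Yt1 (p n : ℕ) (X : Fin n → Fin p → ℝ) (t : ℕ) (j : Fin p) : ℝ :=
  (∑ i ∈ Finset.range (t / 2), (col p n X (2 * i) j - col p n X (n - 1 - 2 * i) j)) /
    Real.sqrt t

/-- Sample-splitting statistic `Y_{t,2}` (even-indexed observations). -/
def Yt2 (p n : ℕ) (X : Fin n → Fin p → ℝ) (t : ℕ) (j : Fin p) : ℝ :=
  (∑ i ∈ Finset.range (t / 2), (col p n X (2 * i + 1) j - col p n X (n - 2 - 2 * i) j)) /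
    Real.sqrt t

/-- `Y_1 = (X_1 − X_n)/√2`. -/
def Y1 (p n : ℕ) (X : Fin n → Fin p → ℝ) (j : Fin p) : ℝ :=
  (col p n X 0 j - col p n X (n - 1) j) / Real.sqrt 2

/-- The hard-thresholded statistic `A_{t,a}`. -/
def Ata (p n : ℕ) (X : Fin n → Fin p → ℝ) (t : ℕ) (a : ℝ) : ℝ :=
  if t = 1 then ∑ j, (Y1 p n X j ^ 2 - 1) * (if a ≤ |Y1 p n X j| then 1 else 0)
  else ∑ j, (Yt1 p n X t j ^ 2 - 1) * (if a ≤ |Yt2 p n X t j| then 1 else 0)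

/-- The sparse sub-Weibull test `φ_{𝒢,sparse}` with threshold parameters `a, r, r₁`. -/
def phiGsparse (p n : ℕ) (a r r₁ : ℝ) (X : Fin n → Fin p → ℝ) : ℝ :=
  if (∃ t ∈ Tgrid n, t ≠ 1 ∧ r < Ata p n X t a) ∨ r₁ < Ata p n X 1 a then 1 else 0

/-- The median of a list of reals: its `⌈m/2⌉`-th smallest element. -/
def median (l : List ℝ) : ℝ :=
  (l.insertionSort (· ≤ ·)).getD ((l.length + 1) / 2 - 1) 0

/-- `Z_i = (X_i − X_{n+1−i})/√2` (0-based index `i`). -/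
def Zb (p n : ℕ) (X : Fin n → Fin p → ℝ) (i : ℕ) (j : Fin p) : ℝ :=
  (col p n X i j - col p n X (n - 1 - i) j) / Real.sqrt 2

/-- Mean of the `g`-th (0-based) of `G` consecutive equal-size groups of `Z_1,…,Z_t`. -/
def groupMean (p n : ℕ) (X : Fin n → Fin p → ℝ) (t G g : ℕ) (j : Fin p) : ℝ :=
  (∑ i ∈ Finset.range (t / G), Zb p n X (g * (t / G) + i) j) / ((t / G : ℕ) : ℝ)

/-- The median-of-means statistic `A_t^{MoM}` with `G` groups. -/
def AMoM (p n : ℕ) (X : Fin n → Fin p → ℝ) (t G : ℕ) : ℝ :=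
  (t : ℝ) * median (List.ofFn fun g : Fin G =>
    ∑ j, (groupMean p n X t G (g : ℕ) j ^ 2 - (G : ℝ) / (t : ℝ)))

/-- `Δ = 2^{3+⌈log₂ log log (8n)⌉}`. -/
def DeltaDense (n : ℕ) : ℕ := 2 ^ (3 + (Int.ceil (Real.logb 2 (LL n))).toNat)

/-- The dense median-of-means test `φ_{𝒫,dense}`. -/
def phiPdense (p n : ℕ) (α C₁ : ℝ) (X : Fin n → Fin p → ℝ) : ℝ :=
  if ∃ t ∈ Tgrid n,
      1 < AMoM p n X t (min t (DeltaDense n)) /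
        (C₁ * (p : ℝ) ^ max ((1 : ℝ) / 2) (2 / α) * ((min t (DeltaDense n) : ℕ) : ℝ))
  then 1 else 0

/-- `Δ = 2^{4+⌈log₂ log log (8n)⌉}`. -/
def DeltaSparse (n : ℕ) : ℕ := 2 ^ (4 + (Int.ceil (Real.logb 2 (LL n))).toNat)

/-- Mean of the `g`-th (0-based) of `G` consecutive equal-size groups of the odd-indexed
`Z_1, Z_3, …, Z_{t−1}`. -/
def groupMeanOdd (p n : ℕ) (X : Fin n → Fin p → ℝ) (t G g : ℕ) (j : Fin p) : ℝ :=
  (∑ i ∈ Finset.range (t / (2 * G)), Zb p n X (2 * (g * (t / (2 * G)) + i)) j) /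
    ((t / (2 * G) : ℕ) : ℝ)

/-- The hard-thresholded median-of-means statistic `A_{t,a}^{MoM}` with `G` groups. -/
def AMoMa (p n : ℕ) (X : Fin n → Fin p → ℝ) (t G : ℕ) (a : ℝ) : ℝ :=
  if t = 1 then ∑ j, (Zb p n X 0 j ^ 2 - 1) * (if a ≤ |Zb p n X 0 j| then 1 else 0)
  else ((t : ℝ) / 2) * median (List.ofFn fun g : Fin G =>
    ∑ j, (groupMeanOdd p n X t G (g : ℕ) j ^ 2 - 2 * (G : ℝ) / (t : ℝ)) *
      (if a ≤ |Yt2 p n X t j| then 1 else 0))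

/-- The sparse median-of-means test `φ_{𝒫,sparse}^{MoM}`. -/
def phiPsparseMoM (p n s : ℕ) (α C₁ C₂ : ℝ) (X : Fin n → Fin p → ℝ) : ℝ :=
  if ∃ t ∈ Tgrid n,
      1 < AMoMa p n X t (min t (DeltaSparse n) / 2)
            (C₁ * (((p : ℝ) / (s : ℝ)) ^ ((1 : ℝ) / α) +
              ((s : ℝ) ^ (-(1 : ℝ) / 2)) * Real.sqrt (LL n))) /
          (C₂ * (if t = 1 then (s : ℝ) * ((p : ℝ) / (s : ℝ)) ^ ((2 : ℝ) / α)
                 else Real.sqrt (s : ℝ) * ((min t (DeltaSparse n) / 2 : ℕ) : ℝ)))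
  then 1 else 0

/-- Condition RSM for `(α, K)` with constants `C₁, C₂`: statistical guarantee for a family
of (measurable) robust sparse mean estimators. -/
def CondRSM (p s : ℕ) (α K C₁ C₂ : ℝ)
    (est : (m : ℕ) → (Fin m → Fin p → ℝ) → ℝ → Fin p → ℝ) : Prop :=
  (∀ m : ℕ, Measurable fun Wη : (Fin m → Fin p → ℝ) × ℝ => est m Wη.1 Wη.2) ∧
  ∀ (m : ℕ) (μW : Fin p → ℝ) (ν : Fin m → Measure (Fin p → ℝ))
    (P : Measure (Fin m → Fin p → ℝ)) (η : ℝ),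
    0 < η → η < 1 → l0 p μW ≤ s →
    (∀ i, IsProbabilityMeasure (ν i)) →
    (∀ i j, Integrable (fun w => w j) (ν i) ∧ (∫ w, w j ∂ν i) = μW j) →
    (∀ i j k, Integrable (fun w => (w j - μW j) * (w k - μW k)) (ν i) ∧
      (∫ w, (w j - μW j) * (w k - μW k) ∂ν i) = if j = k then 1 else 0) →
    (∀ i j, (∫⁻ w, ENNReal.ofReal (|w j - μW j| ^ α) ∂ν i) ≤
      ENNReal.ofReal ((Real.sqrt 2 * K) ^ α)) →
    IsProbabilityMeasure P →
    (∀ S : Fin m → Set (Fin p → ℝ), (∀ i, MeasurableSet (S i)) →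
      P {W | ∀ i, W i ∈ S i} = ∏ i, ν i (S i)) →
    C₁ * ((s : ℝ) * Real.log (Real.exp 1 * (p : ℝ) / (s : ℝ)) + Real.log (1 / η)) ≤ (m : ℝ) →
    ENNReal.ofReal (1 - η) ≤
      P {W | Real.sqrt (sqnorm p fun j => est m W η j - μW j) ≤
        Real.sqrt C₂ * (Real.sqrt ((s : ℝ) * Real.log (Real.exp 1 * (p : ℝ) / (s : ℝ)) / (m : ℝ)) +
          Real.sqrt (Real.log (1 / η) / (m : ℝ)))}

/-- `Δ̃₁ = C₅ (s log(ep/s) + log(16/ε))`. -/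
def rsmDelta1 (p s : ℕ) (ε C₅ : ℝ) : ℝ :=
  C₅ * ((s : ℝ) * Real.log (Real.exp 1 * (p : ℝ) / (s : ℝ)) + Real.log (16 / ε))

/-- `Δ̃₂ = C₅ (s log(ep/s) + log(16 log(2n)/ε))`. -/
def rsmDelta2 (p s n : ℕ) (ε C₅ : ℝ) : ℝ :=
  C₅ * ((s : ℝ) * Real.log (Real.exp 1 * (p : ℝ) / (s : ℝ)) +
    Real.log (16 * Real.log (2 * (n : ℝ)) / ε))

/-- `a = C₃ ((p/s)^{1/α} + s^{−1/2} log^{1/2}(log Δ̃₁))`. -/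
def rsmA (p s : ℕ) (α ε C₃ C₅ : ℝ) : ℝ :=
  C₃ * (((p : ℝ) / (s : ℝ)) ^ ((1 : ℝ) / α) +
    ((s : ℝ) ^ (-(1 : ℝ) / 2)) * Real.sqrt (Real.log (Real.log (rsmDelta1 p s ε C₅))))

/-- The sparse test `φ^{RSM}_{𝒫,sparse}` built from a robust sparse mean estimator `est`. -/
def phiRSM (p n s : ℕ) (est : (m : ℕ) → (Fin m → Fin p → ℝ) → ℝ → Fin p → ℝ)
    (α ε C₃ C₄ C₅ C₆ : ℝ) (X : Fin n → Fin p → ℝ) : ℝ :=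
  if (∃ t ∈ Tgrid n, (t : ℝ) ≤ rsmDelta1 p s ε C₅ ∧
        1 < Ata p n X t (rsmA p s α ε C₃ C₅) /
          (C₄ * (if t = 1 then (s : ℝ) * ((p : ℝ) / (s : ℝ)) ^ ((2 : ℝ) / α)
                 else Real.sqrt ((s : ℝ) * Real.log (rsmDelta1 p s ε C₅))))) ∨
     (∃ t ∈ Tgrid n, rsmDelta1 p s ε C₅ < (t : ℝ) ∧
        1 < (t : ℝ) * sqnorm p (est t (fun i : Fin t => fun j => Zb p n X (i : ℕ) j)
              (Real.exp ((s : ℝ) * Real.log (Real.exp 1 * (p : ℝ) / (s : ℝ)) -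
                min (t : ℝ) (rsmDelta2 p s n ε C₅) / C₅))) /
          (C₆ * min (t : ℝ) (rsmDelta2 p s n ε C₅)))
  then 1 else 0

/-- The multiple-change-point alternative `Θ_multi(p,n,ρ)`. -/
def ThetaMulti (p n : ℕ) (ρ : ℝ) : Set (Fin n → Fin p → ℝ) :=
  {θ | ∃ k : ℕ, 1 ≤ k ∧ ∃ τ : ℕ → ℕ, ∃ μ : ℕ → Fin p → ℝ,
    τ 0 = 0 ∧ τ (k + 1) = n ∧ (∀ i ≤ k, τ i < τ (i + 1)) ∧
    (∀ i, 1 ≤ i → i ≤ k + 1 →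
      ∀ t : Fin n, τ (i - 1) ≤ (t : ℕ) → (t : ℕ) < τ i → θ t = μ i) ∧
    ∃ i, 1 ≤ i ∧ i ≤ k ∧
      4 * Real.log (n : ℝ) ≤ ((min (τ i - τ (i - 1)) (τ (i + 1) - τ i) : ℕ) : ℝ) ∧
      ρ ^ 2 ≤ sqnorm p (fun j => μ (i + 1) j - μ i j) *
        ((min (τ i - τ (i - 1)) (τ (i + 1) - τ i) : ℕ) : ℝ)}

/-- Membership in the temporal-dependence class `𝒫_Temp`: independent rows, entrywise
`𝒫_{α,K}` marginals, and exponentially decaying interlaced α-mixing coefficients. -/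
def memPTemp (p n : ℕ) (α K c₁ c₂ : ℝ) (P : Measure (Fin n → Fin p → ℝ)) : Prop :=
  IsProbabilityMeasure P ∧
  (∀ s : Fin p → Set (Fin n → ℝ), (∀ j, MeasurableSet (s j)) →
    P {x | ∀ j, (fun t => x t j) ∈ s j} = ∏ j, P {x | (fun t => x t j) ∈ s j}) ∧
  (∀ t j, memP α K (P.map fun x => x t j)) ∧
  (∀ i : ℕ, 1 ≤ i → i ≤ n - 1 →
    ∀ S T : Set (Fin n),
      (∀ s' ∈ S, ∀ t' ∈ T, (i : ℤ) ≤ |((s' : ℕ) : ℤ) - ((t' : ℕ) : ℤ)|) →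
      ∀ A B : Set (Fin n → Fin p → ℝ),
        MeasurableSet[MeasurableSpace.comap (fun x (t : S) => x t.1) inferInstance] A →
        MeasurableSet[MeasurableSpace.comap (fun x (t : T) => x t.1) inferInstance] B →
        |(P (A ∩ B)).toReal - (P A).toReal * (P B).toReal| ≤ c₁ * Real.exp (-c₂ * (i : ℝ)))

/-- The class `𝒲_α` of distributions on `ℝ^p`: centered with `𝔼|⟨W,v⟩|^α ≤ 1` for
every unit vector `v`. -/
def memW (p : ℕ) (α : ℝ) (ν : Measure (Fin p → ℝ)) : Prop :=
  IsProbabilityMeasure ν ∧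
  (∀ j, Integrable (fun w => w j) ν ∧ (∫ w, w j ∂ν) = 0) ∧
  ∀ v : Fin p → ℝ, sqnorm p v = 1 →
    (∫⁻ w, ENNReal.ofReal (|∑ j, w j * v j| ^ α) ∂ν) ≤ 1

/-- The class `𝒲_α^⊗`: independent columns with distributions in `𝒲_α`. -/
def Wclass (p n : ℕ) (α : ℝ) : Set (Measure (Fin n → Fin p → ℝ)) :=
  {P | ∃ ν : Fin n → Measure (Fin p → ℝ), (∀ t, memW p α (ν t)) ∧
    IsProbabilityMeasure P ∧
    ∀ s : Fin n → Set (Fin p → ℝ), (∀ t, MeasurableSet (s t)) →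
      P {x | ∀ t, x t ∈ s t} = ∏ t, ν t (s t)}

/-- The alternative `⋃_{t₀=1}^{n−1} Θ(p,n,ρ_{t₀})` for a location-dependent signal
strength sequence `ρ`. -/
def ThetaSeq (p n : ℕ) (ρ : ℕ → ℝ) : Set (Fin n → Fin p → ℝ) :=
  ⋃ t0 ∈ Finset.Icc 1 (n - 1),
    {θ | ∃ μ₁ μ₂ : Fin p → ℝ,
      (∀ t : Fin n, (t : ℕ) < t0 → θ t = μ₁) ∧
      (∀ t : Fin n, t0 ≤ (t : ℕ) → θ t = μ₂) ∧
      (ρ t0) ^ 2 ≤ sqnorm p (fun j => μ₁ j - μ₂ j)}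

/-- The boundary-restricted alternative `Θ_res(p,n,s,ρ)`. -/
def ThetaRes (p n s : ℕ) (ρ tres : ℝ) : Set (Fin n → Fin p → ℝ) :=
  {θ | ∃ t0 : ℕ, tres + 1 ≤ (t0 : ℝ) ∧ (t0 : ℝ) ≤ (n : ℝ) - tres ∧ θ ∈ ThetaAt p n t0 s ρ}

/-- `t^res = 32 (log (e² p / s) + s^{−1} log log (8n))`. -/
def tRes (p n s : ℕ) : ℝ :=
  32 * (Real.log (Real.exp 1 ^ 2 * (p : ℝ) / (s : ℝ)) + LL n / (s : ℝ))

end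

/-- The discrete law giving mass `m l` to the point `f l`. -/
noncomputable def dlaw {Λ β : Type*} [Fintype Λ] [MeasurableSpace β] (m : Λ → ℝ) (f : Λ → β) :
    Measure β :=
  ∑ l, ENNReal.ofReal (m l) • Measure.dirac (f l)

theorem lintegral_dlaw {Λ β : Type*} [Fintype Λ] [MeasurableSpace β] [MeasurableSingletonClass β]
    (m : Λ → ℝ) (f : Λ → β) (g : β → ENNReal) :
    ∫⁻ x, g x ∂(dlaw m f) = ∑ l, ENNReal.ofReal (m l) * g (f l) := by
  simp [dlaw, lintegral_finsetSum_measure, lintegral_smul_measure]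

theorem dlaw_apply {Λ β : Type*} [Fintype Λ] [MeasurableSpace β] [MeasurableSingletonClass β]
    (m : Λ → ℝ) (f : Λ → β) (S : Set β) (hS : MeasurableSet S) :
    dlaw m f S = ∑ l, ENNReal.ofReal (m l) * S.indicator 1 (f l) := by
  rw [← lintegral_indicator_one hS, lintegral_dlaw]

theorem isProbabilityMeasure_dlaw {Λ β : Type*} [Fintype Λ] [MeasurableSpace β]
    [MeasurableSingletonClass β] {m : Λ → ℝ} (hm : ∀ l, 0 ≤ m l) (hm1 : ∑ l, m l = 1)
    (f : Λ → β) : IsProbabilityMeasure (dlaw m f) := by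
  constructor
  rw [dlaw_apply _ _ _ MeasurableSet.univ]
  simp only [Set.indicator_univ, Pi.one_apply, mul_one]
  rw [← ENNReal.ofReal_sum_of_nonneg (fun l _ => hm l), hm1, ENNReal.ofReal_one]

theorem integrable_dlaw {Λ β : Type*} [Fintype Λ] [MeasurableSpace β]
    [MeasurableSingletonClass β] (m : Λ → ℝ) (f : Λ → β) (g : β → ℝ) :
    Integrable g (dlaw m f) := by
  unfold dlaw
  rw [integrable_finsetSum_measure]
  intro l _
  exact (integrable_dirac (by simp)).smul_measure (by simp)

theorem integral_dlaw {Λ β : Type*} [Fintype Λ] [MeasurableSpace β]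
    [MeasurableSingletonClass β] {m : Λ → ℝ} (hm : ∀ l, 0 ≤ m l) (f : Λ → β) (g : β → ℝ) :
    ∫ x, g x ∂(dlaw m f) = ∑ l, m l * g (f l) := by
  unfold dlaw
  rw [integral_finsetSum_measure
    (fun l _ => (integrable_dirac (by simp)).smul_measure (by simp))]
  refine Finset.sum_congr rfl fun l _ => ?_
  rw [integral_smul_measure, integral_dirac, ENNReal.toReal_ofReal (hm l), smul_eq_mul]

theorem memG_dlaw {Λ : Type*} [Fintype Λ] {α K : ℝ} {m : Λ → ℝ} {f : Λ → ℝ} (hm : ∀ l, 0 ≤ m l)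
    (hm1 : ∑ l, m l = 1) (hmean : ∑ l, m l * f l = 0) (hvar : ∑ l, m l * f l ^ 2 = 1)
    (hexp : ∑ l, m l * Real.exp (|f l / K| ^ α) ≤ 2) : memG α K (dlaw m f) := by
  refine ⟨isProbabilityMeasure_dlaw hm hm1 f, integrable_dlaw m f id, ?_, ?_, ?_⟩
  · rw [integral_dlaw hm f (fun x => x), hmean]
  · rw [lintegral_dlaw]
    simp_rw [← ENNReal.ofReal_mul (hm _)]
    rw [← ENNReal.ofReal_sum_of_nonneg (fun l _ => mul_nonneg (hm l) (sq_nonneg _)), hvar,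
      ENNReal.ofReal_one]
  · rw [lintegral_dlaw]
    simp_rw [← ENNReal.ofReal_mul (hm _)]
    rw [← ENNReal.ofReal_sum_of_nonneg
      (fun l _ => mul_nonneg (hm l) (Real.exp_pos _).le)]
    calc _ ≤ ENNReal.ofReal 2 := ENNReal.ofReal_le_ofReal hexp
      _ = 2 := by simp

theorem prod_prod_sum {R : Type*} [CommSemiring R] {p n : ℕ} {Λ : Type*} [Fintype Λ]
    (g : Fin n → Fin p → Λ → R) :
    ∏ t, ∏ j, ∑ l, g t j l = ∑ x : Fin n → Fin p → Λ, ∏ t, ∏ j, g t j (x t j) := by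
  simp_rw [Fintype.prod_sum]

theorem isEntrywiseProduct_dlaw {p n : ℕ} {Λ : Type*} [Fintype Λ] {m f : Fin n → Fin p → Λ → ℝ}
    (hm : ∀ t j l, 0 ≤ m t j l) (hm1 : ∀ t j, ∑ l, m t j l = 1) :
    IsEntrywiseProduct p n
      (dlaw (fun x : Fin n → Fin p → Λ => ∏ t, ∏ j, m t j (x t j))
        (fun x t j => f t j (x t j)))
      (fun t j => dlaw (m t j) (f t j)) := by
  refine ⟨isProbabilityMeasure_dlaw
    (fun x => Finset.prod_nonneg fun t _ => Finset.prod_nonneg fun j _ => hm t j _) ?_ _, ?_⟩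
  · rw [← prod_prod_sum m]
    simp [hm1]
  · intro s hs
    have hS : MeasurableSet {x : Fin n → Fin p → ℝ | ∀ t j, x t j ∈ s t j} := by
      have : {x : Fin n → Fin p → ℝ | ∀ t j, x t j ∈ s t j} =
          Set.univ.pi fun t => Set.univ.pi fun j => s t j := by
        ext x; simp [Set.mem_pi]
      rw [this]
      exact MeasurableSet.univ_pi fun t => MeasurableSet.univ_pi fun j => hs t j
    rw [dlaw_apply _ _ _ hS]
    simp_rw [dlaw_apply _ _ _ (hs _ _)]
    rw [prod_prod_sum fun t j l => ENNReal.ofReal (m t j l) * (s t j).indicator 1 (f t j l)]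
    refine Finset.sum_congr rfl fun x _ => ?_
    simp_rw [Finset.prod_mul_distrib]
    congr 1
    · rw [ENNReal.ofReal_prod_of_nonneg fun t _ => Finset.prod_nonneg fun j _ => hm t j _]
      refine Finset.prod_congr rfl fun t _ => ?_
      rw [ENNReal.ofReal_prod_of_nonneg fun j _ => hm t j _]
    · by_cases h : ∀ t j, f t j (x t j) ∈ s t j
      · rw [Set.indicator_of_mem (by exact h)]
        simp [h]
      · rw [Set.indicator_of_notMem (by exact h)]
        push Not at h
        obtain ⟨t, j, htj⟩ := h
        symm
        refine Finset.prod_eq_zero (Finset.mem_univ t) (Finset.prod_eq_zero (Finset.mem_univ j) ?_)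
        simp [htj]

theorem le_biSup_biSup {P Θ : Type*} {Q : Set P} {T : Set Θ} {g : P → Θ → ℝ}
    (h1 : ∀ a ∈ Q, ∀ b ∈ T, g a b ≤ 1)
    {a : P} (ha : a ∈ Q) {b : Θ} (hb : b ∈ T) :
    g a b ≤ ⨆ a ∈ Q, ⨆ b ∈ T, g a b := by
  have key : ∀ {γ : Type _} {S : Set γ} {u : γ → ℝ}, (∀ c ∈ S, u c ≤ 1) → ∀ c,
      (⨆ _ : c ∈ S, u c) ≤ 1 := fun hu c => Real.iSup_le (fun hc => hu c hc) zero_le_one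
  have inner : ∀ a ∈ Q, (⨆ b ∈ T, g a b) ≤ 1 := fun a ha =>
    Real.iSup_le (fun b => key (h1 a ha) b) zero_le_one
  refine le_trans ?_ (le_ciSup_of_le ⟨1, ?_⟩ a
    (le_ciSup_of_le ⟨1, by rintro _ ⟨h, rfl⟩; exact inner a h⟩ ha le_rfl))
  · refine le_ciSup_of_le ⟨1, ?_⟩ b
      (le_ciSup_of_le ⟨1, by rintro _ ⟨h, rfl⟩; exact h1 a ha b h⟩ hb le_rfl)
    rintro _ ⟨c, rfl⟩; exact key (h1 a ha) c
  · rintro _ ⟨c, rfl⟩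
    exact Real.iSup_le (fun h => inner c h) zero_le_one

/-- Le Cam's two-point bound with a `χ²` control, on a finite space. -/
theorem le_sum_error_of_chiSq {Ω : Type*} [Fintype Ω] {m0 m φ : Ω → ℝ} (hm0 : ∀ x, 0 < m0 x)
    (hm0s : ∑ x, m0 x = 1) (hms : ∑ x, m x = 1) (hφ : ∀ x, φ x = 0 ∨ φ x = 1)
    (hchi : ∑ x, m x ^ 2 / m0 x ≤ 1 + 1 / 16) :
    3 / 4 ≤ ∑ x, m0 x * φ x + ∑ x, m x * (1 - φ x) := by
  have h : ∀ x, (-(1 / 8) * m0 x - 2 * (m x ^ 2 / m0 x - 2 * m x + m0 x)) + m x ≤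
      m0 x * φ x + m x * (1 - φ x) := by
    intro x
    have e : m x ^ 2 / m0 x - 2 * m x + m0 x = (m x - m0 x) ^ 2 / m0 x := by
      field_simp [(hm0 x).ne']
      ring
    rw [e]
    have h1 : 0 ≤ (m x - m0 x) ^ 2 / m0 x := by have := hm0 x; positivity
    rcases hφ x with h | h
    · rw [h]; have := hm0 x; linarith
    · rw [h]
      have : (m x - m0 x) ≤ 1 / 8 * m0 x + 2 * ((m x - m0 x) ^ 2 / m0 x) := by
        have h2 : 2 * ((m x - m0 x) ^ 2 / m0 x) + 1 / 8 * m0 x - (m x - m0 x) =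
            2 * (m x - m0 x - m0 x / 4) ^ 2 / m0 x := by
          field_simp [(hm0 x).ne']
          ring
        have h3 : 0 ≤ 2 * (m x - m0 x - m0 x / 4) ^ 2 / m0 x := by have := hm0 x; positivity
        linarith
      linarith
  have hs := Finset.sum_le_sum fun x (_ : x ∈ Finset.univ) => h x
  simp only [Finset.sum_add_distrib, Finset.sum_sub_distrib, ← Finset.mul_sum, hm0s, hms] at hs
  linarith

/-- Second moment of a mixture of product likelihoods. -/
theorem sum_mixture_sq_div {p n : ℕ} {Λ ι : Type*} [Fintype Λ] [Fintype ι] (m0 : Λ → ℝ)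
    (w : ι → ℝ) (m : ι → Fin n → Fin p → Λ → ℝ) :
    ∑ x : Fin n → Fin p → Λ, (∑ i, w i * ∏ t, ∏ j, m i t j (x t j)) ^ 2 /
        ∏ t, ∏ j, m0 (x t j) =
      ∑ i, ∑ i', w i * w i' * ∏ t, ∏ j, ∑ l, m i t j l * m i' t j l / m0 l := by
  simp_rw [prod_prod_sum, sq, Finset.sum_mul_sum, Finset.sum_div, Finset.mul_sum]
  rw [Finset.sum_comm]
  refine Finset.sum_congr rfl fun i _ => ?_
  rw [Finset.sum_comm]
  refine Finset.sum_congr rfl fun i' _ => Finset.sum_congr rfl fun x _ => ?_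
  simp_rw [Finset.prod_div_distrib, Finset.prod_mul_distrib]
  ring

/-- Reduction of the minimax testing lower bound to a second moment computation for a finitely
supported prior, where the noise law is allowed to depend on the signal. -/
theorem half_le_risk_of_prior {p n : ℕ} {α K : ℝ} {Θalt : Set (Fin n → Fin p → ℝ)}
    {Λ ι : Type*} [Fintype Λ] [Fintype ι] {f m0 : Λ → ℝ} (hm0 : ∀ l, 0 < m0 l)
    (hm0s : ∑ l, m0 l = 1) (hG0 : memG α K (dlaw m0 f)) {w : ι → ℝ} (hw : ∀ i, 0 ≤ w i)
    (hws : ∑ i, w i = 1) {θ : ι → Fin n → Fin p → ℝ} {m : ι → Fin n → Fin p → Λ → ℝ}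
    (hm : ∀ i t j l, 0 ≤ m i t j l) (hms : ∀ i t j, ∑ l, m i t j l = 1)
    (hG : ∀ i t j, memG α K (dlaw (m i t j) (fun l => f l - θ i t j)))
    {good : ι → Prop} (hgood : ∀ i, good i → θ i ∈ Θalt)
    (hbad : ∑ i with ¬ good i, w i ≤ 1 / 4)
    (hchi : ∑ i, ∑ i', w i * w i' * ∏ t, ∏ j, ∑ l, m i t j l * m i' t j l / m0 l ≤ 1 + 1 / 16)
    {φ : (Fin n → Fin p → ℝ) → ℝ} (hφ : IsTest p n φ) :
    1 / 2 ≤ risk p n (Gclass p n α K) Θalt φ := by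
  have hφ0 : ∀ x, 0 ≤ φ x := fun x => by rcases hφ.2 x with h | h <;> simp [h]
  have hφ1 : ∀ x, φ x ≤ 1 := fun x => by rcases hφ.2 x with h | h <;> simp [h]
  have hprob : ∀ P ∈ Gclass p n α K, IsProbabilityMeasure P := by
    rintro P ⟨ν, -, h⟩; exact h.1
  have int_le : ∀ P ∈ Gclass p n α K, ∀ g : (Fin n → Fin p → ℝ) → ℝ,
      (∀ x, 0 ≤ g x) → (∀ x, g x ≤ 1) → ∫ x, g x ∂P ≤ 1 := by
    intro P hP g h0 h1
    have := hprob P hP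
    calc ∫ x, g x ∂P ≤ ∫ _, (1 : ℝ) ∂P :=
          integral_mono_of_nonneg (Filter.Eventually.of_forall h0) (integrable_const _)
            (Filter.Eventually.of_forall h1)
      _ = 1 := by simp
  set F : (Fin n → Fin p → Λ) → Fin n → Fin p → ℝ := fun x t j => f (x t j) with hF
  set M0 : (Fin n → Fin p → Λ) → ℝ := fun x => ∏ t, ∏ j, m0 (x t j) with hM0
  set M : ι → (Fin n → Fin p → Λ) → ℝ := fun i x => ∏ t, ∏ j, m i t j (x t j) with hM
  have hM0pos : ∀ x, 0 < M0 x := fun x =>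
    Finset.prod_pos fun t _ => Finset.prod_pos fun j _ => hm0 _
  have hMnn : ∀ i x, 0 ≤ M i x := fun i x =>
    Finset.prod_nonneg fun t _ => Finset.prod_nonneg fun j _ => hm i t j _
  have hMs : ∀ i, ∑ x, M i x = 1 := fun i => by
    rw [hM, ← prod_prod_sum (m i)]; simp [hms]
  have hM0s : ∑ x, M0 x = 1 := by
    rw [hM0, ← prod_prod_sum fun _ _ => m0]; simp [hm0s]
  have null : ∑ x, M0 x * φ (F x) ≤
      ⨆ P ∈ Gclass p n α K, ⨆ θ ∈ Theta0 p n, ∫ E, φ (θ + E) ∂P := by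
    have hP : dlaw M0 F ∈ Gclass p n α K :=
      ⟨fun _ _ => dlaw m0 f, fun _ _ => hG0,
        isEntrywiseProduct_dlaw (fun _ _ l => (hm0 l).le) fun _ _ => hm0s⟩
    have := le_biSup_biSup (Q := Gclass p n α K) (T := Theta0 p n)
      (g := fun P θ => ∫ E, φ (θ + E) ∂P)
      (fun P hP θ _ => int_le P hP _ (fun _ => hφ0 _) fun _ => hφ1 _) hP
      (b := 0) ⟨0, fun _ => rfl⟩
    refine le_trans (le_of_eq ?_) this
    rw [integral_dlaw fun x => (hM0pos x).le]
    simp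
  have alt : ∀ i, good i → ∑ x, M i x * (1 - φ (F x)) ≤
      ⨆ P ∈ Gclass p n α K, ⨆ θ ∈ Θalt, ∫ E, (1 - φ (θ + E)) ∂P := by
    intro i hi
    have hP : dlaw (M i) (fun x t j => f (x t j) - θ i t j) ∈ Gclass p n α K :=
      ⟨fun t j => dlaw (m i t j) (fun l => f l - θ i t j), hG i,
        isEntrywiseProduct_dlaw (f := fun t j l => f l - θ i t j) (hm i) (hms i)⟩
    have := le_biSup_biSup (Q := Gclass p n α K) (T := Θalt)
      (g := fun P θ => ∫ E, (1 - φ (θ + E)) ∂P)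
      (fun P hP θ _ => int_le P hP _ (fun _ => by linarith [hφ1 (θ + ‹_›)])
        fun _ => by linarith [hφ0 (θ + ‹_›)]) hP (hgood i hi)
    refine le_trans (le_of_eq ?_) this
    rw [integral_dlaw (hMnn i)]
    refine Finset.sum_congr rfl fun x _ => ?_
    congr 3
    ext t j
    simp [hF]
  set B := ⨆ P ∈ Gclass p n α K, ⨆ θ ∈ Θalt, ∫ E, (1 - φ (θ + E)) ∂P with hB
  have hB0 : 0 ≤ B := Real.iSup_nonneg fun P => Real.iSup_nonneg fun _ =>
    Real.iSup_nonneg fun θ => Real.iSup_nonneg fun _ =>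
      integral_nonneg fun x => by simpa using hφ1 _
  have mix : ∑ x, (∑ i, w i * M i x) * (1 - φ (F x)) ≤ B + 1 / 4 := by
    calc ∑ x, (∑ i, w i * M i x) * (1 - φ (F x))
        = ∑ i, w i * ∑ x, M i x * (1 - φ (F x)) := by
          simp_rw [Finset.sum_mul, Finset.mul_sum]
          rw [Finset.sum_comm]
          simp_rw [mul_assoc]
      _ ≤ ∑ i, (w i * B + if ¬ good i then w i else 0) := by
          refine Finset.sum_le_sum fun i _ => ?_
          by_cases hi : good i
          · simpa [hi] using mul_le_mul_of_nonneg_left (alt i hi) (hw i)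
          · have : ∑ x, M i x * (1 - φ (F x)) ≤ 1 := by
              refine (Finset.sum_le_sum fun x _ => ?_).trans (hMs i).le
              nlinarith [hMnn i x, hφ0 (F x)]
            have h1 := mul_le_mul_of_nonneg_left this (hw i)
            have h2 := mul_nonneg (hw i) hB0
            simp only [hi, not_false_eq_true, if_true]
            linarith
      _ ≤ B + 1 / 4 := by
          rw [Finset.sum_add_distrib, ← Finset.sum_mul, hws, one_mul, ← Finset.sum_filter]
          linarith
  have key := le_sum_error_of_chiSq (m := fun x => ∑ i, w i * M i x) (φ := fun x => φ (F x))
    hM0pos hM0s ?_ (fun x => hφ.2 _) ?_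
  · have : risk p n (Gclass p n α K) Θalt φ =
      (⨆ P ∈ Gclass p n α K, ⨆ θ ∈ Theta0 p n, ∫ E, φ (θ + E) ∂P) + B := rfl
    rw [this]
    linarith
  · rw [Finset.sum_comm]
    simp_rw [← Finset.mul_sum, hMs, mul_one, hws]
  · rw [sum_mixture_sq_div]
    exact hchi

/-- The signs `-1, 0, 1`. -/
noncomputable def sg : Fin 3 → ℝ := ![-1, 0, 1]

/-- The law on the labels `{-1, 0, 1}` whose image under doubling has mean `θ` and variance `1`. -/
noncomputable def threePt (θ : ℝ) : Fin 3 → ℝ :=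
  ![(1 - θ) ^ 2 / 8, (3 - θ ^ 2) / 4, (1 + θ) ^ 2 / 8]

theorem abs_sg_le_one (i : Fin 3) : |sg i| ≤ 1 := by
  fin_cases i <;> simp [sg]

theorem threePt_nonneg {θ : ℝ} (hθ : |θ| ≤ 1) (l : Fin 3) : 0 ≤ threePt θ l := by
  have : θ ^ 2 ≤ 1 := (sq_le_one_iff_abs_le_one θ).2 hθ
  fin_cases l
  · simp [threePt]; positivity
  · simp [threePt]; linarith
  · simp [threePt]; positivity

theorem threePt_zero_pos (l : Fin 3) : 0 < threePt 0 l := by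
  fin_cases l <;> simp [threePt]

theorem sum_threePt (θ : ℝ) : ∑ l, threePt θ l = 1 := by
  simp [Fin.sum_univ_three, threePt]; ring

theorem sum_threePt_mul_div (θ θ' : ℝ) :
    ∑ l, threePt θ l * threePt θ' l / threePt 0 l =
      1 + θ * θ' + (θ * θ') ^ 2 / 3 := by
  simp [Fin.sum_univ_three, threePt]; ring

theorem memG_dlaw_of_bounded {Λ : Type*} [Fintype Λ] {α K : ℝ} (hα : 0 < α) (hK : 0 < K)
    (hK3 : (3 / K) ^ α ≤ 1 / 4) {m : Λ → ℝ} {f : Λ → ℝ} (hm : ∀ l, 0 ≤ m l)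
    (hm1 : ∑ l, m l = 1) (hmean : ∑ l, m l * f l = 0) (hvar : ∑ l, m l * f l ^ 2 = 1)
    (hf : ∀ l, m l ≠ 0 → |f l| ≤ 3) : memG α K (dlaw m f) := by
  refine memG_dlaw hm hm1 hmean hvar ?_
  have h : ∀ l, m l * Real.exp (|f l / K| ^ α) ≤ m l * 2 := by
    intro l
    rcases eq_or_ne (m l) 0 with h0 | h0
    · simp [h0]
    · refine mul_le_mul_of_nonneg_left ?_ (hm l)
      have h1 : |f l / K| ^ α ≤ 1 / 4 := by
        refine le_trans (Real.rpow_le_rpow (abs_nonneg _) ?_ hα.le) hK3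
        rw [abs_div, abs_of_pos hK]
        gcongr
        exact hf l h0
      calc Real.exp (|f l / K| ^ α) ≤ Real.exp (Real.log 2) := by
            apply Real.exp_le_exp.2
            linarith [Real.log_two_gt_d9]
        _ = 2 := Real.exp_log (by norm_num)
  calc _ ≤ ∑ l, m l * 2 := Finset.sum_le_sum fun l _ => h l
    _ = 2 := by rw [← Finset.sum_mul, hm1, one_mul]

theorem memG_threePt {α K : ℝ} (hα : 0 < α) (hK : 0 < K) (hK3 : (3 / K) ^ α ≤ 1 / 4) {θ : ℝ}
    (hθ : |θ| ≤ 1) : memG α K (dlaw (threePt θ) fun l => 2 * sg l - θ) := by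
  refine memG_dlaw_of_bounded hα hK hK3 (threePt_nonneg hθ) (sum_threePt θ) ?_ ?_ ?_
  · simp [Fin.sum_univ_three, threePt, sg]; ring
  · simp [Fin.sum_univ_three, threePt, sg]; ring
  · intro l _
    have h1 := abs_le.1 hθ
    have h2 := abs_le.1 (abs_sg_le_one l)
    rw [abs_le]
    constructor <;> linarith [h1.1, h1.2, h2.1, h2.2]

theorem exp_mul_le_of_mem_Icc {u x : ℝ} (h0 : 0 ≤ u) (h1 : u ≤ 1) :
    Real.exp (u * x) ≤ 1 + u * Real.exp x - u := by
  have := convexOn_exp.2 (Set.mem_univ x) (Set.mem_univ (0 : ℝ)) h0 (sub_nonneg.2 h1)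
    (by ring)
  simp only [smul_eq_mul, mul_zero, add_zero, Real.exp_zero, mul_one] at this
  linarith

/-- Correlation between the dyadic change locations `4^i` and `4^l`. -/
noncomputable def timeKer (i l : ℕ) : ℝ := 4 ^ min i l / (2 ^ i * 2 ^ l)

theorem timeKer_nonneg (i l : ℕ) : 0 ≤ timeKer i l := by unfold timeKer; positivity

theorem timeKer_comm (i l : ℕ) : timeKer i l = timeKer l i := by
  unfold timeKer; rw [min_comm, mul_comm]

theorem timeKer_of_le {i l : ℕ} (h : i ≤ l) : timeKer i l = 2 ^ i / 2 ^ l := by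
  unfold timeKer
  rw [min_eq_left h, show (4 : ℝ) = 2 * 2 by norm_num, mul_pow]
  field_simp

theorem timeKer_le_one (i l : ℕ) : timeKer i l ≤ 1 := by
  wlog h : i ≤ l generalizing i l
  · rw [timeKer_comm]; exact this _ _ (le_of_not_ge h)
  rw [timeKer_of_le h, div_le_one (by positivity)]
  exact pow_le_pow_right₀ (by norm_num) h

theorem sum_timeKer_lt (T : ℕ) : ∑ i ∈ Finset.range T, timeKer i T ≤ 1 := by
  have : ∑ i ∈ Finset.range T, timeKer i T = ∑ i ∈ Finset.range T, (2 : ℝ) ^ i / 2 ^ T :=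
    Finset.sum_congr rfl fun i hi => timeKer_of_le (Finset.mem_range.1 hi).le
  rw [this, ← Finset.sum_div, geom_sum_eq (by norm_num), div_le_one (by positivity)]
  norm_num

theorem sum_sum_timeKer_le (T : ℕ) :
    ∑ i : Fin T, ∑ l : Fin T, timeKer i l ≤ 3 * T := by
  have h : ∀ T : ℕ, ∑ i ∈ Finset.range T, ∑ l ∈ Finset.range T, timeKer i l ≤ 3 * T := by
    intro T
    induction T with
    | zero => simp
    | succ T ih =>
      simp_rw [Finset.sum_range_succ, Finset.sum_add_distrib]
      have h1 := sum_timeKer_lt T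
      have h2 : ∑ l ∈ Finset.range T, timeKer T l ≤ 1 := by
        simp_rw [timeKer_comm T]; exact h1
      have h3 := timeKer_le_one T T
      push_cast
      linarith
  have := h T
  simpa [Finset.sum_range] using this

theorem prod_ite_lt_eq_pow {n M : ℕ} (hM : M ≤ n) (x : ℝ) :
    ∏ t : Fin n, (if (t : ℕ) < M then x else 1) = x ^ M := by
  rw [Finset.prod_ite, Finset.prod_const, Finset.prod_const_one, mul_one]
  congr 1
  have := Fin.card_filter_val_lt (n := n) (m := M)
  simp_all

theorem one_le_log_eight_mul {n : ℕ} (hn : 2 ≤ n) : 1 ≤ Real.log (8 * n) := by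
  rw [Real.le_log_iff_exp_le (by positivity)]
  have : (2 : ℝ) ≤ n := by exact_mod_cast hn
  linarith [Real.exp_one_lt_d9]

theorem LL_nonneg {n : ℕ} (hn : 2 ≤ n) : 0 ≤ LL n := Real.log_nonneg (one_le_log_eight_mul hn)

theorem exp_LL {n : ℕ} (hn : 2 ≤ n) : Real.exp (LL n) = Real.log (8 * n) :=
  Real.exp_log (by linarith [one_le_log_eight_mul hn])

theorem one_le_log_four {n : ℕ} (hn : 2 ≤ n) : 1 ≤ Nat.log 4 (2 * n) :=
  (Nat.le_log_iff_pow_le (by norm_num) (by omega)).2 (by omega)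

theorem two_mul_four_pow_le {n k : ℕ} (hn : 2 ≤ n) (hk : k < Nat.log 4 (2 * n)) :
    2 * 4 ^ k ≤ n := by
  have h1 : 4 ^ (k + 1) ≤ 2 * n :=
    (Nat.le_log_iff_pow_le (by norm_num) (by omega)).1 hk
  rw [pow_succ] at h1
  omega

theorem log_eight_mul_le {n : ℕ} (hn : 2 ≤ n) :
    Real.log (8 * n) ≤ 5 * (Nat.log 4 (2 * n) : ℕ) := by
  have h1 : 2 * n < 4 ^ (Nat.log 4 (2 * n) + 1) := Nat.lt_pow_succ_log_self (by norm_num) _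
  have h2 : (8 * n : ℝ) ≤ 4 ^ (Nat.log 4 (2 * n) + 2) := by
    have : 8 * n ≤ 4 ^ (Nat.log 4 (2 * n) + 2) := by
      rw [pow_succ]; omega
    exact_mod_cast this
  have h3 : Real.log (8 * n) ≤ (Nat.log 4 (2 * n) + 2 : ℕ) * Real.log 4 := by
    rw [← Real.log_pow]
    exact Real.log_le_log (by positivity) h2
  have h4 : Real.log 4 = 2 * Real.log 2 := by
    rw [show (4 : ℝ) = 2 ^ 2 by norm_num, Real.log_pow]; norm_num
  have h5 : (1 : ℝ) ≤ (Nat.log 4 (2 * n) : ℕ) := by exact_mod_cast one_le_log_four hn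
  rw [h4] at h3
  push_cast at h3
  nlinarith [Real.log_two_lt_d9]

theorem mem_Theta1_of_two_mul_le {p n s : ℕ} {ρ : ℝ} {t0 : ℕ} (h1 : 1 ≤ t0) (h2 : 2 * t0 ≤ n)
    {v : Fin p → ℝ} (hs : l0 p v ≤ s) (hρ : ρ ^ 2 ≤ t0 / 2 * sqnorm p v) :
    (fun t j => if (t : ℕ) < t0 then v j else 0 : Fin n → Fin p → ℝ) ∈ Theta1 p n s ρ := by
  refine Set.mem_iUnion₂.2 ⟨t0, Finset.mem_Icc.2 ⟨h1, by omega⟩, v, 0, ?_, ?_, ?_, ?_⟩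
  · intro t ht; ext j; simp [ht]
  · intro t ht; ext j; simp [ht]
  · simpa using hs
  · simp only [Pi.zero_apply, sub_zero]
    refine hρ.trans (mul_le_mul_of_nonneg_right ?_ (Finset.sum_nonneg fun j _ => sq_nonneg _))
    have hn : (0 : ℝ) < n := by exact_mod_cast (by omega : 0 < n)
    have h2' : 2 * (t0 : ℝ) ≤ n := by exact_mod_cast h2
    rw [le_div_iff₀ hn]
    have : (0 : ℝ) ≤ t0 := by positivity
    nlinarith

theorem l0_smul_le (p : ℕ) (a : ℝ) (v : Fin p → ℝ) : l0 p (fun j => a * v j) ≤ l0 p v := by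
  refine Finset.card_le_card fun j hj => ?_
  simp only [Finset.mem_filter, Finset.mem_univ, true_and] at hj ⊢
  exact right_ne_zero_of_mul hj

theorem sqnorm_smul (p : ℕ) (a : ℝ) (v : Fin p → ℝ) :
    sqnorm p (fun j => a * v j) = a ^ 2 * sqnorm p v := by
  simp [sqnorm, mul_pow, Finset.mul_sum]

/-- Lower bound from a prior which places the change uniformly on a geometric grid of locations,
in a random direction `ξ`. -/
theorem half_le_risk_of_direction_prior {p n s : ℕ} {α K ρ β c : ℝ} {Ξ : Type*} [Fintype Ξ]
    (hα : 0 < α) (hK : 0 < K) (hK3 : (3 / K) ^ α ≤ 1 / 4) (hn : 2 ≤ n)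
    {w : Ξ → ℝ} (hw : ∀ x, 0 ≤ w x) (hws : ∑ x, w x = 1) {ξ : Ξ → Fin p → ℝ}
    (hξ : ∀ x j, |ξ x j| ≤ 1) (hβ0 : 0 ≤ β) (hβ : β ^ 2 ≤ max 1 (LL n / 10))
    (hc0 : 0 ≤ c) (hc : c ≤ 1 / 480) {good : Ξ → Prop}
    (hgood : ∀ x, good x → l0 p (ξ x) ≤ s ∧ ρ ^ 2 ≤ β ^ 2 / 2 * sqnorm p (ξ x))
    (hbad : ∑ x with ¬ good x, w x ≤ 1 / 4)
    (hcorr : ∀ (M : ℕ) (v u : ℝ), 0 ≤ v → v ≤ 1 → 0 ≤ u → u ≤ 1 → M * v = β ^ 2 * u →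
      ∑ x, ∑ x', w x * w x' *
        ∏ j, (1 + v * (ξ x j * ξ x' j) + (v * (ξ x j * ξ x' j)) ^ 2 / 3) ^ M ≤
        Real.exp (c * u * LL n))
    {φ : (Fin n → Fin p → ℝ) → ℝ} (hφ : IsTest p n φ) :
    1 / 2 ≤ risk p n (Gclass p n α K) (Theta1 p n s ρ) φ := by
  set h := Nat.log 4 (2 * n) with hh
  have h1 : 1 ≤ h := one_le_log_four hn
  have hy := log_eight_mul_le hn
  rw [← hh] at hy
  set k0 := h / 2 with hk0
  set T := h - k0 with hT
  have hT1 : 1 ≤ T := by omega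
  have hTpos : (0 : ℝ) < T := by exact_mod_cast hT1
  have hTh : (h : ℝ) ≤ 2 * T := by exact_mod_cast (by omega : h ≤ 2 * T)
  have hβk : β ≤ 2 ^ k0 := by
    have h2 : max 1 (LL n / 10) ≤ (2 ^ k0 : ℝ) ^ 2 := by
      have e1 : (1 : ℝ) ≤ 2 ^ k0 := one_le_pow₀ (by norm_num)
      refine max_le (one_le_pow₀ e1) ?_
      have e2 : LL n ≤ Real.log (8 * n) := Real.log_le_self (by
        linarith [one_le_log_eight_mul hn])
      have e3 : (h : ℝ) ≤ 2 * 2 ^ k0 := by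
        have : h ≤ 2 * 2 ^ k0 := by have := Nat.lt_two_pow_self (n := k0); omega
        exact_mod_cast this
      nlinarith
    exact le_of_sq_le_sq (hβ.trans h2) (by positivity)
  set b : Fin T → ℝ := fun i => β / 2 ^ (i + k0 : ℕ) with hb
  have hb0 : ∀ i, 0 ≤ b i := fun i => by positivity
  have hb1 : ∀ i, b i ≤ 1 := fun i => by
    rw [hb, div_le_one (by positivity)]
    exact hβk.trans (pow_le_pow_right₀ (by norm_num) (by omega))
  set θ : Fin T × Ξ → Fin n → Fin p → ℝ :=
    fun i t j => if (t : ℕ) < 4 ^ (i.1 + k0 : ℕ) then b i.1 * ξ i.2 j else 0 with hθ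
  have hθ1 : ∀ i t j, |θ i t j| ≤ 1 := by
    intro i t j
    simp only [hθ]
    split_ifs
    · rw [abs_mul, abs_of_nonneg (hb0 _)]
      exact mul_le_one₀ (hb1 _) (abs_nonneg _) (hξ _ _)
    · simp
  have hgrid : ∀ i : Fin T, 2 * 4 ^ (i + k0 : ℕ) ≤ n := fun i =>
    two_mul_four_pow_le hn (by omega)
  refine half_le_risk_of_prior (Λ := Fin 3) (ι := Fin T × Ξ) (f := fun l => 2 * sg l)
    (m0 := threePt 0) threePt_zero_pos (sum_threePt 0)
    (by simpa using memG_threePt hα hK hK3 (θ := 0) (by simp))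
    (w := fun i => 1 / T * w i.2) (fun i => mul_nonneg (by positivity) (hw _)) ?_
    (θ := θ) (m := fun i t j => threePt (θ i t j)) (fun i t j => threePt_nonneg (hθ1 i t j))
    (fun i t j => sum_threePt _) (fun i t j => memG_threePt hα hK hK3 (hθ1 i t j))
    (good := fun i => good i.2) ?_ ?_ ?_ hφ
  · simp_rw [Fintype.sum_prod_type, ← Finset.mul_sum, hws]
    simp [hTpos.ne']
  · rintro ⟨i, x⟩ hx
    obtain ⟨g1, g2⟩ := hgood x hx
    refine mem_Theta1_of_two_mul_le (v := fun j => b i * ξ x j) (Nat.one_le_pow _ _ (by norm_num))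
      (hgrid i) ((l0_smul_le _ _ _).trans g1) (g2.trans (le_of_eq ?_))
    rw [sqnorm_smul, hb]
    have : ((4 ^ (i + k0 : ℕ) : ℕ) : ℝ) = (2 ^ (i + k0 : ℕ)) ^ 2 := by
      push_cast
      rw [← pow_mul, mul_comm, pow_mul]; norm_num
    rw [this]
    field_simp
  · rw [Finset.sum_filter, Fintype.sum_prod_type]
    have : ∀ i : Fin T, ∑ x, (if ¬ good x then 1 / T * w x else 0) ≤ 1 / T * (1 / 4) := by
      intro i
      rw [← Finset.sum_filter, ← Finset.mul_sum]
      exact mul_le_mul_of_nonneg_left hbad (by positivity)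
    refine (Finset.sum_le_sum fun i _ => this i).trans (le_of_eq ?_)
    simp [hTpos.ne']
  · simp_rw [sum_threePt_mul_div]
    have hprod : ∀ (i l : Fin T) (x x' : Ξ),
        ∏ t, ∏ j, (1 + θ (i, x) t j * θ (l, x') t j + (θ (i, x) t j * θ (l, x') t j) ^ 2 / 3) =
        ∏ j, (1 + b i * b l * (ξ x j * ξ x' j) + (b i * b l * (ξ x j * ξ x' j)) ^ 2 / 3) ^
          4 ^ (min (i : ℕ) l + k0 : ℕ) := by
      intro i l x x'
      rw [Finset.prod_comm]
      refine Finset.prod_congr rfl fun j _ => ?_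
      have hle : 4 ^ (min (i : ℕ) l + k0 : ℕ) ≤ n := by
        have := hgrid (min i l)
        rw [Fin.coe_min] at this
        omega
      rw [← prod_ite_lt_eq_pow hle]
      refine Finset.prod_congr rfl fun t _ => ?_
      have e : (4 : ℕ) ^ (min (i : ℕ) l + k0 : ℕ) = min (4 ^ (i + k0 : ℕ)) (4 ^ (l + k0 : ℕ)) := by
        rw [← min_add_add_right]
        exact (pow_right_mono₀ (by norm_num : 1 ≤ 4)).map_min
      simp only [hθ]
      rw [e]
      by_cases ht1 : (t : ℕ) < 4 ^ (i + k0 : ℕ) <;> by_cases ht2 : (t : ℕ) < 4 ^ (l + k0 : ℕ) <;>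
        simp [ht1, ht2]
      ring
    have hpair : ∀ i l : Fin T, ∑ x, ∑ x', w x * w x' *
        ∏ t, ∏ j, (1 + θ (i, x) t j * θ (l, x') t j + (θ (i, x) t j * θ (l, x') t j) ^ 2 / 3) ≤
        1 + c * Real.log (8 * n) * timeKer i l := by
      intro i l
      simp_rw [hprod]
      refine (hcorr _ (b i * b l) (timeKer i l) (mul_nonneg (hb0 i) (hb0 l))
        (mul_le_one₀ (hb1 i) (hb0 l) (hb1 l)) (timeKer_nonneg _ _) (timeKer_le_one _ _) ?_).trans ?_
      · simp only [hb, timeKer]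
        push_cast
        rw [pow_add, pow_add, pow_add, show (4 : ℝ) ^ k0 = 2 ^ k0 * 2 ^ k0 by
          rw [← mul_pow]; norm_num]
        field_simp
      · have k1 := timeKer_le_one i l
        have k2 := timeKer_nonneg i l
        have := exp_mul_le_of_mem_Icc (u := c * timeKer i l) (x := LL n) (by positivity)
          (by nlinarith)
        rw [exp_LL hn] at this
        nlinarith [mul_nonneg hc0 k2]
    calc _ = ∑ i : Fin T, ∑ l : Fin T, 1 / T * (1 / T) * (∑ x, ∑ x', w x * w x' *
        ∏ t, ∏ j, (1 + θ (i, x) t j * θ (l, x') t j +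
          (θ (i, x) t j * θ (l, x') t j) ^ 2 / 3)) := by
          simp_rw [Fintype.sum_prod_type, Finset.mul_sum]
          refine Finset.sum_congr rfl fun i _ => ?_
          rw [Finset.sum_comm]
          refine Finset.sum_congr rfl fun l _ => Finset.sum_congr rfl fun x _ =>
            Finset.sum_congr rfl fun x' _ => ?_
          ring
      _ ≤ ∑ i : Fin T, ∑ l : Fin T, 1 / T * (1 / T) *
          (1 + c * Real.log (8 * n) * timeKer i l) := by
          gcongr with i _ l _
          exact hpair i l
      _ = 1 + c * Real.log (8 * n) * (1 / T * (1 / T)) * ∑ i : Fin T, ∑ l : Fin T,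
            timeKer i l := by
          simp_rw [mul_add, Finset.sum_add_distrib, Finset.mul_sum]
          congr 1
          · simp [hTpos.ne']
          · refine Finset.sum_congr rfl fun i _ => Finset.sum_congr rfl fun l _ => ?_
            ring
      _ ≤ 1 + c * Real.log (8 * n) * (1 / T * (1 / T)) * (3 * T) := by
          have := one_le_log_eight_mul hn
          gcongr
          exact sum_sum_timeKer_le T
      _ = 1 + c * (3 * (Real.log (8 * n) / T)) := by field_simp
      _ ≤ 1 + 1 / 480 * (3 * 10) := by
          have h10 : Real.log (8 * n) / T ≤ 10 := by
            rw [div_le_iff₀ hTpos]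
            linarith
          have h0 : 0 ≤ Real.log (8 * n) / T :=
            div_nonneg (by linarith [one_le_log_eight_mul hn]) hTpos.le
          gcongr
      _ = 1 + 1 / 16 := by norm_num

theorem half_le_risk_of_sq_le_LL {p n s : ℕ} {α K ρ : ℝ} (hα : 0 < α) (hK : 0 < K)
    (hK3 : (3 / K) ^ α ≤ 1 / 4) (hp : 0 < p) (hn : 2 ≤ n) (hs : 1 ≤ s)
    (hρ : ρ ^ 2 ≤ 1 / 5000 * LL n) {φ : (Fin n → Fin p → ℝ) → ℝ} (hφ : IsTest p n φ) :
    1 / 2 ≤ risk p n (Gclass p n α K) (Theta1 p n s ρ) φ := by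
  have hLL := LL_nonneg hn
  have hβ : (Real.sqrt (2 * ρ ^ 2)) ^ 2 = 2 * ρ ^ 2 := Real.sq_sqrt (by positivity)
  refine half_le_risk_of_direction_prior (Ξ := Unit) (w := fun _ => 1)
    (ξ := fun _ j => if j = ⟨0, hp⟩ then 1 else 0) (β := Real.sqrt (2 * ρ ^ 2)) (c := 1 / 480)
    (good := fun _ => True)
    hα hK hK3 hn (by simp) (by simp) ?_ (Real.sqrt_nonneg _) ?_ (by norm_num) le_rfl ?_ (by simp)
    ?_ hφ
  · intro _ j; split_ifs <;> simp
  · rw [hβ]; exact le_max_of_le_right (by linarith)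
  · intro _ _
    rw [hβ]
    constructor
    · simpa [l0, Finset.filter_eq'] using hs
    · simp [sqnorm]
  · intro M v u hv0 hv1 hu0 _ hMv
    rw [hβ] at hMv
    simp only [Finset.univ_unique, Finset.sum_singleton, mul_one, one_mul]
    rw [Finset.prod_eq_single ⟨0, hp⟩ (fun j _ hj => by simp [hj]) (by simp)]
    simp only [if_true, mul_one]
    calc (1 + v + v ^ 2 / 3) ^ M ≤ (Real.exp (v * (4 / 3))) ^ M := by
          gcongr
          have := Real.add_one_le_exp (v * (4 / 3))
          nlinarith
      _ = Real.exp (M * v * (4 / 3)) := by rw [← Real.exp_nat_mul]; ring_nf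
      _ ≤ Real.exp (1 / 480 * u * LL n) := by
          rw [hMv]
          apply Real.exp_le_exp.2
          nlinarith [mul_le_mul_of_nonneg_right hρ hu0, mul_nonneg hu0 hLL]

/-- Marginal of the sparse symmetric prior, on the labels `{-1, 0, 1}`. -/
noncomputable def spW (q : ℝ) : Fin 3 → ℝ := ![q / 2, 1 - q, q / 2]

theorem spW_nonneg {q : ℝ} (h0 : 0 ≤ q) (h1 : q ≤ 1) (c : Fin 3) : 0 ≤ spW q c := by
  fin_cases c <;> simp [spW] <;> linarith

theorem sum_spW (q : ℝ) : ∑ c, spW q c = 1 := by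
  simp [Fin.sum_univ_three, spW]; ring

theorem sum_prod_spW (p : ℕ) (q : ℝ) : ∑ σ : Fin p → Fin 3, ∏ j, spW q (σ j) = 1 := by
  rw [← Fintype.prod_sum fun (_ : Fin p) => spW q]
  simp [sum_spW]

theorem sum_sum_prod_mul_prod {κ : Type*} [Fintype κ] (p : ℕ) (w : κ → ℝ) (A : κ → κ → ℝ) :
    ∑ σ : Fin p → κ, ∑ σ' : Fin p → κ, (∏ j, w (σ j)) * (∏ j, w (σ' j)) *
        ∏ j, A (σ j) (σ' j) = (∑ c, ∑ c', w c * w c' * A c c') ^ p := by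
  have h : (∑ c, ∑ c', w c * w c' * A c c') ^ p =
      ∏ _j : Fin p, ∑ c, ∑ c', w c * w c' * A c c' := by simp
  rw [h, Fintype.prod_sum]
  refine Finset.sum_congr rfl fun σ _ => ?_
  rw [Fintype.prod_sum]
  refine Finset.sum_congr rfl fun σ' _ => ?_
  simp_rw [Finset.prod_mul_distrib]

theorem l0_sg {p : ℕ} (σ : Fin p → Fin 3) :
    (l0 p (fun j => sg (σ j)) : ℝ) = ∑ j, sg (σ j) ^ 2 := by
  unfold l0
  rw [Finset.card_filter]
  push_cast
  refine Finset.sum_congr rfl fun j _ => ?_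
  generalize σ j = c
  fin_cases c <;> simp [sg]

/-- Exponential moments of the number of nonzero coordinates under the sparse prior. -/
theorem sum_prod_spW_mul_exp_le {p : ℕ} {q : ℝ} (h0 : 0 ≤ q) (h1 : q ≤ 1) (lam : ℝ) :
    ∑ σ : Fin p → Fin 3, (∏ j, spW q (σ j)) * Real.exp (lam * ∑ j, sg (σ j) ^ 2) ≤
      Real.exp (p * q * (Real.exp lam - 1)) := by
  have h : ∀ σ : Fin p → Fin 3, (∏ j, spW q (σ j)) * Real.exp (lam * ∑ j, sg (σ j) ^ 2) =
      ∏ j, (spW q (σ j) * Real.exp (lam * sg (σ j) ^ 2)) := fun σ => by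
    rw [Finset.mul_sum, Real.exp_sum, Finset.prod_mul_distrib]
  simp_rw [h]
  rw [← Fintype.prod_sum fun (_ : Fin p) c => spW q c * Real.exp (lam * sg c ^ 2),
    Finset.prod_const, Finset.card_univ, Fintype.card_fin]
  have e : ∑ c, spW q c * Real.exp (lam * sg c ^ 2) = q * (Real.exp lam - 1) + 1 := by
    simp [Fin.sum_univ_three, spW, sg]; ring
  rw [e, mul_assoc, Real.exp_nat_mul]
  refine pow_le_pow_left₀ ?_ (Real.add_one_le_exp _) p
  nlinarith [Real.exp_pos lam]

/-- The number of nonzero coordinates under the sparse prior with mean `s / 2` lies in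
`[s / 8, s]` with probability at least `3 / 4`. -/
theorem sum_prod_spW_bad_le {p s : ℕ} (hs : 64 ≤ s) (hsp : s ≤ p) :
    ∑ σ : Fin p → Fin 3 with
        ¬ ((s : ℝ) / 8 ≤ ∑ j, sg (σ j) ^ 2 ∧ ∑ j, sg (σ j) ^ 2 ≤ (s : ℝ)),
      ∏ j, spW (s / (2 * p)) (σ j) ≤ 1 / 4 := by
  set q : ℝ := s / (2 * p) with hq
  have hs' : (64 : ℝ) ≤ s := by exact_mod_cast hs
  have hp' : (s : ℝ) ≤ p := by exact_mod_cast hsp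
  have hp0 : (0 : ℝ) < p := by linarith
  have hq0 : 0 ≤ q := by positivity
  have hq1 : q ≤ 1 := by rw [hq, div_le_one (by positivity)]; linarith
  have hpq : p * q = s / 2 := by rw [hq]; field_simp
  have hW : ∀ σ : Fin p → Fin 3, 0 ≤ ∏ j, spW q (σ j) := fun σ =>
    Finset.prod_nonneg fun j _ => spW_nonneg hq0 hq1 _
  have up := sum_prod_spW_mul_exp_le (p := p) hq0 hq1 1
  have lo := sum_prod_spW_mul_exp_le (p := p) hq0 hq1 (-1)
  rw [hpq] at up lo
  have he1 : Real.exp (-1) ≤ 1 / 2 := by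
    rw [Real.exp_neg, one_div]
    exact inv_anti₀ (by norm_num) (by linarith [Real.exp_one_gt_d9])
  have hup : Real.exp (-s) * Real.exp (s / 2 * (Real.exp 1 - 1)) ≤ Real.exp (-3) := by
    rw [← Real.exp_add]
    apply Real.exp_le_exp.2
    nlinarith [Real.exp_one_lt_d9]
  have hlo : Real.exp (s / 8) * Real.exp (s / 2 * (Real.exp (-1) - 1)) ≤ Real.exp (-3) := by
    rw [← Real.exp_add]
    apply Real.exp_le_exp.2
    nlinarith
  have he : Real.exp (-3) ≤ 1 / 8 := by
    calc Real.exp (-3) = Real.exp (-1) ^ 3 := by rw [← Real.exp_nat_mul]; norm_num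
      _ ≤ (1 / 2) ^ 3 := by gcongr
      _ = 1 / 8 := by norm_num
  rw [Finset.sum_filter]
  calc _ ≤ ∑ σ : Fin p → Fin 3, (Real.exp (-s) *
          ((∏ j, spW q (σ j)) * Real.exp (1 * ∑ j, sg (σ j) ^ 2)) + Real.exp (s / 8) *
          ((∏ j, spW q (σ j)) * Real.exp (-1 * ∑ j, sg (σ j) ^ 2))) := by
        refine Finset.sum_le_sum fun σ _ => ?_
        have e1 : Real.exp (-s) *
          ((∏ j, spW q (σ j)) * Real.exp (1 * ∑ j, sg (σ j) ^ 2)) =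
            (∏ j, spW q (σ j)) * Real.exp (∑ j, sg (σ j) ^ 2 - s) := by
          rw [sub_eq_add_neg, Real.exp_add, one_mul]; ring
        have e2 : Real.exp (s / 8) *
          ((∏ j, spW q (σ j)) * Real.exp (-1 * ∑ j, sg (σ j) ^ 2)) =
            (∏ j, spW q (σ j)) * Real.exp (s / 8 - ∑ j, sg (σ j) ^ 2) := by
          rw [sub_eq_add_neg, Real.exp_add, neg_one_mul]; ring
        rw [e1, e2, ← mul_add]
        split_ifs with hc
        · have := hW σ
          positivity
        · refine le_mul_of_one_le_right (hW σ) ?_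
          rcases not_and_or.1 hc with h | h
          · have : 1 ≤ Real.exp (s / 8 - ∑ j, sg (σ j) ^ 2) :=
              Real.one_le_exp (by linarith [not_le.1 h])
            linarith [Real.exp_pos (∑ j, sg (σ j) ^ 2 - s)]
          · have : 1 ≤ Real.exp (∑ j, sg (σ j) ^ 2 - s) :=
              Real.one_le_exp (by linarith [not_le.1 h])
            linarith [Real.exp_pos (s / 8 - ∑ j, sg (σ j) ^ 2)]
    _ ≤ Real.exp (-s) * Real.exp (s / 2 * (Real.exp 1 - 1)) +
          Real.exp (s / 8) * Real.exp (s / 2 * (Real.exp (-1) - 1)) := by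
        rw [Finset.sum_add_distrib, ← Finset.mul_sum, ← Finset.mul_sum]
        gcongr
    _ ≤ 1 / 4 := by linarith

theorem half_pow_add_pow_le {M : ℕ} {v : ℝ} (hv0 : 0 ≤ v) (hv1 : v ≤ 1) :
    ((1 + v + v ^ 2 / 3) ^ M + (1 - v + v ^ 2 / 3) ^ M) / 2 ≤ Real.exp ((M * v) ^ 2) := by
  have h1 : (1 + v + v ^ 2 / 3) ^ M ≤ Real.exp (M * v ^ 2 / 3) * Real.exp (M * v) := by
    calc (1 + v + v ^ 2 / 3) ^ M ≤ Real.exp (v + v ^ 2 / 3) ^ M := by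
          gcongr; linarith [Real.add_one_le_exp (v + v ^ 2 / 3)]
      _ = _ := by rw [← Real.exp_nat_mul, ← Real.exp_add]; ring_nf
  have h2 : (1 - v + v ^ 2 / 3) ^ M ≤ Real.exp (M * v ^ 2 / 3) * Real.exp (-(M * v)) := by
    calc (1 - v + v ^ 2 / 3) ^ M ≤ Real.exp (-v + v ^ 2 / 3) ^ M := by
          refine pow_le_pow_left₀ (by nlinarith) ?_ M
          linarith [Real.add_one_le_exp (-v + v ^ 2 / 3)]
      _ = _ := by rw [← Real.exp_nat_mul, ← Real.exp_add]; ring_nf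
  have h3 : Real.exp (M * v ^ 2 / 3) * Real.cosh (M * v) ≤ Real.exp ((M * v) ^ 2) := by
    calc _ ≤ Real.exp (M * v ^ 2 / 3) * Real.exp ((M * v) ^ 2 / 2) := by
          gcongr; exact Real.cosh_le_exp_half_sq _
      _ ≤ _ := by
          rw [← Real.exp_add]
          apply Real.exp_le_exp.2
          have : (M : ℝ) ≤ M ^ 2 := by exact_mod_cast Nat.le_self_pow two_ne_zero M
          nlinarith [mul_le_mul_of_nonneg_right this (sq_nonneg v), sq_nonneg (M * v)]
  rw [Real.cosh_eq] at h3
  linarith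

theorem sum_sum_spW_mul_pow (q v : ℝ) (M : ℕ) :
    ∑ c, ∑ c', spW q c * spW q c' *
        (1 + v * (sg c * sg c') + (v * (sg c * sg c')) ^ 2 / 3) ^ M =
      1 - q ^ 2 + q ^ 2 * (((1 + v + v ^ 2 / 3) ^ M + (1 - v + v ^ 2 / 3) ^ M) / 2) := by
  simp [Fin.sum_univ_three, spW, sg, ← sub_eq_add_neg]
  ring

/-- Second moment of the sparse symmetric prior, for a common change location. -/
theorem sum_sum_prod_spW_corr_le {p M : ℕ} {q v : ℝ} (hq0 : 0 ≤ q) (hq1 : q ≤ 1) (hv0 : 0 ≤ v)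
    (hv1 : v ≤ 1) (hz1 : M * v ≤ 1) :
    ∑ σ : Fin p → Fin 3, ∑ σ' : Fin p → Fin 3, (∏ j, spW q (σ j)) * (∏ j, spW q (σ' j)) *
        ∏ j, (1 + v * (sg (σ j) * sg (σ' j)) + (v * (sg (σ j) * sg (σ' j))) ^ 2 / 3) ^ M ≤
      Real.exp (p * (2 * q ^ 2 * (M * v) ^ 2)) := by
  rw [sum_sum_prod_mul_prod p (spW q)
    (fun c c' => (1 + v * (sg c * sg c') + (v * (sg c * sg c')) ^ 2 / 3) ^ M)]
  have e := sum_sum_spW_mul_pow q v M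
  rw [e]
  have hz0 : 0 ≤ M * v := by positivity
  have hz2 : (M * v) ^ 2 ≤ 1 := by nlinarith
  have h1 := half_pow_add_pow_le (M := M) hv0 hv1
  have h2 := exp_mul_le_of_mem_Icc (u := (M * v) ^ 2) (x := 1) (sq_nonneg _) hz2
  rw [mul_one] at h2
  have h3 : ((1 + v + v ^ 2 / 3) ^ M + (1 - v + v ^ 2 / 3) ^ M) / 2 ≤ 1 + 2 * (M * v) ^ 2 := by
    nlinarith [Real.exp_one_lt_three, sq_nonneg (M * v)]
  have h4 : 1 - q ^ 2 + q ^ 2 * (((1 + v + v ^ 2 / 3) ^ M + (1 - v + v ^ 2 / 3) ^ M) / 2) ≤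
      Real.exp (2 * q ^ 2 * (M * v) ^ 2) := by
    have := Real.add_one_le_exp (2 * q ^ 2 * (M * v) ^ 2)
    nlinarith [mul_le_mul_of_nonneg_left h3 (sq_nonneg q)]
  have h5 : 0 ≤ 1 - q ^ 2 +
      q ^ 2 * (((1 + v + v ^ 2 / 3) ^ M + (1 - v + v ^ 2 / 3) ^ M) / 2) := by
    have a1 : 0 ≤ 1 + v + v ^ 2 / 3 := by positivity
    have a2 : 0 ≤ 1 - v + v ^ 2 / 3 := by nlinarith
    have a3 : 0 ≤ 1 - q ^ 2 := by nlinarith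
    positivity
  calc _ ≤ Real.exp (2 * q ^ 2 * (M * v) ^ 2) ^ p := pow_le_pow_left₀ h5 h4 p
    _ = _ := by rw [← Real.exp_nat_mul]

theorem half_le_risk_of_dense {p n s : ℕ} {α K ρ : ℝ} (hα : 0 < α) (hK : 0 < K)
    (hK3 : (3 / K) ^ α ≤ 1 / 4) (hn : 2 ≤ n) (hs : 64 ≤ s) (hsp : s ≤ p)
    (hps : Real.sqrt (p * LL n) ≤ s) (hρ : ρ ^ 2 ≤ 1 / 5000 * Real.sqrt (p * LL n))
    {φ : (Fin n → Fin p → ℝ) → ℝ} (hφ : IsTest p n φ) :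
    1 / 2 ≤ risk p n (Gclass p n α K) (Theta1 p n s ρ) φ := by
  have hLL := LL_nonneg hn
  have hs' : (64 : ℝ) ≤ s := by exact_mod_cast hs
  have hp' : (s : ℝ) ≤ p := by exact_mod_cast hsp
  have hp0 : (0 : ℝ) < p := by linarith
  set q : ℝ := s / (2 * p) with hq
  have hq0 : 0 ≤ q := by positivity
  have hq1 : q ≤ 1 := by rw [hq, div_le_one (by positivity)]; linarith
  set β := Real.sqrt (16 * ρ ^ 2 / s) with hβdef
  have hβ : β ^ 2 = 16 * ρ ^ 2 / s := Real.sq_sqrt (by positivity)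
  have hβ1 : β ^ 2 ≤ 1 := by
    rw [hβ, div_le_one (by linarith)]
    linarith
  have hρ4 : (ρ ^ 2) ^ 2 ≤ (1 / 5000) ^ 2 * (p * LL n) := by
    calc (ρ ^ 2) ^ 2 ≤ (1 / 5000 * Real.sqrt (p * LL n)) ^ 2 := by gcongr
      _ = _ := by rw [mul_pow, Real.sq_sqrt (by positivity)]
  refine half_le_risk_of_direction_prior (Ξ := Fin p → Fin 3) (w := fun σ => ∏ j, spW q (σ j))
    (ξ := fun σ j => sg (σ j)) (β := β) (c := 1 / 480)
    (good := fun σ => (s : ℝ) / 8 ≤ ∑ j, sg (σ j) ^ 2 ∧ ∑ j, sg (σ j) ^ 2 ≤ (s : ℝ))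
    hα hK hK3 hn (fun σ => Finset.prod_nonneg fun j _ => spW_nonneg hq0 hq1 _)
    (sum_prod_spW p q) (fun σ j => abs_sg_le_one _) (Real.sqrt_nonneg _)
    (le_max_of_le_left hβ1) (by norm_num) le_rfl ?_ ?_ ?_ hφ
  · rintro σ ⟨g1, g2⟩
    constructor
    · rw [← l0_sg] at g2
      exact_mod_cast g2
    · unfold sqnorm
      rw [hβ]
      calc ρ ^ 2 = 16 * ρ ^ 2 / s / 2 * (s / 8) := by field_simp; ring
        _ ≤ _ := by gcongr
  · convert sum_prod_spW_bad_le hs hsp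
  · intro M v u hv0 hv1 hu0 hu1 hMv
    have hz1 : M * v ≤ 1 := by rw [hMv]; nlinarith [sq_nonneg β]
    refine (sum_sum_prod_spW_corr_le hq0 hq1 hv0 hv1 hz1).trans ?_
    have e : p * (2 * q ^ 2 * (M * v) ^ 2) = 128 * (ρ ^ 2) ^ 2 / p * u ^ 2 := by
      rw [hMv, hβ, hq]
      field_simp
      ring
    rw [e]
    apply Real.exp_le_exp.2
    have : 128 * (ρ ^ 2) ^ 2 / p ≤ 1 / 480 * LL n := by
      rw [div_le_iff₀ hp0]
      nlinarith [mul_nonneg hp0.le hLL]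
    calc _ ≤ 1 / 480 * LL n * u := by
          gcongr
          nlinarith
      _ = _ := by ring
/-- The symmetric law on `{-1, 0, 1}` with mass `v / 8` at `±1`. -/
noncomputable def symPt (v : ℝ) : Fin 3 → ℝ := ![v / 8, 1 - v / 4, v / 8]

theorem symPt_pos {v : ℝ} (hv : 0 < v) (hv1 : v ≤ 1) (z : Fin 3) : 0 < symPt v z := by
  fin_cases z <;> simp [symPt] <;> linarith

theorem sum_symPt (v : ℝ) : ∑ z, symPt v z = 1 := by
  simp [Fin.sum_univ_three, symPt]; ring

theorem spW_pos {q : ℝ} (hq : 0 < q) (hq1 : q < 1) (c : Fin 3) : 0 < spW q c := by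
  fin_cases c <;> simp [spW] <;> linarith

/-- The law of a pair `(z, c)`, where `c` has law `spW q` and, given `c`, the point `z` has law
`symPt v` or `symPt 1` according to whether `c` is the central point or not. -/
noncomputable def spikePt (q v : ℝ) (l : Fin 3 × Fin 3) : ℝ :=
  spW q l.2 * symPt (if l.2 = 1 then v else 1) l.1

theorem spikePt_pos {q v : ℝ} (hq : 0 < q) (hq1 : q < 1) (hv : 0 < v) (hv1 : v ≤ 1)
    (l : Fin 3 × Fin 3) : 0 < spikePt q v l := by
  refine mul_pos (spW_pos hq hq1 _) ?_
  split_ifs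
  · exact symPt_pos hv hv1 _
  · exact symPt_pos one_pos le_rfl _

theorem sum_spikePt_mul (q v : ℝ) (g : Fin 3 → ℝ) :
    ∑ l, spikePt q v l * g l.2 = ∑ c, spW q c * g c := by
  rw [Fintype.sum_prod_type_right]
  refine Finset.sum_congr rfl fun c _ => ?_
  have : ∀ z, spikePt q v (z, c) * g c = spW q c * g c * symPt (if c = 1 then v else 1) z :=
    fun z => by simp only [spikePt]; ring
  simp only [this, ← Finset.mul_sum, sum_symPt, mul_one]

theorem sum_spikePt (q v : ℝ) : ∑ l, spikePt q v l = 1 := by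
  simpa [sum_spW] using sum_spikePt_mul q v 1

theorem memG_spikePt {α K q v a L : ℝ} (hα : 0 < α) (hK : 0 < K) (hK3 : (3 / K) ^ α ≤ 1 / 4)
    (hq : 0 < q) (hq1 : q < 1) (hv : 0 < v) (hv1 : v ≤ 1) (ha : 0 ≤ a) (hL : 1 ≤ L)
    (haL : a ≤ L ^ (1 / α)) (hvar : (1 - q) * v + q * (1 + a ^ 2) = 1)
    (hqL : q * Real.exp (L / 4) ≤ 1 / 2 * Real.exp (1 / 4)) :
    memG α K (dlaw (spikePt q v) (fun l => 2 * sg l.1 + a * sg l.2)) := by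
  refine memG_dlaw (fun l => (spikePt_pos hq hq1 hv hv1 l).le) (sum_spikePt q v) ?_ ?_ ?_
  · simp [Fintype.sum_prod_type, Fin.sum_univ_three, spikePt, symPt, spW, sg]
    ring
  · rw [← hvar]
    simp [Fintype.sum_prod_type, Fin.sum_univ_three, spikePt, symPt, spW, sg]
    ring
  · have hL' : 1 ≤ L ^ (1 / α) := Real.one_le_rpow hL (by positivity)
    have hLα : (L ^ (1 / α)) ^ α = L := by
      rw [← Real.rpow_mul (by linarith), one_div_mul_cancel hα.ne', Real.rpow_one]
    have key : ∀ l : Fin 3 × Fin 3, Real.exp (|(2 * sg l.1 + a * sg l.2) / K| ^ α) ≤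
        (fun c => if c = 1 then Real.exp (1 / 4) else Real.exp (L / 4)) l.2 := by
      rintro ⟨z, c⟩
      have hz := abs_sg_le_one z
      have hc := abs_sg_le_one c
      simp only
      rw [abs_div, abs_of_pos hK]
      split_ifs with h
      · apply Real.exp_le_exp.2
        refine le_trans ?_ hK3
        have : sg c = 0 := by rw [h]; rfl
        rw [this, mul_zero, add_zero, abs_mul, abs_two]
        gcongr
        linarith
      · apply Real.exp_le_exp.2
        have h3 : |2 * sg z + a * sg c| ≤ 3 * L ^ (1 / α) := by
          refine (abs_add_le _ _).trans ?_
          rw [abs_mul, abs_mul, abs_two, abs_of_nonneg ha]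
          nlinarith [mul_le_mul_of_nonneg_left hc ha]
        calc (|2 * sg z + a * sg c| / K) ^ α ≤ (3 / K * L ^ (1 / α)) ^ α := by
              rw [div_mul_eq_mul_div]
              gcongr
          _ = (3 / K) ^ α * L := by
              rw [Real.mul_rpow (by positivity) (by positivity), hLα]
          _ ≤ 1 / 4 * L := by gcongr
          _ = _ := by ring
    refine (Finset.sum_le_sum fun l _ => mul_le_mul_of_nonneg_left (key l)
      (spikePt_pos hq hq1 hv hv1 l).le).trans ?_
    rw [sum_spikePt_mul q v (fun c => if c = 1 then Real.exp (1 / 4) else Real.exp (L / 4))]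
    have he : Real.exp (1 / 4) ≤ 4 / 3 := by
      have h1 := Real.add_one_le_exp (-(1 / 4 : ℝ))
      have h2 : Real.exp (1 / 4) * Real.exp (-(1 / 4)) = 1 := by
        rw [← Real.exp_add]; simp
      nlinarith [Real.exp_pos (1 / 4 : ℝ)]
    simp [Fin.sum_univ_three, spW] at *
    nlinarith [Real.exp_pos (4⁻¹ : ℝ)]

theorem sum_sum_spW_spike_corr_le {q v : ℝ} (hq : 0 < q) (hq1 : q < 1) (hv : 0 < v)
    (hv1 : v ≤ 1) :
    ∑ c, ∑ c', spW q c * spW q c' * ∑ l : Fin 3 × Fin 3,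
      (if l.2 = c then symPt 1 l.1 else 0) * (if l.2 = c' then symPt 1 l.1 else 0) /
        spikePt q v l ≤ 1 + (1 - v) ^ 2 / v := by
  have h1 : ∀ c c', ∑ l : Fin 3 × Fin 3,
      (if l.2 = c then symPt 1 l.1 else 0) * (if l.2 = c' then symPt 1 l.1 else 0) /
        spikePt q v l = if c' = c then ∑ z, symPt 1 z ^ 2 / spikePt q v (z, c) else 0 := by
    intro c c'
    rw [Fintype.sum_prod_type]
    split_ifs with h
    · subst h
      refine Finset.sum_congr rfl fun z _ => ?_
      rw [Finset.sum_eq_single c' (by intro b _ hb; simp [hb]) (by simp)]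
      simp [sq]
    · refine Finset.sum_eq_zero fun z _ => Finset.sum_eq_zero fun b _ => ?_
      by_cases hb : b = c
      · subst hb; simp [Ne.symm h]
      · simp [hb]
  have h2 : ∀ c, spW q c * spW q c * ∑ z, symPt 1 z ^ 2 / spikePt q v (z, c) =
      spW q c * ∑ z, symPt 1 z ^ 2 / symPt (if c = 1 then v else 1) z := by
    intro c
    have := (spW_pos hq hq1 c).ne'
    simp only [spikePt]
    rw [mul_assoc, Finset.mul_sum]
    congr 1
    refine Finset.sum_congr rfl fun z _ => ?_
    rw [← mul_div_assoc, mul_div_mul_left _ _ this]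
  have h3 : ∑ z, symPt 1 z ^ 2 / symPt v z ≤ 1 + (1 - v) ^ 2 / v := by
    have hd : 0 < 1 - v / 4 := by linarith
    have : ∑ z, symPt 1 z ^ 2 / symPt v z = 1 + (1 - v) ^ 2 / (v * (4 - v)) := by
      have : (4 - v) ≠ 0 := by linarith
      have e : 1 - v / 4 = (4 - v) / 4 := by ring
      simp [Fin.sum_univ_three, symPt]
      rw [e]
      field_simp
      ring
    rw [this]
    gcongr
    nlinarith
  have h4 : ∑ z, symPt 1 z ^ 2 / symPt 1 z = 1 := by
    refine Eq.trans (Finset.sum_congr rfl fun z _ => ?_) (sum_symPt 1)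
    have := (symPt_pos one_pos le_rfl z).ne'
    field_simp
  have h6 : ∀ c, ∑ c', spW q c * spW q c' * ∑ l : Fin 3 × Fin 3,
      (if l.2 = c then symPt 1 l.1 else 0) * (if l.2 = c' then symPt 1 l.1 else 0) /
        spikePt q v l = spW q c * ∑ z, symPt 1 z ^ 2 / symPt (if c = 1 then v else 1) z := by
    intro c
    rw [← h2 c, Finset.sum_eq_single c (by intro b _ hb; rw [h1, if_neg hb, mul_zero]) (by simp),
      h1, if_pos rfl]
  simp only [h6]
  have h5 : ∀ c, spW q c * ∑ z, symPt 1 z ^ 2 / symPt (if c = 1 then v else 1) z ≤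
      spW q c * (1 + (1 - v) ^ 2 / v) := by
    intro c
    refine mul_le_mul_of_nonneg_left ?_ (spW_pos hq hq1 c).le
    split_ifs
    · exact h3
    · rw [h4]
      have : 0 ≤ (1 - v) ^ 2 / v := by positivity
      linarith
  refine (Finset.sum_le_sum fun c _ => h5 c).trans ?_
  rw [← Finset.sum_mul, sum_spW, one_mul]

theorem exp_one_div_hundred_le : Real.exp (1 / 100) ≤ 1 + 1 / 16 := by
  have h1 := Real.add_one_le_exp (-(1 / 100 : ℝ))
  have h2 : Real.exp (1 / 100) * Real.exp (-(1 / 100)) = 1 := by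
    rw [← Real.exp_add]; simp
  nlinarith [Real.exp_pos (1 / 100 : ℝ)]

theorem half_le_risk_of_sparse {p n s : ℕ} {α K ρ : ℝ} (hα : 0 < α) (hK : 0 < K)
    (hK3 : (3 / K) ^ α ≤ 1 / 4) (hn : 2 ≤ n) (hs : 64 ≤ s) (hsp : s ≤ p)
    (hρ : ρ ^ 2 ≤ 1 / 5000 * (s * Real.log (Real.exp 1 * p / s) ^ (2 / α)))
    (hρp : ρ ^ 2 ≤ 1 / 5000 * Real.sqrt p)
    {φ : (Fin n → Fin p → ℝ) → ℝ} (hφ : IsTest p n φ) :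
    1 / 2 ≤ risk p n (Gclass p n α K) (Theta1 p n s ρ) φ := by
  have hs' : (64 : ℝ) ≤ s := by exact_mod_cast hs
  have hs0 : (0 : ℝ) < s := by linarith
  have hp' : (s : ℝ) ≤ p := by exact_mod_cast hsp
  have hp0 : (0 : ℝ) < p := by linarith
  set L := Real.log (Real.exp 1 * p / s) with hLdef
  have hexpL : Real.exp L = Real.exp 1 * p / s := Real.exp_log (by positivity)
  have hL : 1 ≤ L := by
    rw [hLdef, Real.le_log_iff_exp_le (by positivity), le_div_iff₀ hs0]
    gcongr
  set q : ℝ := s / (2 * p) with hq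
  have hq0 : 0 < q := by positivity
  have hq2 : q ≤ 1 / 2 := by rw [hq, div_le_iff₀ (by positivity)]; linarith
  have hq1 : q < 1 := by linarith
  have hqL : q * Real.exp (L / 4) ≤ 1 / 2 * Real.exp (1 / 4) := by
    have e : q = 1 / 2 * Real.exp (1 - L) := by
      rw [Real.exp_sub, hexpL, hq]
      field_simp
    rw [e, mul_assoc, ← Real.exp_add]
    gcongr
    linarith
  set a := Real.sqrt (16 * ρ ^ 2 / s) with hadef
  have ha0 : 0 ≤ a := Real.sqrt_nonneg _
  have ha : a ^ 2 = 16 * ρ ^ 2 / s := Real.sq_sqrt (by positivity)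
  have haL : a ≤ L ^ (1 / α) := by
    apply le_of_sq_le_sq _ (by positivity)
    have e : (L ^ (1 / α)) ^ 2 = L ^ (2 / α) := by
      rw [← Real.rpow_natCast, ← Real.rpow_mul (by linarith)]
      congr 1
      push_cast
      ring
    rw [ha, e, div_le_iff₀ hs0]
    have : 0 ≤ (s : ℝ) * L ^ (2 / α) := by positivity
    linarith
  set η := q * a ^ 2 / (1 - q) with hη
  have hη0 : 0 ≤ η := div_nonneg (by positivity) (by linarith)
  have hηp : η ≤ 16 * ρ ^ 2 / p := by
    rw [hη, div_le_iff₀ (by linarith), ha, hq]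
    have : 0 ≤ 16 * ρ ^ 2 / p := by positivity
    calc (s : ℝ) / (2 * p) * (16 * ρ ^ 2 / s) = 16 * ρ ^ 2 / p * (1 / 2) := by
          field_simp
      _ ≤ _ := by rw [← hq]; gcongr; linarith
  have hsp1 : Real.sqrt p ≤ p := by
    rw [Real.sqrt_le_left hp0.le]
    nlinarith
  have hη2 : η ≤ 1 / 2 := by
    refine hηp.trans ?_
    rw [div_le_iff₀ hp0]
    linarith
  have hpη : p * η ^ 2 ≤ 1 / 1000 := by
    have h1 : η * p ≤ 16 / 5000 * Real.sqrt p := by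
      rw [le_div_iff₀ hp0] at hηp
      linarith
    have h2 : (η * p) ^ 2 ≤ (16 / 5000) ^ 2 * p := by
      calc (η * p) ^ 2 ≤ (16 / 5000 * Real.sqrt p) ^ 2 := by gcongr
        _ = _ := by rw [mul_pow, Real.sq_sqrt hp0.le]
    nlinarith
  have hv : 0 < 1 - η := by linarith
  have hv1 : 1 - η ≤ 1 := by linarith
  have hvar : (1 - q) * (1 - η) + q * (1 + a ^ 2) = 1 := by
    have : (1 - q) * η = q * a ^ 2 := by
      rw [hη]
      field_simp [show (1 - q) ≠ 0 by linarith]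
    linarith
  have hG0 := memG_spikePt hα hK hK3 hq0 hq1 hv hv1 ha0 hL haL hvar hqL
  have hm0 := spikePt_pos hq0 hq1 hv hv1
  have hms0 := sum_spikePt q (1 - η)
  refine half_le_risk_of_prior (ι := Fin p → Fin 3) (m0 := spikePt q (1 - η)) hm0 hms0 hG0
    (w := fun σ => ∏ j, spW q (σ j)) (fun σ => Finset.prod_nonneg fun j _ => (spW_pos hq0 hq1 _).le)
    (sum_prod_spW p q)
    (θ := fun σ t j => if (t : ℕ) < 1 then a * sg (σ j) else 0)
    (m := fun σ t j l => if (t : ℕ) < 1 then (if l.2 = σ j then symPt 1 l.1 else 0)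
      else spikePt q (1 - η) l)
    (good := fun σ => (s : ℝ) / 8 ≤ ∑ j, sg (σ j) ^ 2 ∧ ∑ j, sg (σ j) ^ 2 ≤ (s : ℝ))
    ?_ ?_ ?_ ?_ ?_ ?_ hφ
  · intro σ t j l
    have := (symPt_pos one_pos le_rfl l.1).le
    have := (hm0 l).le
    split_ifs <;> first | assumption | exact le_rfl
  · intro σ t j
    by_cases ht : (t : ℕ) < 1
    · simp only [ht, if_true]
      rw [Fintype.sum_prod_type]
      simp [sum_symPt]
    · simp only [ht, if_false, hms0]
  · intro σ t j
    by_cases ht : (t : ℕ) < 1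
    · simp only [ht, if_true]
      have hsum : ∀ g : Fin 3 × Fin 3 → ℝ, ∑ l : Fin 3 × Fin 3,
          (if l.2 = σ j then symPt 1 l.1 else 0) * g l = ∑ z, symPt 1 z * g (z, σ j) := by
        intro g
        rw [Fintype.sum_prod_type]
        simp
      refine memG_dlaw_of_bounded hα hK hK3 ?_ ?_ ?_ ?_ ?_
      · intro l
        have := (symPt_pos one_pos le_rfl l.1).le
        split_ifs <;> first | assumption | exact le_rfl
      · simpa [sum_symPt] using hsum 1
      · rw [hsum]
        simp [Fin.sum_univ_three, symPt, sg]
      · rw [hsum]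
        simp [Fin.sum_univ_three, symPt, sg]
        norm_num
      · intro l hl
        have hl' : l.2 = σ j := by
          by_contra h
          simp [h] at hl
        rw [hl', add_sub_cancel_right, abs_mul, abs_two]
        linarith [abs_sg_le_one l.1]
    · simpa only [ht, if_false, sub_zero] using hG0
  · rintro σ ⟨g1, g2⟩
    refine mem_Theta1_of_two_mul_le (t0 := 1) (v := fun j => a * sg (σ j)) le_rfl (by omega) ?_ ?_
    · refine (l0_smul_le p a _).trans ?_
      rw [← l0_sg] at g2
      exact_mod_cast g2
    · rw [sqnorm_smul, ha]
      unfold sqnorm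
      calc ρ ^ 2 = (1 : ℕ) / 2 * (16 * ρ ^ 2 / s * (s / 8)) := by push_cast; field_simp; ring
        _ ≤ _ := by gcongr
  · convert sum_prod_spW_bad_le hs hsp
  · set A : Fin 3 → Fin 3 → ℝ := fun c c' => ∑ l : Fin 3 × Fin 3,
      (if l.2 = c then symPt 1 l.1 else 0) * (if l.2 = c' then symPt 1 l.1 else 0) /
        spikePt q (1 - η) l with hA
    have hfac : ∀ σ σ' : Fin p → Fin 3, (∏ t : Fin n, ∏ j, ∑ l,
        (if (t : ℕ) < 1 then (if l.2 = σ j then symPt 1 l.1 else 0) else spikePt q (1 - η) l) *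
        (if (t : ℕ) < 1 then (if l.2 = σ' j then symPt 1 l.1 else 0) else spikePt q (1 - η) l) /
          spikePt q (1 - η) l) = ∏ j, A (σ j) (σ' j) := by
      intro σ σ'
      rw [Finset.prod_eq_single (⟨0, by omega⟩ : Fin n)]
      · simp [hA]
      · intro t _ ht
        have ht' : ¬ (t : ℕ) < 1 := by
          intro h
          exact ht (Fin.ext (by simpa using h))
        refine Finset.prod_eq_one fun j _ => ?_
        simp only [ht', if_false]
        refine Eq.trans (Finset.sum_congr rfl fun l _ => ?_) hms0
        rw [mul_div_assoc, div_self (hm0 l).ne', mul_one]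
      · simp
    simp only [hfac]
    rw [sum_sum_prod_mul_prod p (spW q) A]
    have hle := sum_sum_spW_spike_corr_le hq0 hq1 hv hv1
    have hnn : 0 ≤ ∑ c, ∑ c', spW q c * spW q c' * A c c' := by
      refine Finset.sum_nonneg fun c _ => Finset.sum_nonneg fun c' _ =>
        mul_nonneg (mul_nonneg (spW_pos hq0 hq1 c).le (spW_pos hq0 hq1 c').le)
          (Finset.sum_nonneg fun l _ => div_nonneg (mul_nonneg ?_ ?_) (hm0 l).le)
      all_goals
        have := (symPt_pos one_pos le_rfl l.1).le
        split_ifs <;> first | assumption | exact le_rfl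
    have hb : ∑ c, ∑ c', spW q c * spW q c' * A c c' ≤ Real.exp (2 * η ^ 2) := by
      refine hle.trans ?_
      have : (1 - (1 - η)) ^ 2 / (1 - η) ≤ 2 * η ^ 2 := by
        rw [div_le_iff₀ hv]
        nlinarith [sq_nonneg η]
      linarith [Real.add_one_le_exp (2 * η ^ 2)]
    calc _ ≤ Real.exp (2 * η ^ 2) ^ p := pow_le_pow_left₀ hnn hb p
      _ = Real.exp (p * (2 * η ^ 2)) := by rw [← Real.exp_nat_mul]
      _ ≤ Real.exp (1 / 100) := by
          apply Real.exp_le_exp.2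
          linarith
      _ ≤ 1 + 1 / 16 := exp_one_div_hundred_le

/-- Theorem: minimax lower bound under sub-Weibull noise. -/
theorem statement_2 :
    ∃ c : ℝ, 1 ≤ c ∧
      ∀ α : ℝ, 0 < α → α ≤ 2 →
        ∃ Kα : ℝ, 0 < Kα ∧
          ∀ K : ℝ, Kα ≤ K →
            ∃ c' : ℝ, 0 < c' ∧
              ∀ p n s : ℕ, 0 < p → 2 ≤ n → c ≤ (s : ℝ) → s ≤ p →
                ∀ ρ : ℝ,
                  ρ ^ 2 ≤ c' *
                      (min ((s : ℝ) * Real.log (Real.exp 1 * (p : ℝ) / (s : ℝ)) ^ ((2 : ℝ) / α))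
                        (Real.sqrt ((p : ℝ) *
                          (if Real.sqrt ((p : ℝ) * LL n) < (s : ℝ) then LL n else 1))) +
                      LL n) →
                  ∀ φ : (Fin n → Fin p → ℝ) → ℝ, IsTest p n φ →
                    1 / 2 ≤ risk p n (Gclass p n α K) (Theta1 p n s ρ) φ := by
  refine ⟨64, by norm_num, fun α hα _ => ⟨3 * 4 ^ (1 / α), by positivity, fun K hKα => ?_⟩⟩
  have hK : 0 < K := lt_of_lt_of_le (by positivity) hKα
  have hK3 : (3 / K) ^ α ≤ 1 / 4 := by
    have h1 : 3 / K ≤ (4 ^ (1 / α))⁻¹ := by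
      rw [div_le_iff₀ hK, inv_mul_eq_div, le_div_iff₀ (by positivity)]
      exact hKα
    calc (3 / K) ^ α ≤ ((4 ^ (1 / α))⁻¹) ^ α := by gcongr
      _ = 1 / 4 := by
        rw [Real.inv_rpow (by positivity), ← Real.rpow_mul (by norm_num),
          one_div_mul_cancel hα.ne', Real.rpow_one, one_div]
  refine ⟨1 / 10000, by norm_num, fun p n s hp hn hs hsp ρ hρ φ hφ => ?_⟩
  have hs64 : 64 ≤ s := by exact_mod_cast hs
  rcases le_total (min ((s : ℝ) * Real.log (Real.exp 1 * (p : ℝ) / (s : ℝ)) ^ ((2 : ℝ) / α))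
      (Real.sqrt ((p : ℝ) * (if Real.sqrt ((p : ℝ) * LL n) < (s : ℝ) then LL n else 1))))
      (LL n) with h | h
  · exact half_le_risk_of_sq_le_LL hα hK hK3 hp hn (by omega) (by linarith) hφ
  · have h1 := min_le_left ((s : ℝ) * Real.log (Real.exp 1 * (p : ℝ) / (s : ℝ)) ^ ((2 : ℝ) / α))
      (Real.sqrt ((p : ℝ) * (if Real.sqrt ((p : ℝ) * LL n) < (s : ℝ) then LL n else 1)))
    have h2 := min_le_right ((s : ℝ) * Real.log (Real.exp 1 * (p : ℝ) / (s : ℝ)) ^ ((2 : ℝ) / α))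
      (Real.sqrt ((p : ℝ) * (if Real.sqrt ((p : ℝ) * LL n) < (s : ℝ) then LL n else 1)))
    by_cases hd : Real.sqrt ((p : ℝ) * LL n) < (s : ℝ)
    · rw [if_pos hd] at h h1 h2 hρ
      exact half_le_risk_of_dense hα hK hK3 hn hs64 hsp hd.le (by linarith) hφ
    · rw [if_neg hd, mul_one] at h h1 h2 hρ
      exact half_le_risk_of_sparse hα hK hK3 hn hs64 hsp (by linarith) (by linarith) hφ

end ChangePoint
end

section
/- Let p, n ∈ ℤ⁺ with n ≥ 2, let α ≥ 2 and K > 0, and let 1 ≤ s ≤ p. For any ε ∈ (0,1) there exist constants C₁, C₂ > 0 depending only on α, K and ε such that the median-of-means test φ_{P,dense} := 1{max_{t∈T} A_t^{MoM}/r_t > 1} with r_t = C₁·p^{max(1/2, 2/α)}·G_t, G_t = min(t, Δ) and Δ = 2^{3+⌈log₂ log log(8n)⌉} satisfies R_{P_{α,K}^⊗}(ρ, φ_{P,dense}) ≤ ε whenever ρ² ≥ C₂·p^{max(2/α, 1/2)}·log log(8n). -/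
open MeasureTheory
open scoped Classical

namespace ChangePoint

section Independence

open ProbabilityTheory

variable {Ω : Type*} [MeasurableSpace Ω] {P : Measure Ω}

/-- Blocks of an independent family are independent. -/
lemma iIndepFun_blocks {ι : Type*} {κ : Type*} [IsProbabilityMeasure P]
    {X : ι × κ → Ω → ℝ} (mX : ∀ l, Measurable (X l)) (h : iIndepFun X P) :
    iIndepFun (fun (i : ι) ω (j : κ) => X (i, j) ω) P := by
  have hs : iIndepFun (fun (q : (_ : ι) × κ) ω => X (q.1, q.2) ω) P :=
    h.precomp (g := fun q : (_ : ι) × κ => (q.1, q.2)) (fun a b hab => by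
      cases a; cases b; simp_all)
  have hp : ∀ i j, IsProbabilityMeasure (P.map (X (i, j))) :=
    fun i j => Measure.isProbabilityMeasure_map (mX _).aemeasurable
  rw [iIndepFun_iff_map_fun_eq_infinitePi_map
    (fun i => measurable_pi_iff.2 fun j => mX (i, j))]
  have e : (fun ω i j => X (i, j) ω) = (MeasurableEquiv.piCurry fun (_ : ι) (_ : κ) => ℝ) ∘
      (fun ω (q : (_ : ι) × κ) => X (q.1, q.2) ω) := by
    ext; simp [Sigma.curry]
  rw [e, ← Measure.map_map (by fun_prop) (measurable_pi_iff.2 fun q => mX _),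
    (iIndepFun_iff_map_fun_eq_infinitePi_map (fun q => mX _)).1 hs,
    Measure.infinitePi_map_piCurry (fun i j => P.map (X (i, j)))]
  congr with i : 1
  have hi : iIndepFun (fun (j : κ) => X (i, j)) P :=
    h.precomp (g := fun j : κ => (i, j)) (fun a b hab => by simpa using hab)
  rw [(iIndepFun_iff_map_fun_eq_infinitePi_map (fun j => mX _)).1 hi]

/-- If each of `G` independent variables falls in its set with probability at most `(η/2)²`,
then at least half of them do so with probability at most `η ^ G`. -/
lemma measureReal_half_mem_le [IsProbabilityMeasure P] {G : ℕ} {F : Fin G → Ω → ℝ}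
    (hF : iIndepFun F P) {B : Set ℝ} (hB : MeasurableSet B) {η : ℝ}
    (hη0 : 0 ≤ η) (hη1 : η ≤ 1) (h : ∀ g, P.real (F g ⁻¹' B) ≤ (η / 2) ^ 2) :
    P.real {ω | ∃ A : Finset (Fin G), G ≤ 2 * A.card ∧ ∀ g ∈ A, F g ω ∈ B} ≤ η ^ G := by
  have hsub : {ω | ∃ A : Finset (Fin G), G ≤ 2 * A.card ∧ ∀ g ∈ A, F g ω ∈ B} ⊆
      ⋃ A ∈ (Finset.univ.filter fun A : Finset (Fin G) => G ≤ 2 * A.card),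
        ⋂ g ∈ A, F g ⁻¹' B := by
    rintro ω ⟨A, hA, hω⟩
    simp only [Set.mem_iUnion, Set.mem_iInter]
    exact ⟨A, by simpa using hA, hω⟩
  refine (measureReal_mono hsub (measure_ne_top _ _)).trans ((measureReal_biUnion_finset_le _ _).trans ?_)
  have hone : ∀ A ∈ (Finset.univ.filter fun A : Finset (Fin G) => G ≤ 2 * A.card),
      P.real (⋂ g ∈ A, F g ⁻¹' B) ≤ (η / 2) ^ G := by
    intro A hA
    have hA' : G ≤ 2 * A.card := by simpa using hA
    have e := hF.measure_inter_preimage_eq_mul A (sets := fun _ => B) (fun _ _ => hB)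
    rw [measureReal_def, e, ENNReal.toReal_prod]
    calc ∏ g ∈ A, (P (F g ⁻¹' B)).toReal ≤ ∏ g ∈ A, (η / 2) ^ 2 :=
          Finset.prod_le_prod (fun _ _ => ENNReal.toReal_nonneg) fun g _ => h g
      _ = (η / 2) ^ (2 * A.card) := by rw [Finset.prod_const, pow_mul]
      _ ≤ (η / 2) ^ G := pow_le_pow_of_le_one (by linarith) (by linarith) hA'
  refine (Finset.sum_le_sum hone).trans ?_
  rw [Finset.sum_const, nsmul_eq_mul]
  calc ((Finset.univ.filter fun A : Finset (Fin G) => G ≤ 2 * A.card).card : ℝ) * (η / 2) ^ G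
      ≤ (2 : ℝ) ^ G * (η / 2) ^ G := by
        gcongr
        have := Finset.card_filter_le (Finset.univ : Finset (Finset (Fin G)))
          (fun A => G ≤ 2 * A.card)
        rw [Finset.card_univ, Fintype.card_finset, Fintype.card_fin] at this
        exact_mod_cast this
    _ = η ^ G := by rw [← mul_pow]; congr 1; ring

end Independence

section Median

lemma card_filter_eq_countP_insertionSort {G : ℕ} (f : Fin G → ℝ) (q : ℝ → Prop) [DecidablePred q] :
    (Finset.univ.filter fun g => q (f g)).card =
      ((List.ofFn f).insertionSort (· ≤ ·)).countP q := by
  rw [(List.perm_insertionSort (· ≤ ·) (List.ofFn f)).countP_eq, Fin.univ_def, List.ofFn_eq_map,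
    List.countP_map, List.countP_eq_length_filter]
  rfl

lemma exists_half_lt_of_lt_median {G : ℕ} (hG : 0 < G) (f : Fin G → ℝ) {r : ℝ}
    (h : r < median (List.ofFn f)) :
    ∃ A : Finset (Fin G), G ≤ 2 * A.card ∧ ∀ g ∈ A, r < f g := by
  refine ⟨Finset.univ.filter fun g => r < f g, ?_, fun g hg => by simpa using hg⟩
  rw [card_filter_eq_countP_insertionSort f (fun x => r < x)]
  set s := (List.ofFn f).insertionSort (· ≤ ·) with hs
  have hlen : s.length = G := by simp [hs]
  have hsort : s.Pairwise (· ≤ ·) := List.pairwise_insertionSort _ _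
  unfold median at h
  rw [List.length_ofFn, ← hs] at h
  set k := (G + 1) / 2 - 1 with hk
  have hkG : k < s.length := by omega
  rw [List.getD_eq_getElem _ _ hkG] at h
  have h1 : (s.drop k).countP (fun x => r < x) ≤ s.countP (fun x => r < x) :=
    (List.drop_sublist k s).countP_le
  have h2 : (s.drop k).countP (fun x => r < x) = (s.drop k).length := by
    rw [List.countP_eq_length]
    intro a ha
    obtain ⟨i, hi, rfl⟩ := List.mem_iff_getElem.1 ha
    rw [List.getElem_drop]
    have := hsort.rel_get_of_le (a := ⟨k, hkG⟩) (b := ⟨k + i, by simp at hi; omega⟩) (by simp)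
    simp only [List.get_eq_getElem] at this
    simpa using h.trans_le this
  rw [h2, List.length_drop] at h1
  omega

lemma exists_half_le_of_median_le {G : ℕ} (hG : 0 < G) (f : Fin G → ℝ) {r : ℝ}
    (h : median (List.ofFn f) ≤ r) :
    ∃ A : Finset (Fin G), G ≤ 2 * A.card ∧ ∀ g ∈ A, f g ≤ r := by
  refine ⟨Finset.univ.filter fun g => f g ≤ r, ?_, fun g hg => by simpa using hg⟩
  rw [card_filter_eq_countP_insertionSort f (fun x => x ≤ r)]
  set s := (List.ofFn f).insertionSort (· ≤ ·) with hs
  have hlen : s.length = G := by simp [hs]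
  have hsort : s.Pairwise (· ≤ ·) := List.pairwise_insertionSort _ _
  unfold median at h
  rw [List.length_ofFn, ← hs] at h
  set k := (G + 1) / 2 - 1 with hk
  have hkG : k < s.length := by omega
  rw [List.getD_eq_getElem _ _ hkG] at h
  have h1 : (s.take (k + 1)).countP (fun x => x ≤ r) ≤ s.countP (fun x => x ≤ r) :=
    (List.take_sublist (k + 1) s).countP_le
  have h2 : (s.take (k + 1)).countP (fun x => x ≤ r) = (s.take (k + 1)).length := by
    rw [List.countP_eq_length]
    intro a ha
    obtain ⟨i, hi, rfl⟩ := List.mem_iff_getElem.1 ha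
    rw [List.getElem_take]
    rw [List.length_take] at hi
    have := hsort.rel_get_of_le (a := ⟨i, by omega⟩) (b := ⟨k, hkG⟩) (by simp; omega)
    simp only [List.get_eq_getElem] at this
    simpa using this.trans h
  rw [h2, List.length_take] at h1
  omega

end Median

section Tails

open ProbabilityTheory

variable {Ω : Type*} [MeasurableSpace Ω] {P : Measure Ω}

lemma measureReal_ge_abs_le_integral_sq {X : Ω → ℝ} (hX : Integrable (fun ω => X ω ^ 2) P)
    {c : ℝ} (hc : 0 < c) : P.real {ω | c ≤ |X ω|} ≤ (∫ ω, X ω ^ 2 ∂P) / c ^ 2 := by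
  have h := mul_meas_ge_le_integral_of_nonneg (μ := P) (f := fun ω => X ω ^ 2)
    (Filter.Eventually.of_forall fun _ => sq_nonneg _) hX (c ^ 2)
  have e : {ω | c ^ 2 ≤ X ω ^ 2} = {ω | c ≤ |X ω|} := by
    ext ω
    simp only [Set.mem_ofPred_eq]
    rw [sq_le_sq, abs_of_pos hc]
  rw [e] at h
  rw [le_div_iff₀ (by positivity), mul_comm]
  exact h

lemma measureReal_ge_abs_le_integral_abs {X : Ω → ℝ} (hX : Integrable X P)
    {c : ℝ} (hc : 0 < c) : P.real {ω | c ≤ |X ω|} ≤ (∫ ω, |X ω| ∂P) / c := by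
  have h := mul_meas_ge_le_integral_of_nonneg (μ := P) (f := fun ω => |X ω|)
    (Filter.Eventually.of_forall fun _ => abs_nonneg _) hX.abs c
  rw [le_div_iff₀ hc, mul_comm]
  exact h

lemma integral_sq_sum_of_orthogonal {κ : Type*} (s : Finset κ) {R : κ → Ω → ℝ}
    (hR : ∀ e ∈ s, MemLp (R e) 2 P)
    (h : ∀ e ∈ s, ∀ e' ∈ s, e ≠ e' → ∫ ω, R e ω * R e' ω ∂P = 0) :
    ∫ ω, (∑ e ∈ s, R e ω) ^ 2 ∂P = ∑ e ∈ s, ∫ ω, R e ω ^ 2 ∂P := by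
  have hint : ∀ e ∈ s, ∀ e' ∈ s, Integrable (fun ω => R e ω * R e' ω) P :=
    fun e he e' he' => (hR e he).integrable_mul (hR e' he')
  simp_rw [sq, Finset.sum_mul_sum]
  rw [integral_finsetSum _ fun e he => integrable_finsetSum _ fun e' he' => hint e he e' he']
  refine Finset.sum_congr rfl fun e he => ?_
  rw [integral_finsetSum _ fun e' he' => hint e he e' he']
  exact Finset.sum_eq_single_of_mem e he fun e' he' hne => h e he e' he' hne.symm

/-- A weak-type bound of order `N ^ (1/q)` for sums of `N` independent centred variables with
bounded `q`-th moment, `1 ≤ q ≤ 2`. -/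
lemma measureReal_sum_ge_le_of_moment [IsProbabilityMeasure P] {ι : Type*} [Fintype ι] [Nonempty ι] {V : ι → Ω → ℝ}
    (mV : ∀ l, Measurable (V l)) (hind : iIndepFun V P) (hint : ∀ l, Integrable (V l) P)
    (h0 : ∀ l, ∫ ω, V l ω ∂P = 0) {q C : ℝ} (hq1 : 1 ≤ q) (hq2 : q ≤ 2)
    (hVq : ∀ l, Integrable (fun ω => |V l ω| ^ q) P) (hC : ∀ l, ∫ ω, |V l ω| ^ q ∂P ≤ C)
    {L : ℝ} (hL : 1 ≤ L) :
    P.real {ω | L * (Fintype.card ι : ℝ) ^ (1 / q) ≤ |∑ l, V l ω|} ≤ 8 * C / L := by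
  set N : ℝ := (Fintype.card ι : ℝ) with hN
  have hN0 : 0 < N := by rw [hN]; exact_mod_cast Fintype.card_pos
  set τ : ℝ := N ^ (1 / q) with hτ
  have hτ0 : 0 < τ := Real.rpow_pos_of_pos hN0 _
  have hτq : τ ^ q = N := by
    rw [hτ, ← Real.rpow_mul hN0.le, one_div_mul_cancel (by linarith), Real.rpow_one]
  have hC0 : 0 ≤ C := by
    obtain ⟨l⟩ := ‹Nonempty ι›
    exact (integral_nonneg fun ω => by positivity).trans (hC l)
  let f : ℝ → ℝ := fun x => if |x| ≤ τ then x else 0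
  have mf : Measurable f :=
    Measurable.ite (measurableSet_le measurable_norm measurable_const) measurable_id
      measurable_const
  have hf_bd : ∀ x, |f x| ≤ τ := by
    intro x; simp only [f]; split_ifs with h
    · exact h
    · simpa using hτ0.le
  have hf_sq : ∀ x, f x ^ 2 ≤ τ ^ (2 - q) * |x| ^ q := by
    intro x; simp only [f]; split_ifs with h
    · rcases eq_or_ne x 0 with rfl | hx
      · simp; positivity
      · have hx' : 0 < |x| := abs_pos.2 hx
        calc x ^ 2 = |x| ^ (2 - q) * |x| ^ q := by
              rw [← Real.rpow_add hx']; simp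
          _ ≤ _ := mul_le_mul_of_nonneg_right
              (Real.rpow_le_rpow hx'.le h (by linarith)) (by positivity)
    · simp; positivity
  have hg_abs : ∀ x, |x - f x| ≤ τ ^ (1 - q) * |x| ^ q := by
    intro x; simp only [f]; split_ifs with h
    · simp; positivity
    · push Not at h
      have hx' : 0 < |x| := hτ0.trans h
      calc |x - 0| = |x| ^ (1 - q) * |x| ^ q := by
            rw [← Real.rpow_add hx']; simp
        _ ≤ _ := mul_le_mul_of_nonneg_right
            (Real.rpow_le_rpow_of_nonpos hτ0 h.le (by linarith)) (by positivity)
  have mA : ∀ l, Measurable (fun ω => f (V l ω)) := fun l => mf.comp (mV l)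
  have hA2 : ∀ l, MemLp (fun ω => f (V l ω)) 2 P := fun l =>
    MemLp.of_bound (mA l).aestronglyMeasurable τ (Filter.Eventually.of_forall fun ω => hf_bd _)
  have hAint : ∀ l, Integrable (fun ω => f (V l ω)) P := fun l => (hA2 l).integrable one_le_two
  have hBint : ∀ l, Integrable (fun ω => V l ω - f (V l ω)) P := fun l => (hint l).sub (hAint l)
  have hB1 : ∀ l, ∫ ω, |V l ω - f (V l ω)| ∂P ≤ τ ^ (1 - q) * C := by
    intro l
    calc ∫ ω, |V l ω - f (V l ω)| ∂P ≤ ∫ ω, τ ^ (1 - q) * |V l ω| ^ q ∂P :=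
          integral_mono (hBint l).abs ((hVq l).const_mul _) fun ω => hg_abs _
      _ = τ ^ (1 - q) * ∫ ω, |V l ω| ^ q ∂P := integral_const_mul _ _
      _ ≤ _ := by gcongr; exact hC l
  have hB0 : ∀ l, ∫ ω, (V l ω - f (V l ω)) ∂P = -∫ ω, f (V l ω) ∂P := by
    intro l; rw [integral_sub (hint l) (hAint l), h0]; ring
  let S : Ω → ℝ := ∑ l, fun ω => f (V l ω)
  have hS2 : MemLp S 2 P := memLp_finsetSum' _ fun l _ => hA2 l
  have hS_exp : ∫ ω, S ω ∂P = ∑ l, ∫ ω, f (V l ω) ∂P := by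
    simp only [S, Finset.sum_apply]
    exact integral_finsetSum _ fun l _ => hAint l
  have hvar : variance S P ≤ τ ^ 2 * C := by
    have e : variance S P = ∑ l, variance (fun ω => f (V l ω)) P :=
      IndepFun.variance_sum (fun l _ => hA2 l) fun i _ j _ hij =>
        (hind.indepFun hij).comp mf mf
    rw [e]
    calc ∑ l, variance (fun ω => f (V l ω)) P ≤ ∑ _l : ι, τ ^ (2 - q) * C := by
          refine Finset.sum_le_sum fun l _ => ?_
          refine (variance_le_expectation_sq (mA l).aestronglyMeasurable).trans ?_
          calc ∫ ω, f (V l ω) ^ 2 ∂P ≤ ∫ ω, τ ^ (2 - q) * |V l ω| ^ q ∂P :=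
                integral_mono (hA2 l).integrable_sq ((hVq l).const_mul _) fun ω => hf_sq _
            _ = τ ^ (2 - q) * ∫ ω, |V l ω| ^ q ∂P := integral_const_mul _ _
            _ ≤ _ := by gcongr; exact hC l
      _ = (τ ^ q * τ ^ (2 - q)) * C := by
          rw [Finset.sum_const, nsmul_eq_mul, Finset.card_univ, ← hN, hτq]; ring
      _ = τ ^ 2 * C := by rw [← Real.rpow_add hτ0]; simp
  let T : Ω → ℝ := fun ω => ∑ l, ((V l ω - f (V l ω)) - ∫ ω, (V l ω - f (V l ω)) ∂P)
  have hTint : Integrable T P :=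
    integrable_finsetSum _ fun l _ => (hBint l).sub (integrable_const _)
  have habs : ∀ l, Integrable (fun ω => |V l ω - f (V l ω)| +
      |∫ ω, (V l ω - f (V l ω)) ∂P|) P := fun l => (hBint l).abs.add (integrable_const _)
  have hT1 : ∫ ω, |T ω| ∂P ≤ 2 * C * τ := by
    calc ∫ ω, |T ω| ∂P
        ≤ ∫ ω, ∑ l, (|V l ω - f (V l ω)| + |∫ ω, (V l ω - f (V l ω)) ∂P|) ∂P := by
          refine integral_mono hTint.abs (integrable_finsetSum _ fun l _ => habs l) fun ω => ?_
          exact (Finset.abs_sum_le_sum_abs _ _).trans (Finset.sum_le_sum fun l _ => abs_sub _ _)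
      _ = ∑ l, (∫ ω, |V l ω - f (V l ω)| ∂P + |∫ ω, (V l ω - f (V l ω)) ∂P|) := by
          rw [integral_finsetSum _ fun l _ => habs l]
          refine Finset.sum_congr rfl fun l _ => ?_
          rw [integral_add (hBint l).abs (integrable_const _)]
          simp
      _ ≤ ∑ _l : ι, (τ ^ (1 - q) * C + τ ^ (1 - q) * C) := by
          refine Finset.sum_le_sum fun l _ => add_le_add (hB1 l) ?_
          exact (abs_integral_le_integral_abs).trans (hB1 l)
      _ = 2 * C * (τ ^ q * τ ^ (1 - q)) := by
          rw [Finset.sum_const, nsmul_eq_mul, Finset.card_univ, ← hN, hτq]; ring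
      _ = 2 * C * τ := by rw [← Real.rpow_add hτ0]; simp
  have hc0 : 0 < L / 2 * τ := by positivity
  have hsub : {ω | L * τ ≤ |∑ l, V l ω|} ⊆
      {ω | L / 2 * τ ≤ |S ω - ∫ ω, S ω ∂P|} ∪ {ω | L / 2 * τ ≤ |T ω|} := by
    intro ω hω
    by_contra hcon
    simp only [Set.mem_union, Set.mem_ofPred_eq, not_or, not_le] at hcon hω
    have e : ∑ l, V l ω = (S ω - ∫ ω, S ω ∂P) + T ω := by
      rw [hS_exp]
      simp only [S, T, Finset.sum_apply, hB0, Finset.sum_sub_distrib, Finset.sum_neg_distrib]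
      ring
    rw [e] at hω
    have := abs_add_le (S ω - ∫ ω, S ω ∂P) (T ω)
    linarith [hcon.1, hcon.2]
  have h1 : P.real {ω | L / 2 * τ ≤ |S ω - ∫ ω, S ω ∂P|} ≤ 4 * C / L := by
    have := meas_ge_le_variance_div_sq hS2 hc0
    have h' : P.real {ω | L / 2 * τ ≤ |S ω - ∫ ω, S ω ∂P|} ≤ variance S P / (L / 2 * τ) ^ 2 :=
      ENNReal.toReal_le_of_le_ofReal (div_nonneg (variance_nonneg _ _) (by positivity)) this
    refine h'.trans ?_
    rw [div_le_div_iff₀ (by positivity) (by linarith)]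
    calc variance S P * L ≤ τ ^ 2 * C * L := by gcongr
      _ ≤ τ ^ 2 * C * L * L := le_mul_of_one_le_right (by positivity) hL
      _ = 4 * C * (L / 2 * τ) ^ 2 := by ring
  have h2 : P.real {ω | L / 2 * τ ≤ |T ω|} ≤ 4 * C / L := by
    refine (measureReal_ge_abs_le_integral_abs hTint hc0).trans ?_
    rw [div_le_div_iff₀ hc0 (by linarith)]
    calc (∫ ω, |T ω| ∂P) * L ≤ 2 * C * τ * L := by gcongr
      _ = 4 * C * (L / 2 * τ) := by ring
  calc P.real {ω | L * τ ≤ |∑ l, V l ω|} ≤ _ := measureReal_mono hsub (measure_ne_top _ _)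
    _ ≤ _ := measureReal_union_le _ _
    _ ≤ 4 * C / L + 4 * C / L := add_le_add h1 h2
    _ = 8 * C / L := by ring

end Tails

section Blocks

open ProbabilityTheory

variable {Ω : Type*} [MeasurableSpace Ω] {P : Measure Ω}

/-- Independent standardized variables whose centred squares have `q`-th moments at most `C`. -/
structure StdFamily (P : Measure Ω) (q C : ℝ) {ι : Type*} (Y : ι → Ω → ℝ) : Prop where
  meas : ∀ l, Measurable (Y l)
  indep : iIndepFun Y P
  memLp : ∀ l, MemLp (Y l) 2 P
  mean : ∀ l, ∫ ω, Y l ω ∂P = 0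
  var : ∀ l, ∫ ω, Y l ω ^ 2 ∂P = 1
  moment : ∀ l, Integrable (fun ω => |Y l ω ^ 2 - 1| ^ q) P
  moment_le : ∀ l, ∫ ω, |Y l ω ^ 2 - 1| ^ q ∂P ≤ C

lemma StdFamily.precomp {q C : ℝ} {ι κ : Type*} {Y : ι → Ω → ℝ} (h : StdFamily P q C Y)
    {g : κ → ι} (hg : Function.Injective g) : StdFamily P q C (fun k => Y (g k)) where
  meas _ := h.meas _
  indep := h.indep.precomp hg
  memLp _ := h.memLp _
  mean _ := h.mean _
  var _ := h.var _
  moment _ := h.moment _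
  moment_le _ := h.moment_le _

variable {q C : ℝ}

lemma StdFamily.memLp_mul {ι : Type*} {Y : ι → Ω → ℝ} (h : StdFamily P q C Y) {a b : ι}
    (hab : a ≠ b) : MemLp (fun ω => Y a ω * Y b ω) 2 P := by
  have hm : Measurable (fun ω => Y a ω * Y b ω) := (h.meas a).mul (h.meas b)
  rw [memLp_two_iff_integrable_sq hm.aestronglyMeasurable]
  have hi : IndepFun (fun ω => Y a ω ^ 2) (fun ω => Y b ω ^ 2) P :=
    (h.indep.indepFun hab).comp (measurable_id.pow_const 2) (measurable_id.pow_const 2)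
  simp_rw [mul_pow]
  exact hi.integrable_mul (h.memLp a).integrable_sq (h.memLp b).integrable_sq

lemma StdFamily.integral_sq_mul {ι : Type*} {Y : ι → Ω → ℝ} (h : StdFamily P q C Y) {a b : ι}
    (hab : a ≠ b) : ∫ ω, (Y a ω * Y b ω) ^ 2 ∂P = 1 := by
  have hi : IndepFun (fun ω => Y a ω ^ 2) (fun ω => Y b ω ^ 2) P :=
    (h.indep.indepFun hab).comp (measurable_id.pow_const 2) (measurable_id.pow_const 2)
  simp_rw [mul_pow]
  rw [hi.integral_fun_mul_eq_mul_integral ((h.meas a).pow_const 2).aestronglyMeasurable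
    ((h.meas b).pow_const 2).aestronglyMeasurable, h.var, h.var, one_mul]

lemma StdFamily.integral_mul_eq_zero {ι : Type*} {Y : ι → Ω → ℝ} (h : StdFamily P q C Y)
    {a b : ι} (hab : a ≠ b) : ∫ ω, Y a ω * Y b ω ∂P = 0 := by
  rw [(h.indep.indepFun hab).integral_fun_mul_eq_mul_integral (h.meas a).aestronglyMeasurable
    (h.meas b).aestronglyMeasurable, h.mean, zero_mul]

lemma StdFamily.integral_four_eq_zero {ι : Type*} [Fintype ι] {Y : ι → Ω → ℝ}
    (h : StdFamily P q C Y) {a b c d : ι} (hab : a ≠ b) (hcd : c ≠ d)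
    (h1 : ¬ (a = c ∧ b = d)) (h2 : ¬ (a = d ∧ b = c)) :
    ∫ ω, (Y a ω * Y b ω) * (Y c ω * Y d ω) ∂P = 0 := by
  let k : ι → ℕ := fun l =>
    (if l = a then 1 else 0) + (if l = b then 1 else 0) + (if l = c then 1 else 0) +
      (if l = d then 1 else 0)
  have e : ∀ ω, (Y a ω * Y b ω) * (Y c ω * Y d ω) = ∏ l, (Y l ω) ^ (k l) := by
    intro ω
    simp only [k, pow_add, Finset.prod_mul_distrib, pow_ite, pow_one, pow_zero,
      Finset.prod_ite_eq', Finset.mem_univ, if_true]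
    ring
  simp_rw [e]
  have hk := (h.indep.comp (fun l x => x ^ (k l))
    (fun l => measurable_id.pow_const _)).integral_fun_prod_eq_prod_integral
    (fun l => ((h.meas l).pow_const (k l)).aestronglyMeasurable)
  simp only [Function.comp_apply] at hk
  rw [hk]
  have hone : ∃ l, k l = 1 := by
    by_cases hac : a = c ∨ a = d
    · refine ⟨b, ?_⟩
      have hbc : b ≠ c := by rintro rfl; rcases hac with hac | hac <;> simp_all
      have hbd : b ≠ d := by rintro rfl; rcases hac with hac | hac <;> simp_all
      simp [k, hab.symm, hbc, hbd]
    · push Not at hac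
      exact ⟨a, by simp [k, hab, hac.1, hac.2]⟩
  obtain ⟨l, hl⟩ := hone
  refine Finset.prod_eq_zero (Finset.mem_univ l) ?_
  simp [hl, h.mean]

lemma sq_sum_eq_sum_sq_add {m : ℕ} (y : Fin m → ℝ) :
    (∑ i, y i) ^ 2 = ∑ i, y i ^ 2 +
      2 * ∑ e ∈ (Finset.univ.filter fun e : Fin m × Fin m => e.1 < e.2), y e.1 * y e.2 := by
  have hsplit : ∀ i k : Fin m, y i * y k = (if i = k then y i * y k else 0) +
      ((if i < k then y i * y k else 0) + (if k < i then y k * y i else 0)) := by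
    intro i k
    rcases lt_trichotomy i k with h | h | h
    · simp [h, h.ne, h.not_gt]
    · simp [h]
    · simp [h, h.ne', h.not_gt, mul_comm]
  rw [sq, Finset.sum_mul_sum, Finset.sum_filter, Fintype.sum_prod_type]
  conv_lhs => enter [2, i, 2, k]; rw [hsplit i k]
  simp only [Finset.sum_add_distrib, Finset.sum_ite_eq, Finset.mem_univ, if_true]
  rw [Finset.sum_comm (f := fun i k : Fin m => if k < i then y k * y i else 0), two_mul]
  simp [sq]

/-- The centred and normalized squared norm of a block of `m` vectors shifted by `d`. -/
noncomputable def blockStat {m p : ℕ} (d : Fin p → ℝ) (y : Fin m × Fin p → ℝ) : ℝ :=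
  ∑ j, ((∑ i, y (i, j) + m * d j) ^ 2 / m - 1)

lemma measurable_blockStat {m p : ℕ} (d : Fin p → ℝ) :
    Measurable (blockStat (m := m) d) := by
  unfold blockStat
  fun_prop

lemma blockStat_zero_eq {m p : ℕ} (hm : 0 < m) (y : Fin m × Fin p → ℝ) :
    (m : ℝ) * blockStat 0 y = ∑ l, (y l ^ 2 - 1) +
      2 * ∑ e ∈ (Finset.univ.filter fun e : (Fin m × Fin m) × Fin p => e.1.1 < e.1.2),
        y (e.1.1, e.2) * y (e.1.2, e.2) := by
  have hm0 : (m : ℝ) ≠ 0 := by positivity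
  rw [blockStat, Finset.mul_sum, Finset.sum_filter, Fintype.sum_prod_type_right,
    Fintype.sum_prod_type_right, Finset.mul_sum, ← Finset.sum_add_distrib]
  refine Finset.sum_congr rfl fun j _ => ?_
  have := sq_sum_eq_sum_sq_add fun i => y (i, j)
  rw [Finset.sum_filter] at this
  simp only [Pi.zero_apply, mul_zero, add_zero]
  rw [this, Finset.sum_sub_distrib]
  simp only [Finset.sum_const, Finset.card_univ, Fintype.card_fin, nsmul_eq_mul, mul_one]
  field_simp
  ring

lemma blockStat_eq_add {m p : ℕ} (hm : 0 < m) (d : Fin p → ℝ) (y : Fin m × Fin p → ℝ) :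
    blockStat d y = blockStat 0 y + 2 * ∑ l, d l.2 * y l + m * ∑ j, d j ^ 2 := by
  have hm0 : (m : ℝ) ≠ 0 := by positivity
  rw [blockStat, blockStat, Fintype.sum_prod_type_right, Finset.mul_sum, Finset.mul_sum,
    ← Finset.sum_add_distrib, ← Finset.sum_add_distrib]
  refine Finset.sum_congr rfl fun j _ => ?_
  simp only [Pi.zero_apply, mul_zero, add_zero]
  rw [← Finset.mul_sum]
  field_simp
  ring

lemma StdFamily.blockStat_tail [IsProbabilityMeasure P] {m p : ℕ} (hm : 0 < m) (hp : 0 < p)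
    {Y : Fin m × Fin p → Ω → ℝ} (h : StdFamily P q C Y) (hq1 : 1 ≤ q) (hq2 : q ≤ 2)
    {L : ℝ} (hL : 2 ≤ L) :
    P.real {ω | L * (p : ℝ) ^ (1 / q) ≤ |blockStat 0 fun l => Y l ω|} ≤ 16 * (C + 1) / L := by
  set s := Finset.univ.filter fun e : (Fin m × Fin m) × Fin p => e.1.1 < e.1.2 with hs
  let R : (Fin m × Fin m) × Fin p → Ω → ℝ := fun e ω => Y (e.1.1, e.2) ω * Y (e.1.2, e.2) ω
  have hm0 : (0 : ℝ) < m := by exact_mod_cast hm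
  have hm1 : (1 : ℝ) ≤ m := by exact_mod_cast hm
  have hp1 : (1 : ℝ) ≤ p := by exact_mod_cast hp
  have hp0 : (0 : ℝ) < p := by linarith
  have hne : ∀ e ∈ s, ((e.1.1, e.2) : Fin m × Fin p) ≠ (e.1.2, e.2) := by
    intro e he heq
    have he' : e.1.1 < e.1.2 := by simpa [hs] using he
    exact he'.ne (Prod.ext_iff.1 heq).1
  have hRL : ∀ e ∈ s, MemLp (R e) 2 P := fun e he => h.memLp_mul (hne e he)
  have hRsq : ∫ ω, (∑ e ∈ s, R e ω) ^ 2 ∂P ≤ (m : ℝ) ^ 2 * p := by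
    rw [integral_sq_sum_of_orthogonal s hRL]
    · rw [Finset.sum_congr rfl fun e he => h.integral_sq_mul (hne e he), Finset.sum_const,
        nsmul_eq_mul, mul_one]
      have := Finset.card_le_univ s
      simp only [Fintype.card_prod, Fintype.card_fin] at this
      rw [sq]
      exact_mod_cast this
    · intro e he e' he' hee
      have h1 : e.1.1 < e.1.2 := by simpa [hs] using he
      have h2 : e'.1.1 < e'.1.2 := by simpa [hs] using he'
      refine h.integral_four_eq_zero (hne e he) (hne e' he') ?_ ?_
      · rintro ⟨ha, hb⟩
        simp only [Prod.mk.injEq] at ha hb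
        exact hee (Prod.ext (Prod.ext ha.1 hb.1) ha.2)
      · rintro ⟨ha, hb⟩
        simp only [Prod.mk.injEq] at ha hb
        rw [ha.1, hb.1] at h1
        exact lt_asymm h1 h2
  have hRint : Integrable (fun ω => (∑ e ∈ s, R e ω) ^ 2) P :=
    (memLp_finsetSum s hRL).integrable_sq
  have : Nonempty (Fin m × Fin p) := ⟨(⟨0, hm⟩, ⟨0, hp⟩)⟩
  have hV := measureReal_sum_ge_le_of_moment (P := P) (V := fun l ω => Y l ω ^ 2 - 1)
    (fun l => ((h.meas l).pow_const 2).sub_const 1)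
    (h.indep.comp (fun _ x => x ^ 2 - 1) fun _ => (measurable_id.pow_const 2).sub_const 1)
    (fun l => (h.memLp l).integrable_sq.sub (integrable_const 1))
    (fun l => by rw [integral_sub (h.memLp l).integrable_sq (integrable_const 1), h.var]; simp)
    hq1 hq2 h.moment h.moment_le (L := L / 2) (by linarith)
  have hcard : (Fintype.card (Fin m × Fin p) : ℝ) ^ (1 / q) ≤ m * (p : ℝ) ^ (1 / q) := by
    simp only [Fintype.card_prod, Fintype.card_fin, Nat.cast_mul]
    rw [Real.mul_rpow hm0.le hp0.le]
    gcongr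
    calc (m : ℝ) ^ (1 / q) ≤ (m : ℝ) ^ (1 : ℝ) := by
          apply Real.rpow_le_rpow_of_exponent_le hm1
          rw [div_le_one (by linarith)]; exact hq1
      _ = m := Real.rpow_one _
  set w := (p : ℝ) ^ (1 / q) with hw
  have hw0 : 0 < w := Real.rpow_pos_of_pos hp0 _
  have hw2 : (p : ℝ) ≤ w ^ 2 := by
    calc (p : ℝ) = (p : ℝ) ^ (1 : ℝ) := (Real.rpow_one _).symm
      _ ≤ (p : ℝ) ^ (1 / q * 2) := by
          apply Real.rpow_le_rpow_of_exponent_le hp1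
          rw [div_mul_eq_mul_div, one_mul, le_div_iff₀ (by linarith)]; linarith
      _ = w ^ 2 := by rw [hw, Real.rpow_mul hp0.le]; simp
  have hR2 : P.real {ω | L / 4 * (m * w) ≤ |∑ e ∈ s, R e ω|} ≤ 16 / L := by
    refine (measureReal_ge_abs_le_integral_sq hRint (by positivity)).trans ?_
    rw [div_le_div_iff₀ (by positivity) (by linarith)]
    calc (∫ ω, (∑ e ∈ s, R e ω) ^ 2 ∂P) * L ≤ (m : ℝ) ^ 2 * w ^ 2 * L := by
          gcongr; exact hRsq.trans (by gcongr)
      _ ≤ (m : ℝ) ^ 2 * w ^ 2 * L * L := le_mul_of_one_le_right (by positivity) (by linarith)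
      _ = 16 * (L / 4 * (m * w)) ^ 2 := by ring
  have hsub : {ω | L * w ≤ |blockStat 0 fun l => Y l ω|} ⊆
      {ω | L / 2 * (Fintype.card (Fin m × Fin p) : ℝ) ^ (1 / q) ≤ |∑ l, (Y l ω ^ 2 - 1)|} ∪
        {ω | L / 4 * (m * w) ≤ |∑ e ∈ s, R e ω|} := by
    intro ω hω
    by_contra hcon
    simp only [Set.mem_union, Set.mem_ofPred_eq, not_or, not_le] at hcon hω
    have e := blockStat_zero_eq hm fun l => Y l ω
    have h1 : (m : ℝ) * |blockStat 0 fun l => Y l ω| ≤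
        |∑ l, (Y l ω ^ 2 - 1)| + 2 * |∑ e ∈ s, R e ω| := by
      calc (m : ℝ) * |blockStat 0 fun l => Y l ω| = |(m : ℝ) * blockStat 0 fun l => Y l ω| := by
            rw [abs_mul, abs_of_pos hm0]
        _ ≤ _ := by
            rw [e]
            refine (abs_add_le _ _).trans ?_
            rw [abs_mul, abs_two]
    have h2 : L / 2 * (Fintype.card (Fin m × Fin p) : ℝ) ^ (1 / q) ≤ L / 2 * (m * w) := by gcongr
    have h3 := mul_le_mul_of_nonneg_left hω hm0.le
    have h4 : (m : ℝ) * (L * w) = L / 2 * (m * w) + 2 * (L / 4 * (m * w)) := by ring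
    linarith [hcon.1, hcon.2]
  calc _ ≤ _ := measureReal_mono hsub (measure_ne_top _ _)
    _ ≤ _ := measureReal_union_le _ _
    _ ≤ 8 * C / (L / 2) + 16 / L := add_le_add hV hR2
    _ = 16 * (C + 1) / L := by field_simp; ring

lemma StdFamily.blockStat_shift_tail [IsProbabilityMeasure P] {m p : ℕ} (hm : 0 < m)
    (hp : 0 < p) {Y : Fin m × Fin p → Ω → ℝ} (h : StdFamily P q C Y) (hq1 : 1 ≤ q) (hq2 : q ≤ 2)
    {L : ℝ} (hL : 2 ≤ L) {d : Fin p → ℝ}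
    (hd : 4 * L * (p : ℝ) ^ (1 / q) ≤ m * ∑ j, d j ^ 2) :
    P.real {ω | blockStat d (fun l => Y l ω) ≤ L * (p : ℝ) ^ (1 / q)} ≤ 16 * (C + 2) / L := by
  have hp1 : (1 : ℝ) ≤ p := by exact_mod_cast hp
  set w := (p : ℝ) ^ (1 / q) with hw
  have hw1 : 1 ≤ w := Real.one_le_rpow hp1 (by positivity)
  set B : ℝ := m * ∑ j, d j ^ 2 with hB
  have hLB : 4 * L ≤ B := (le_mul_of_one_le_right (by linarith) hw1).trans hd
  have hDL : ∀ l ∈ Finset.univ, MemLp (fun ω => d l.2 * Y l ω) 2 P :=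
    fun l _ => (h.memLp l).const_mul _
  have hDint : Integrable (fun ω => (∑ l, d l.2 * Y l ω) ^ 2) P :=
    (memLp_finsetSum Finset.univ hDL).integrable_sq
  have hDsq : ∫ ω, (∑ l, d l.2 * Y l ω) ^ 2 ∂P = B := by
    rw [integral_sq_sum_of_orthogonal Finset.univ hDL]
    · simp_rw [mul_pow, integral_const_mul, h.var, mul_one]
      rw [Fintype.sum_prod_type_right, hB, Finset.mul_sum]
      simp
    · intro a _ b _ hab
      have e : ∀ ω, d a.2 * Y a ω * (d b.2 * Y b ω) = d a.2 * d b.2 * (Y a ω * Y b ω) :=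
        fun ω => by ring
      simp_rw [e, integral_const_mul, h.integral_mul_eq_zero hab, mul_zero]
  have hD : P.real {ω | B / 8 ≤ |∑ l, d l.2 * Y l ω|} ≤ 16 / L := by
    refine (measureReal_ge_abs_le_integral_sq hDint (by linarith)).trans ?_
    rw [hDsq, div_le_div_iff₀ (by nlinarith) (by linarith)]
    nlinarith
  have hsub : {ω | blockStat d (fun l => Y l ω) ≤ L * w} ⊆
      {ω | L * w ≤ |blockStat 0 fun l => Y l ω|} ∪ {ω | B / 8 ≤ |∑ l, d l.2 * Y l ω|} := by
    intro ω hω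
    by_contra hcon
    simp only [Set.mem_union, Set.mem_ofPred_eq, not_or, not_le] at hcon hω
    rw [blockStat_eq_add hm, ← hB] at hω
    have h1 := neg_abs_le (blockStat 0 fun l => Y l ω)
    have h2 := neg_abs_le (∑ l, d l.2 * Y l ω)
    nlinarith [hcon.1, hcon.2]
  calc _ ≤ _ := measureReal_mono hsub (measure_ne_top _ _)
    _ ≤ _ := measureReal_union_le _ _
    _ ≤ 16 * (C + 1) / L + 16 / L :=
        add_le_add (h.blockStat_tail hm hp hq1 hq2 hL) hD
    _ = 16 * (C + 2) / L := by ring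

/-- Median-of-means concentration: for a grid of `G` independent blocks, at least half of the
block statistics lie in `B` with probability at most `η ^ G`. -/
lemma StdFamily.half_blocks_le [IsProbabilityMeasure P] {G m p : ℕ}
    {Y : Fin G × (Fin m × Fin p) → Ω → ℝ} (h : StdFamily P q C Y) (d : Fin p → ℝ)
    {B : Set ℝ} (hB : MeasurableSet B) {η : ℝ} (hη0 : 0 ≤ η) (hη1 : η ≤ 1)
    (hg : ∀ g, P.real {ω | blockStat d (fun l => Y (g, l) ω) ∈ B} ≤ (η / 2) ^ 2) :
    P.real {ω | ∃ A : Finset (Fin G), G ≤ 2 * A.card ∧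
      ∀ g ∈ A, blockStat d (fun l => Y (g, l) ω) ∈ B} ≤ η ^ G :=
  measureReal_half_mem_le (F := fun g ω => blockStat d (fun l => Y (g, l) ω))
    ((iIndepFun_blocks h.meas h.indep).comp (fun _ => blockStat d)
      fun _ => measurable_blockStat d) hB hη0 hη1 hg

end Blocks

section Noise

open ProbabilityTheory

variable {p n : ℕ} {P : Measure (Fin n → Fin p → ℝ)} {ν : Fin n → Fin p → Measure ℝ}

lemma IsEntrywiseProduct.measure_biInter (h : IsEntrywiseProduct p n P ν)
    (hν : ∀ t j, IsProbabilityMeasure (ν t j)) (A : Finset (Fin n × Fin p))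
    {s : Fin n × Fin p → Set ℝ} (hs : ∀ l ∈ A, MeasurableSet (s l)) :
    P (⋂ l ∈ A, (fun E : Fin n → Fin p → ℝ => E l.1 l.2) ⁻¹' s l) =
      ∏ l ∈ A, ν l.1 l.2 (s l) := by
  have h2 := h.2 (fun t j => if (t, j) ∈ A then s (t, j) else Set.univ) (fun t j => by
    split_ifs with hA
    · exact hs _ hA
    · exact MeasurableSet.univ)
  have e1 : {x : Fin n → Fin p → ℝ | ∀ t j, x t j ∈ if (t, j) ∈ A then s (t, j) else Set.univ} =
      ⋂ l ∈ A, (fun E : Fin n → Fin p → ℝ => E l.1 l.2) ⁻¹' s l := by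
    ext x
    simp only [Set.mem_ofPred_eq, Set.mem_iInter, Set.mem_preimage]
    constructor
    · intro hx l hl
      have := hx l.1 l.2
      rwa [if_pos hl] at this
    · intro hx t j
      split_ifs with hA
      · exact hx _ hA
      · trivial
  rw [← e1, h2, ← Fintype.prod_prod_type
    (f := fun l : Fin n × Fin p => ν l.1 l.2 (if (l.1, l.2) ∈ A then s (l.1, l.2) else Set.univ)),
    ← Finset.prod_subset A.subset_univ]
  · exact Finset.prod_congr rfl fun l hl => by rw [if_pos hl]
  · intro l _ hl
    rw [if_neg hl]
    exact measure_univ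

lemma IsEntrywiseProduct.map_eval (h : IsEntrywiseProduct p n P ν)
    (hν : ∀ t j, IsProbabilityMeasure (ν t j)) (l : Fin n × Fin p) :
    P.map (fun E : Fin n → Fin p → ℝ => E l.1 l.2) = ν l.1 l.2 := by
  ext s hs
  rw [Measure.map_apply (by fun_prop) hs]
  simpa using h.measure_biInter hν {l} (s := fun _ => s) (fun _ _ => hs)

lemma IsEntrywiseProduct.iIndepFun_eval (h : IsEntrywiseProduct p n P ν)
    (hν : ∀ t j, IsProbabilityMeasure (ν t j)) :
    iIndepFun (fun (l : Fin n × Fin p) (E : Fin n → Fin p → ℝ) => E l.1 l.2) P := by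
  rw [iIndepFun_iff_measure_inter_preimage_eq_mul]
  intro A s hs
  rw [h.measure_biInter hν A hs]
  refine Finset.prod_congr rfl fun l hl => ?_
  rw [← h.map_eval hν l, Measure.map_apply (by fun_prop) (hs l hl)]

variable {α K : ℝ} {ν₀ : Measure ℝ}

lemma memP.integrable_sq (h : memP α K ν₀) : Integrable (fun x => x ^ 2) ν₀ := by
  refine ⟨by fun_prop, ?_⟩
  rw [hasFiniteIntegral_iff_ofReal (ae_of_all _ fun x => sq_nonneg x), h.2.2.2.1]
  exact ENNReal.one_lt_top

lemma memP.integral_sq (h : memP α K ν₀) : ∫ x, x ^ 2 ∂ν₀ = 1 := by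
  rw [integral_eq_lintegral_of_nonneg_ae (ae_of_all _ fun x => sq_nonneg x) (by fun_prop),
    h.2.2.2.1, ENNReal.toReal_one]

lemma memP.integrable_abs_div_rpow (h : memP α K ν₀) :
    Integrable (fun x => |x / K| ^ α) ν₀ := by
  refine ⟨((measurable_id.div_const K).abs.pow_const α).aestronglyMeasurable, ?_⟩
  rw [hasFiniteIntegral_iff_ofReal (ae_of_all _ fun x => by positivity)]
  exact h.2.2.2.2.trans_lt ENNReal.one_lt_top

lemma memP.integral_abs_div_rpow_le (h : memP α K ν₀) : ∫ x, |x / K| ^ α ∂ν₀ ≤ 1 := by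
  rw [integral_eq_lintegral_of_nonneg_ae (ae_of_all _ fun x => by positivity)
    h.integrable_abs_div_rpow.aestronglyMeasurable]
  exact ENNReal.toReal_le_of_le_ofReal zero_le_one (by simpa using h.2.2.2.2)

lemma abs_rpow_le_one_add {K r α x : ℝ} (hK : 0 < K) (hr0 : 0 ≤ r) (hr : r ≤ α) :
    |x| ^ r ≤ K ^ r * (1 + |x / K| ^ α) := by
  have e : |x| = K * |x / K| := by
    rw [abs_div, abs_of_pos hK]; field_simp
  conv_lhs => rw [e, Real.mul_rpow hK.le (abs_nonneg _)]
  gcongr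
  rcases le_total (|x / K|) 1 with h | h
  · have := Real.rpow_le_one (abs_nonneg (x / K)) h hr0
    have : 0 ≤ |x / K| ^ α := by positivity
    linarith
  · have := Real.rpow_le_rpow_of_exponent_le h hr
    linarith

lemma memP.integrable_abs_rpow (h : memP α K ν₀) (hK : 0 < K) {r : ℝ} (hr0 : 0 ≤ r)
    (hr : r ≤ α) : Integrable (fun x => |x| ^ r) ν₀ := by
  have := h.1
  refine (((integrable_const (1 : ℝ)).add h.integrable_abs_div_rpow).const_mul (K ^ r)).mono'
    (by fun_prop) (ae_of_all _ fun x => ?_)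
  rw [Real.norm_of_nonneg (by positivity)]
  exact abs_rpow_le_one_add hK hr0 hr

lemma memP.integral_abs_rpow_le (h : memP α K ν₀) (hK : 0 < K) {r : ℝ} (hr0 : 0 ≤ r)
    (hr : r ≤ α) : ∫ x, |x| ^ r ∂ν₀ ≤ 2 * K ^ r := by
  have := h.1
  calc ∫ x, |x| ^ r ∂ν₀ ≤ ∫ x, K ^ r * (1 + |x / K| ^ α) ∂ν₀ :=
        integral_mono (h.integrable_abs_rpow hK hr0 hr)
          (((integrable_const (1 : ℝ)).add h.integrable_abs_div_rpow).const_mul (K ^ r))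
          fun x => abs_rpow_le_one_add hK hr0 hr
    _ = K ^ r * (1 + ∫ x, |x / K| ^ α ∂ν₀) := by
        rw [integral_const_mul, integral_add (integrable_const _) h.integrable_abs_div_rpow]
        simp
    _ ≤ K ^ r * (1 + 1) := by
        gcongr
        exact h.integral_abs_div_rpow_le
    _ = 2 * K ^ r := by ring

lemma abs_sq_sub_one_rpow_le {a b q : ℝ} (hq0 : 0 ≤ q) (hq2 : q ≤ 2) :
    |((a - b) / √2) ^ 2 - 1| ^ q ≤ 4 * (|a| ^ (2 * q) + |b| ^ (2 * q)) + 1 := by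
  have key : ∀ c : ℝ, |((a - b) / √2) ^ 2 - 1| ≤ 2 * |c| ^ 2 →
      |((a - b) / √2) ^ 2 - 1| ^ q ≤ 4 * |c| ^ (2 * q) := by
    intro c hc
    calc |((a - b) / √2) ^ 2 - 1| ^ q ≤ (2 * |c| ^ 2) ^ q :=
          Real.rpow_le_rpow (abs_nonneg _) hc hq0
      _ = 2 ^ q * |c| ^ (2 * q) := by
          rw [Real.mul_rpow zero_le_two (by positivity), Real.rpow_mul (abs_nonneg c)]
          norm_num
      _ ≤ 2 ^ (2 : ℝ) * |c| ^ (2 * q) := by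
          gcongr
          norm_num
      _ = 4 * |c| ^ (2 * q) := by norm_num
  have ha : 0 ≤ |a| ^ (2 * q) := by positivity
  have hb : 0 ≤ |b| ^ (2 * q) := by positivity
  have e : ((a - b) / √2) ^ 2 = (a - b) ^ 2 / 2 := by
    rw [div_pow, Real.sq_sqrt zero_le_two]
  rcases le_total (((a - b) / √2) ^ 2) 1 with h | h
  · have h1 : |((a - b) / √2) ^ 2 - 1| ≤ 1 := by
      rw [abs_le]; constructor <;> linarith [sq_nonneg ((a - b) / √2)]
    have := Real.rpow_le_one (abs_nonneg _) h1 hq0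
    linarith
  · have h1 : |((a - b) / √2) ^ 2 - 1| ≤ a ^ 2 + b ^ 2 := by
      rw [abs_of_nonneg (by linarith), e]
      nlinarith [sq_nonneg (a + b)]
    rcases le_total (a ^ 2) (b ^ 2) with h2 | h2
    · have := key b (by rw [sq_abs]; linarith)
      linarith
    · have := key a (by rw [sq_abs]; linarith)
      linarith

/-- The antisymmetrized noise is a standardized family. -/
lemma IsEntrywiseProduct.stdFamily_Zb (h : IsEntrywiseProduct p n P ν)
    (hν : ∀ t j, memP α K (ν t j)) (hK : 0 < K) {q : ℝ} (hq0 : 0 ≤ q) (hq2 : q ≤ 2)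
    (hqα : 2 * q ≤ α) :
    StdFamily P q (1 + 16 * K ^ (2 * q))
      (fun (l : Fin (n / 2) × Fin p) (E : Fin n → Fin p → ℝ) => Zb p n E l.1 l.2) := by
  have hP := h.1
  have hν' : ∀ t j, IsProbabilityMeasure (ν t j) := fun t j => (hν t j).1
  let r : Fin (n / 2) × Fin p → Bool → Fin n × Fin p := fun l b =>
    (⟨if b then l.1 else n - 1 - l.1, by have := l.1.2; split_ifs <;> omega⟩, l.2)
  have hr : Function.Injective fun l : (Fin (n / 2) × Fin p) × Bool => r l.1 l.2 := by
    rintro ⟨⟨i, j⟩, b⟩ ⟨⟨i', j'⟩, b'⟩ heq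
    simp only [r, Prod.mk.injEq, Fin.mk.injEq] at heq
    have h1 := i.2
    have h2 := i'.2
    obtain ⟨h3, rfl⟩ := heq
    cases b <;> cases b' <;> simp only [if_true, Bool.false_eq_true, if_false] at h3 <;>
      simp only [Prod.mk.injEq, and_true, Bool.false_eq_true, Bool.true_eq_false, and_false,
        Fin.ext_iff] <;> omega
  let U : Fin n × Fin p → (Fin n → Fin p → ℝ) → ℝ := fun l E => E l.1 l.2
  have hU : ∀ l, Measurable (U l) := fun l => by fun_prop
  have hind : iIndepFun U P := h.iIndepFun_eval hν'
  have hmap : ∀ l, P.map (U l) = ν l.1 l.2 := h.map_eval hν'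
  have eZ : (fun (l : Fin (n / 2) × Fin p) (E : Fin n → Fin p → ℝ) => Zb p n E l.1 l.2) =
      fun l E => (U (r l true) E - U (r l false) E) / √2 := by
    funext l E
    have := l.1.2
    simp only [Zb, col, U, r, dif_pos (show (l.1 : ℕ) < n by omega),
      dif_pos (show n - 1 - (l.1 : ℕ) < n by omega), if_true, Bool.false_eq_true, if_false]
  have hint : ∀ (l) {f : ℝ → ℝ}, Measurable f → Integrable f (ν l.1 l.2) →
      Integrable (fun E => f (U l E)) P := by
    intro l f hf hfi
    rw [← hmap l] at hfi
    exact (integrable_map_measure hf.aestronglyMeasurable (hU l).aemeasurable).1 hfi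
  have hval : ∀ (l) {f : ℝ → ℝ}, Measurable f →
      ∫ E, f (U l E) ∂P = ∫ x, f x ∂(ν l.1 l.2) := by
    intro l f hf
    rw [← hmap l, integral_map (hU l).aemeasurable hf.aestronglyMeasurable]
  have hsq : ∀ l, MemLp (U l) 2 P := fun l =>
    (memLp_two_iff_integrable_sq (hU l).aestronglyMeasurable).2
      (hint l (f := fun x => x ^ 2) (by fun_prop) (hν _ _).integrable_sq)
  have hI1 : ∀ l, Integrable (U l) P := fun l => (hsq l).integrable one_le_two
  have hmean : ∀ l, ∫ E, U l E ∂P = 0 := fun l => by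
    rw [hval l (f := fun x => x) measurable_id]
    exact (hν _ _).2.2.1
  have hvar : ∀ l, ∫ E, U l E ^ 2 ∂P = 1 := fun l => by
    rw [hval l (f := fun x => x ^ 2) (by fun_prop)]
    exact (hν _ _).integral_sq
  have hq' : 0 ≤ 2 * q := by linarith
  have habs : ∀ l, Integrable (fun E => |U l E| ^ (2 * q)) P := fun l =>
    hint l (f := fun x => |x| ^ (2 * q)) (by fun_prop) ((hν _ _).integrable_abs_rpow hK hq' hqα)
  have habs' : ∀ l, ∫ E, |U l E| ^ (2 * q) ∂P ≤ 2 * K ^ (2 * q) := fun l => by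
    rw [hval l (f := fun x => |x| ^ (2 * q)) (by fun_prop)]
    exact (hν _ _).integral_abs_rpow_le hK hq' hqα
  have hdom : ∀ l, Integrable (fun E => 4 * (|U (r l true) E| ^ (2 * q) +
      |U (r l false) E| ^ (2 * q)) + 1) P := fun l =>
    (((habs _).add (habs _)).const_mul 4).add (integrable_const 1)
  have hmom : ∀ l, Integrable
      (fun E => |((U (r l true) E - U (r l false) E) / √2) ^ 2 - 1| ^ q) P := by
    intro l
    refine (hdom l).mono' (by fun_prop) (ae_of_all _ fun E => ?_)
    rw [Real.norm_of_nonneg (by positivity)]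
    exact abs_sq_sub_one_rpow_le hq0 hq2
  rw [eZ]
  refine ⟨fun l => by fun_prop, ?_, fun l => ?_, fun l => ?_, fun l => ?_, hmom, fun l => ?_⟩
  · exact (iIndepFun_blocks (X := fun l : (Fin (n / 2) × Fin p) × Bool => U (r l.1 l.2))
      (fun l => hU _) (hind.precomp hr)).comp
      (fun _ f => (f true - f false) / √2) fun _ => by fun_prop
  · simp_rw [div_eq_inv_mul]
    exact ((hsq _).sub (hsq _)).const_mul _
  · rw [integral_div, integral_sub (hI1 _) (hI1 _), hmean, hmean]
    simp
  · have hne : r l true ≠ r l false := fun heq => by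
      have := @hr (l, true) (l, false) heq
      simp at this
    have e : ∀ E, ((U (r l true) E - U (r l false) E) / √2) ^ 2 =
        (U (r l true) E ^ 2 + U (r l false) E ^ 2) / 2 - U (r l true) E * U (r l false) E := by
      intro E
      rw [div_pow, Real.sq_sqrt zero_le_two]
      ring
    have hii := hind.indepFun hne
    have hadd : Integrable (fun E => (U (r l true) E ^ 2 + U (r l false) E ^ 2) / 2) P :=
      ((hsq _).integrable_sq.add (hsq _).integrable_sq).div_const 2
    have hmul : Integrable (fun E => U (r l true) E * U (r l false) E) P :=
      hii.integrable_mul (hI1 _) (hI1 _)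
    simp_rw [e]
    rw [integral_sub hadd hmul, integral_div,
      integral_add (hsq _).integrable_sq (hsq _).integrable_sq, hvar, hvar,
      hii.integral_fun_mul_eq_mul_integral (hU _).aestronglyMeasurable
        (hU _).aestronglyMeasurable, hmean, hmean]
    norm_num
  · calc _ ≤ ∫ E, (4 * (|U (r l true) E| ^ (2 * q) + |U (r l false) E| ^ (2 * q)) + 1) ∂P :=
          integral_mono (hmom l) (hdom l) fun E => abs_sq_sub_one_rpow_le hq0 hq2
      _ = 4 * ((∫ E, |U (r l true) E| ^ (2 * q) ∂P) + ∫ E, |U (r l false) E| ^ (2 * q) ∂P) + 1 := by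
          have hadd : Integrable (fun E => 4 * (|U (r l true) E| ^ (2 * q) +
              |U (r l false) E| ^ (2 * q))) P := ((habs _).add (habs _)).const_mul 4
          rw [integral_add hadd (integrable_const 1),
            integral_const_mul, integral_add (habs _) (habs _)]
          simp
      _ ≤ 4 * (2 * K ^ (2 * q) + 2 * K ^ (2 * q)) + 1 := by
          gcongr <;> exact habs' _
      _ = 1 + 16 * K ^ (2 * q) := by ring

end Noise

section Statistic

variable {p n : ℕ}

lemma groupMean_add_eq {G m : ℕ} (hG : 0 < G) {θ E : Fin n → Fin p → ℝ} {d : Fin p → ℝ}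
    (hθ : ∀ i < G * m, ∀ j, Zb p n θ i j = d j) {g : ℕ} (hg : g < G) (j : Fin p) :
    groupMean p n (θ + E) (G * m) G g j =
      (∑ i : Fin m, Zb p n E (g * m + i) j + m * d j) / m := by
  have e : ∀ i < m, Zb p n (θ + E) (g * m + i) j = Zb p n E (g * m + i) j + d j := by
    intro i hi
    have hlt : g * m + i < G * m := by nlinarith
    rw [← hθ _ hlt j]
    unfold Zb col
    split_ifs <;> simp only [Pi.add_apply, Pi.zero_apply] <;> ring
  rw [groupMean, Nat.mul_div_cancel_left _ hG,
    Finset.sum_congr rfl fun i hi => e i (Finset.mem_range.1 hi), Finset.sum_add_distrib,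
    Finset.sum_const, Finset.card_range, nsmul_eq_mul, Finset.sum_range]

/-- Each entry of the median-of-means list is a rescaled block statistic. -/
lemma sum_groupMean_sq_eq {G m : ℕ} (hG : 0 < G) (hm : 0 < m) {θ E : Fin n → Fin p → ℝ}
    {d : Fin p → ℝ} (hθ : ∀ i < G * m, ∀ j, Zb p n θ i j = d j) {g : ℕ} (hg : g < G) :
    ∑ j, (groupMean p n (θ + E) (G * m) G g j ^ 2 - (G : ℝ) / ((G * m : ℕ) : ℝ)) =
      blockStat d (fun l : Fin m × Fin p => Zb p n E (g * m + l.1) l.2) / m := by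
  have hG0 : (G : ℝ) ≠ 0 := by positivity
  have hm0 : (m : ℝ) ≠ 0 := by positivity
  rw [blockStat, Finset.sum_div]
  refine Finset.sum_congr rfl fun j _ => ?_
  rw [groupMean_add_eq hG hθ hg j]
  push_cast
  field_simp

lemma one_lt_AMoM_div_iff {G m : ℕ} (hG : 0 < G) (hm : 0 < m) {θ E : Fin n → Fin p → ℝ}
    {d : Fin p → ℝ} (hθ : ∀ i < G * m, ∀ j, Zb p n θ i j = d j) {c : ℝ} (hc : 0 < c) :
    1 < AMoM p n (θ + E) (G * m) G / (c * G) ↔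
      c / m < median (List.ofFn fun g : Fin G =>
        blockStat d (fun l : Fin m × Fin p => Zb p n E (g * m + l.1) l.2) / m) := by
  have hG0 : (0 : ℝ) < G := by exact_mod_cast hG
  have hm0 : (0 : ℝ) < m := by exact_mod_cast hm
  rw [AMoM, funext fun g : Fin G => sum_groupMean_sq_eq hG hm hθ g.2, one_lt_div (by positivity),
    div_lt_iff₀ hm0]
  push_cast
  rw [mul_comm c, mul_assoc, mul_lt_mul_iff_right₀ hG0, mul_comm (m : ℝ)]

end Statistic

section Errors

variable {p n : ℕ} {P : Measure (Fin n → Fin p → ℝ)} {q C : ℝ}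

/-- The `G` consecutive blocks of length `m` of a standardized family. -/
lemma StdFamily.blocks {G m : ℕ} (h : StdFamily P q C
      (fun (l : Fin (n / 2) × Fin p) (E : Fin n → Fin p → ℝ) => Zb p n E l.1 l.2))
    (hGm : G * m ≤ n / 2) :
    StdFamily P q C (fun (l : Fin G × (Fin m × Fin p)) (E : Fin n → Fin p → ℝ) =>
      Zb p n E (l.1 * m + l.2.1) l.2.2) := by
  have hlt : ∀ l : Fin G × (Fin m × Fin p), (l.1 : ℕ) * m + l.2.1 < n / 2 := fun l => by
    have h1 := l.1.2
    have h2 := l.2.1.2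
    nlinarith
  refine h.precomp (g := fun l : Fin G × (Fin m × Fin p) =>
    ((⟨l.1 * m + l.2.1, hlt l⟩, l.2.2) : Fin (n / 2) × Fin p)) ?_
  rintro ⟨g, i, j⟩ ⟨g', i', j'⟩ heq
  simp only [Prod.mk.injEq, Fin.mk.injEq] at heq
  obtain ⟨h1, rfl⟩ := heq
  have hm : 0 < m := i.pos
  have hdiv : (g : ℕ) = g' := by
    have := congrArg (· / m) h1
    simpa [Nat.add_div_of_dvd_right, Nat.mul_div_cancel _ hm, Nat.div_eq_of_lt i.2,
      Nat.div_eq_of_lt i'.2] using this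
  have hmod : (i : ℕ) = i' := by
    rw [hdiv] at h1
    omega
  simp [Fin.ext_iff, hdiv, hmod]

variable [IsProbabilityMeasure P]

lemma measureReal_one_lt_AMoM_le {G m : ℕ} (hG : 0 < G) (hm : 0 < m) (hp : 0 < p)
    (h : StdFamily P q C
      (fun (l : Fin (n / 2) × Fin p) (E : Fin n → Fin p → ℝ) => Zb p n E l.1 l.2))
    (hq1 : 1 ≤ q) (hq2 : q ≤ 2) (hGm : G * m ≤ n / 2) {θ : Fin n → Fin p → ℝ}
    (hθ : ∀ i < G * m, ∀ j, Zb p n θ i j = 0) {L η : ℝ} (hL : 2 ≤ L) (hη0 : 0 ≤ η)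
    (hη1 : η ≤ 1) (hLη : 16 * (C + 1) / L ≤ (η / 2) ^ 2) :
    P.real {E | 1 < AMoM p n (θ + E) (G * m) G / (L * (p : ℝ) ^ (1 / q) * G)} ≤ η ^ G := by
  have hb := h.blocks hGm
  have hm0 : (0 : ℝ) < m := by exact_mod_cast hm
  have hp0 : (0 : ℝ) < p := by exact_mod_cast hp
  have hw : 0 < L * (p : ℝ) ^ (1 / q) := by positivity
  refine (measureReal_mono ?_ (measure_ne_top _ _)).trans (hb.half_blocks_le 0
    (measurableSet_Ioi (a := L * (p : ℝ) ^ (1 / q))) hη0 hη1 fun g => ?_)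
  · intro E hE
    rw [Set.mem_ofPred_eq, one_lt_AMoM_div_iff hG hm (d := 0) hθ hw] at hE
    obtain ⟨A, hA, hlt⟩ := exists_half_lt_of_lt_median hG _ hE
    exact ⟨A, hA, fun g hg => (div_lt_div_iff_of_pos_right hm0).1 (hlt g hg)⟩
  · refine (measureReal_mono ?_ (measure_ne_top _ _)).trans
      (((hb.precomp (g := fun l => (g, l)) fun a b hab => (Prod.ext_iff.1 hab).2).blockStat_tail
        hm hp hq1 hq2 hL).trans hLη)
    intro E hE
    have hlt : L * (p : ℝ) ^ (1 / q) < blockStat 0 _ := hE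
    exact hlt.le.trans (le_abs_self _)

lemma measureReal_AMoM_le_le {G m : ℕ} (hG : 0 < G) (hm : 0 < m) (hp : 0 < p)
    (h : StdFamily P q C
      (fun (l : Fin (n / 2) × Fin p) (E : Fin n → Fin p → ℝ) => Zb p n E l.1 l.2))
    (hq1 : 1 ≤ q) (hq2 : q ≤ 2) (hGm : G * m ≤ n / 2) {θ : Fin n → Fin p → ℝ} {d : Fin p → ℝ}
    (hθ : ∀ i < G * m, ∀ j, Zb p n θ i j = d j) {L η : ℝ} (hL : 2 ≤ L) (hη0 : 0 ≤ η)
    (hη1 : η ≤ 1) (hLη : 16 * (C + 2) / L ≤ (η / 2) ^ 2)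
    (hd : 4 * L * (p : ℝ) ^ (1 / q) ≤ m * ∑ j, d j ^ 2) :
    P.real {E | ¬ 1 < AMoM p n (θ + E) (G * m) G / (L * (p : ℝ) ^ (1 / q) * G)} ≤ η ^ G := by
  have hb := h.blocks hGm
  have hm0 : (0 : ℝ) < m := by exact_mod_cast hm
  have hp0 : (0 : ℝ) < p := by exact_mod_cast hp
  have hw : 0 < L * (p : ℝ) ^ (1 / q) := by positivity
  refine (measureReal_mono ?_ (measure_ne_top _ _)).trans (hb.half_blocks_le d
    (measurableSet_Iic (a := L * (p : ℝ) ^ (1 / q))) hη0 hη1 fun g => ?_)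
  · intro E hE
    rw [Set.mem_ofPred_eq, one_lt_AMoM_div_iff hG hm hθ hw, not_lt] at hE
    obtain ⟨A, hA, hle⟩ := exists_half_le_of_median_le hG _ hE
    exact ⟨A, hA, fun g hg => (div_le_div_iff_of_pos_right hm0).1 (hle g hg)⟩
  · exact ((hb.precomp (g := fun l => (g, l))
      fun a b hab => (Prod.ext_iff.1 hab).2).blockStat_shift_tail hm hp hq1 hq2 hL hd).trans hLη

end Errors

section Grid

lemma log_eight_mul_ge {n : ℕ} (hn : 2 ≤ n) : Real.exp 1 ≤ Real.log (8 * n) := by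
  have h1 : Real.log 16 ≤ Real.log (8 * n) := by
    apply Real.log_le_log (by norm_num)
    have : (2 : ℝ) ≤ n := by exact_mod_cast hn
    linarith
  have h2 : Real.log 16 = 4 * Real.log 2 := by
    rw [show (16 : ℝ) = 2 ^ 4 by norm_num, Real.log_pow]; norm_num
  linarith [Real.log_two_gt_d9, Real.exp_one_lt_d9]

lemma one_le_LL {n : ℕ} (hn : 2 ≤ n) : 1 ≤ LL n := by
  have := log_eight_mul_ge hn
  rw [LL, Real.le_log_iff_exp_le ((Real.exp_pos 1).trans_le this)]
  exact this

lemma DeltaDense_bounds {n : ℕ} (hn : 2 ≤ n) :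
    8 * LL n ≤ DeltaDense n ∧ (DeltaDense n : ℝ) ≤ 16 * LL n := by
  have h1 := one_le_LL hn
  have h0 : 0 < LL n := by linarith
  have hlog : 0 ≤ Real.logb 2 (LL n) := Real.logb_nonneg one_lt_two h1
  set c := ⌈Real.logb 2 (LL n)⌉ with hc
  have hc0 : 0 ≤ c := Int.ceil_nonneg hlog
  have hcast : ((c.toNat : ℕ) : ℝ) = (c : ℝ) := by
    exact_mod_cast congrArg (Int.cast : ℤ → ℝ) (Int.toNat_of_nonneg hc0)
  have e : (DeltaDense n : ℝ) = 8 * (2 : ℝ) ^ (c : ℝ) := by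
    rw [DeltaDense, pow_add, ← hc, ← hcast, Real.rpow_natCast]
    push_cast
    norm_num
  have eL : (2 : ℝ) ^ Real.logb 2 (LL n) = LL n := Real.rpow_logb two_pos (by norm_num) h0
  have h2 : LL n ≤ (2 : ℝ) ^ (c : ℝ) := by
    conv_lhs => rw [← eL]
    exact Real.rpow_le_rpow_of_exponent_le one_le_two (Int.le_ceil _)
  have h3 : (2 : ℝ) ^ (c : ℝ) ≤ 2 * LL n := by
    conv_rhs => rw [← eL]
    rw [mul_comm, ← Real.rpow_add_one two_ne_zero]
    exact Real.rpow_le_rpow_of_exponent_le one_le_two (Int.ceil_lt_add_one _).le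
  rw [e]
  constructor <;> linarith

lemma min_DeltaDense_dvd (n k : ℕ) : min (2 ^ k) (DeltaDense n) ∣ 2 ^ k := by
  rcases le_total (2 ^ k) (DeltaDense n) with h | h
  · rw [min_eq_left h]
  · rw [min_eq_right h]
    exact pow_dvd_pow 2 ((Nat.pow_le_pow_iff_right one_lt_two).1 h)

lemma min_DeltaDense_pos (n k : ℕ) : 0 < min (2 ^ k) (DeltaDense n) :=
  lt_min (by positivity) (by unfold DeltaDense; positivity)

lemma pow_le_half_of_le_log {n k : ℕ} (hn : 2 ≤ n) (hk : k ≤ Nat.log 2 (n / 2)) :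
    2 ^ k ≤ n / 2 :=
  (Nat.pow_le_pow_right two_pos hk).trans (Nat.pow_log_le_self 2 (by omega))

lemma log_two_half_add_one_le {n : ℕ} (hn : 2 ≤ n) :
    ((Nat.log 2 (n / 2) + 1 : ℕ) : ℝ) ≤ 2 * Real.log (8 * n) := by
  have hn0 : (0 : ℝ) < n := by positivity
  have h1 : 2 ^ (Nat.log 2 (n / 2) + 1) ≤ n := by
    have := pow_le_half_of_le_log hn le_rfl
    rw [pow_succ]
    omega
  have h2 : ((2 : ℝ) ^ (Nat.log 2 (n / 2) + 1)) ≤ 8 * n := by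
    have : ((2 : ℝ) ^ (Nat.log 2 (n / 2) + 1)) ≤ n := by exact_mod_cast h1
    linarith
  have h3 := Real.log_le_log (by positivity) h2
  rw [Real.log_pow] at h3
  have h4 := Real.log_two_gt_d9
  have h5 : (0 : ℝ) ≤ ((Nat.log 2 (n / 2) + 1 : ℕ) : ℝ) := Nat.cast_nonneg _
  nlinarith

lemma pow_DeltaDense_le {n : ℕ} (hn : 2 ≤ n) {η : ℝ} (hη0 : 0 ≤ η) (hη1 : η ≤ 1 / 8) :
    η ^ DeltaDense n ≤ η / Real.log (8 * n) := by
  have hL := one_le_LL hn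
  have hΔ := (DeltaDense_bounds hn).1
  have hpos : 0 < Real.log (8 * n) := (Real.exp_pos 1).trans_le (log_eight_mul_ge hn)
  have hΔ1 : 1 ≤ DeltaDense n := by
    have : (1 : ℝ) ≤ DeltaDense n := by linarith
    exact_mod_cast this
  have hη : η ≤ Real.exp (-1) := by
    rw [Real.exp_neg, ← one_div, le_div_iff₀ (Real.exp_pos 1)]
    nlinarith [Real.exp_one_lt_d9, Real.exp_pos 1]
  obtain ⟨N, hN⟩ := Nat.exists_eq_add_of_le' hΔ1
  have hNL : LL n ≤ N := by
    have : (DeltaDense n : ℝ) = N + 1 := by exact_mod_cast hN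
    linarith
  rw [hN, pow_succ, mul_comm, div_eq_mul_inv]
  gcongr
  calc η ^ N ≤ Real.exp (-1) ^ N := pow_le_pow_left₀ hη0 hη N
    _ = Real.exp (-N) := by rw [← Real.exp_nat_mul]; ring_nf
    _ ≤ Real.exp (-LL n) := Real.exp_le_exp.2 (by linarith)
    _ = (Real.log (8 * n))⁻¹ := by rw [Real.exp_neg, LL, Real.exp_log hpos]

lemma sum_pow_two_pow_le {η : ℝ} (hη0 : 0 ≤ η) (hη1 : η ≤ 1 / 2) (N : ℕ) :
    ∑ k ∈ Finset.range N, η ^ 2 ^ k ≤ 2 * η := by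
  have h : ∀ N, ∑ k ∈ Finset.range N, η ^ (k + 1) ≤ 2 * η - η ^ N * (2 * η) := by
    intro N
    induction N with
    | zero => simp
    | succ N ih =>
      rw [Finset.sum_range_succ]
      have : 0 ≤ η ^ N * η := by positivity
      rw [pow_succ]
      nlinarith
  calc ∑ k ∈ Finset.range N, η ^ 2 ^ k ≤ ∑ k ∈ Finset.range N, η ^ (k + 1) :=
        Finset.sum_le_sum fun k _ =>
          pow_le_pow_of_le_one hη0 (by linarith) (Nat.lt_two_pow_self : k < 2 ^ k)
    _ ≤ 2 * η - η ^ N * (2 * η) := h N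
    _ ≤ 2 * η := by
        have : 0 ≤ η ^ N * (2 * η) := by positivity
        linarith

lemma sum_pow_min_DeltaDense_le {n : ℕ} (hn : 2 ≤ n) {η : ℝ} (hη0 : 0 ≤ η)
    (hη1 : η ≤ 1 / 8) :
    ∑ k ∈ Finset.range (Nat.log 2 (n / 2) + 1), η ^ min (2 ^ k) (DeltaDense n) ≤ 4 * η := by
  have hpos : 0 < Real.log (8 * n) := (Real.exp_pos 1).trans_le (log_eight_mul_ge hn)
  have hmin : ∀ a b : ℕ, η ^ min a b ≤ η ^ a + η ^ b := fun a b => by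
    have ha : 0 ≤ η ^ a := by positivity
    have hb : 0 ≤ η ^ b := by positivity
    rcases min_choice a b with h | h <;> rw [h] <;> linarith
  calc _ ≤ ∑ k ∈ Finset.range (Nat.log 2 (n / 2) + 1), (η ^ 2 ^ k + η ^ DeltaDense n) :=
        Finset.sum_le_sum fun k _ => hmin _ _
    _ = ∑ k ∈ Finset.range (Nat.log 2 (n / 2) + 1), η ^ 2 ^ k +
          ((Nat.log 2 (n / 2) + 1 : ℕ) : ℝ) * η ^ DeltaDense n := by
        rw [Finset.sum_add_distrib, Finset.sum_const, Finset.card_range, nsmul_eq_mul]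
    _ ≤ 2 * η + 2 * Real.log (8 * n) * (η / Real.log (8 * n)) := by
        gcongr
        · exact sum_pow_two_pow_le hη0 (by linarith) _
        · exact log_two_half_add_one_le hn
        · exact pow_DeltaDense_le hn hη0 hη1
    _ = 4 * η := by field_simp; ring

lemma mul_sub_div_le_min {a n : ℕ} (ha : 1 ≤ a) (han : a ≤ n - 1) :
    (a : ℝ) * ((n : ℝ) - a) / n ≤ ((min a (n - a) : ℕ) : ℝ) := by
  have h1 : (a : ℝ) ≤ n := by exact_mod_cast (by omega : a ≤ n)
  have hn0 : (0 : ℝ) < n := by exact_mod_cast (by omega : 0 < n)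
  have ha0 : (0 : ℝ) ≤ a := Nat.cast_nonneg a
  rw [div_le_iff₀ hn0, Nat.cast_min, Nat.cast_sub (by omega)]
  rcases le_total (a : ℝ) (n - a) with h | h
  · rw [min_eq_left h]; nlinarith
  · rw [min_eq_right h]; nlinarith

end Grid

section Risk

lemma integral_le_measureReal {Ω : Type*} [MeasurableSpace Ω] {P : Measure Ω} [IsFiniteMeasure P]
    {f : Ω → ℝ} {S : Set Ω} (h0 : ∀ ω, 0 ≤ f ω) (h1 : ∀ ω, f ω ≤ 1) (hS : ∀ ω ∉ S, f ω ≤ 0) :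
    ∫ ω, f ω ∂P ≤ P.real S := by
  have hm := measurableSet_toMeasurable P S
  calc ∫ ω, f ω ∂P ≤ ∫ ω, (toMeasurable P S).indicator (fun _ => (1 : ℝ)) ω ∂P := by
        refine integral_mono_of_nonneg (ae_of_all _ h0)
          ((integrable_const (1 : ℝ)).indicator hm) (ae_of_all _ fun ω => ?_)
        by_cases hω : ω ∈ toMeasurable P S
        · simpa [hω] using h1 ω
        · simpa [hω] using hS ω fun h => hω (subset_toMeasurable P S h)
    _ = P.real S := by
        rw [integral_indicator_const _ hm, smul_eq_mul, mul_one, Measure.real, measure_toMeasurable, Measure.real]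

lemma risk_le {p n : ℕ} {Q : Set (Measure (Fin n → Fin p → ℝ))} {Θ : Set (Fin n → Fin p → ℝ)}
    {φ : (Fin n → Fin p → ℝ) → ℝ} {ε : ℝ} (hε : 0 ≤ ε)
    (h0 : ∀ P ∈ Q, ∀ θ ∈ Theta0 p n, ∫ E, φ (θ + E) ∂P ≤ ε / 2)
    (h1 : ∀ P ∈ Q, ∀ θ ∈ Θ, ∫ E, (1 - φ (θ + E)) ∂P ≤ ε / 2) : risk p n Q Θ φ ≤ ε := by
  have h : 0 ≤ ε / 2 := by linarith
  rw [risk, ← add_halves ε]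
  refine add_le_add ?_ ?_
  · exact Real.iSup_le (fun P => Real.iSup_le (fun hP => Real.iSup_le (fun θ =>
      Real.iSup_le (fun hθ => h0 P hP θ hθ) h) h) h) h
  · exact Real.iSup_le (fun P => Real.iSup_le (fun hP => Real.iSup_le (fun θ =>
      Real.iSup_le (fun hθ => h1 P hP θ hθ) h) h) h) h

end Risk

section DenseTest

variable {p n : ℕ} {P : Measure (Fin n → Fin p → ℝ)} [IsProbabilityMeasure P] {α q C : ℝ}

lemma phiPdense_nonneg (C₁ : ℝ) (X : Fin n → Fin p → ℝ) : 0 ≤ phiPdense p n α C₁ X := by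
  unfold phiPdense
  split_ifs <;> norm_num

lemma phiPdense_le_one (C₁ : ℝ) (X : Fin n → Fin p → ℝ) : phiPdense p n α C₁ X ≤ 1 := by
  unfold phiPdense
  split_ifs <;> norm_num

/-- Type I error of the dense median-of-means test. -/
lemma integral_phiPdense_le (hp : 0 < p) (hn : 2 ≤ n)
    (h : StdFamily P q C
      (fun (l : Fin (n / 2) × Fin p) (E : Fin n → Fin p → ℝ) => Zb p n E l.1 l.2))
    (hq1 : 1 ≤ q) (hq2 : q ≤ 2) (hqα : max ((1 : ℝ) / 2) (2 / α) = 1 / q)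
    {θ : Fin n → Fin p → ℝ} (hθ : θ ∈ Theta0 p n) {L η : ℝ} (hL : 2 ≤ L) (hη0 : 0 ≤ η)
    (hη1 : η ≤ 1 / 8) (hLη : 16 * (C + 1) / L ≤ (η / 2) ^ 2) :
    ∫ E, phiPdense p n α L (θ + E) ∂P ≤ 4 * η := by
  obtain ⟨μ, hμ⟩ := hθ
  let S : ℕ → Set (Fin n → Fin p → ℝ) := fun k =>
    {E | 1 < AMoM p n (θ + E) (2 ^ k) (min (2 ^ k) (DeltaDense n)) /
      (L * (p : ℝ) ^ (1 / q) * ((min (2 ^ k) (DeltaDense n) : ℕ) : ℝ))}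
  have hS : ∀ k ∈ Finset.range (Nat.log 2 (n / 2) + 1),
      P.real (S k) ≤ η ^ min (2 ^ k) (DeltaDense n) := by
    intro k hk
    have hk2 := pow_le_half_of_le_log hn (Nat.lt_succ_iff.1 (Finset.mem_range.1 hk))
    have hG := min_DeltaDense_pos n k
    obtain ⟨m, hm⟩ := min_DeltaDense_dvd n k
    have hm0 : 0 < m := by
      rcases Nat.eq_zero_or_pos m with rfl | h0
      · simp at hm
      · exact h0
    have hlt : min (2 ^ k) (DeltaDense n) * m ≤ n / 2 := hm ▸ hk2
    have := measureReal_one_lt_AMoM_le hG hm0 hp h hq1 hq2 hlt (θ := θ) (fun i hi j => by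
      rw [Zb, col, col, dif_pos (by omega : i < n), dif_pos (by omega : n - 1 - i < n), hμ, hμ]
      simp) hL hη0 (by linarith) hLη
    rw [← hm] at this
    exact this
  refine (integral_le_measureReal (S := ⋃ k ∈ Finset.range (Nat.log 2 (n / 2) + 1), S k)
    (fun E => phiPdense_nonneg L _) (fun E => phiPdense_le_one L _) fun E hE => ?_).trans ?_
  · rw [phiPdense, if_neg]
    rintro ⟨t, ht, hlt⟩
    obtain ⟨k, hk, rfl⟩ := Finset.mem_image.1 ht
    rw [hqα] at hlt
    exact hE (Set.mem_biUnion hk hlt)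
  · exact (measureReal_biUnion_finset_le _ _).trans
      ((Finset.sum_le_sum hS).trans (sum_pow_min_DeltaDense_le hn hη0 hη1))

/-- Type II error of the dense median-of-means test. -/
lemma integral_one_sub_phiPdense_le (hp : 0 < p) (hn : 2 ≤ n)
    (h : StdFamily P q C
      (fun (l : Fin (n / 2) × Fin p) (E : Fin n → Fin p → ℝ) => Zb p n E l.1 l.2))
    (hq1 : 1 ≤ q) (hq2 : q ≤ 2) (hqα : max ((1 : ℝ) / 2) (2 / α) = 1 / q) {s : ℕ} {ρ : ℝ}
    {θ : Fin n → Fin p → ℝ} (hθ : θ ∈ Theta1 p n s ρ) {L η : ℝ} (hL : 2 ≤ L) (hη0 : 0 ≤ η)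
    (hη1 : η ≤ 1) (hLη : 16 * (C + 2) / L ≤ (η / 2) ^ 2)
    (hρ : 256 * L * (p : ℝ) ^ (1 / q) * LL n ≤ ρ ^ 2) :
    ∫ E, (1 - phiPdense p n α L (θ + E)) ∂P ≤ η := by
  simp only [Theta1, Set.mem_iUnion, Finset.mem_Icc] at hθ
  obtain ⟨a, ⟨ha1, han⟩, μ₁, μ₂, hμ₁, hμ₂, -, hsig⟩ := hθ
  set b := min a (n - a) with hb
  have hb0 : b ≠ 0 := by omega
  set k := Nat.log 2 b with hk
  have hkb : 2 ^ k ≤ b := Nat.pow_log_le_self 2 hb0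
  have hbk : b < 2 ^ (k + 1) := Nat.lt_pow_succ_log_self one_lt_two b
  have hkn : k ≤ Nat.log 2 (n / 2) := Nat.log_mono_right (by omega)
  have hk2 := pow_le_half_of_le_log hn hkn
  have hG := min_DeltaDense_pos n k
  have hGΔ : min (2 ^ k) (DeltaDense n) ≤ DeltaDense n := min_le_right _ _
  obtain ⟨m, hm⟩ := min_DeltaDense_dvd n k
  have hmem : 2 ^ k ∈ Tgrid n :=
    Finset.mem_image_of_mem _ (Finset.mem_range.2 (Nat.lt_succ_of_le hkn))
  set G := min (2 ^ k) (DeltaDense n) with hGdef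
  have hm0 : 0 < m := by
    rcases Nat.eq_zero_or_pos m with rfl | h0
    · simp at hm
    · exact h0
  have hLL := one_le_LL hn
  have hG16 : (G : ℝ) ≤ 16 * LL n :=
    (by exact_mod_cast hGΔ : (G : ℝ) ≤ DeltaDense n).trans (DeltaDense_bounds hn).2
  have hG0 : (0 : ℝ) < G := by exact_mod_cast hG
  set D := sqnorm p (fun j => μ₁ j - μ₂ j) with hD
  have hD0 : 0 ≤ D := Finset.sum_nonneg fun j _ => sq_nonneg _
  have hsum : ∑ j, ((μ₁ j - μ₂ j) / √2) ^ 2 = D / 2 := by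
    rw [hD, sqnorm, Finset.sum_div]
    refine Finset.sum_congr rfl fun j _ => ?_
    rw [div_pow, Real.sq_sqrt zero_le_two]
  have hstrength : ρ ^ 2 ≤ 2 * (G * m) * D := by
    refine hsig.trans (mul_le_mul_of_nonneg_right ?_ hD0)
    refine (mul_sub_div_le_min ha1 han).trans ?_
    have : b ≤ 2 * (G * m) := by rw [← hm]; rw [pow_succ] at hbk; omega
    exact_mod_cast this
  have hd : 4 * L * (p : ℝ) ^ (1 / q) ≤ m * ∑ j, ((μ₁ j - μ₂ j) / √2) ^ 2 := by
    rw [hsum]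
    have hw : 0 ≤ 16 * L * (p : ℝ) ^ (1 / q) := by positivity
    have h1 : 16 * L * (p : ℝ) ^ (1 / q) * G ≤ 16 * L * (p : ℝ) ^ (1 / q) * (16 * LL n) :=
      mul_le_mul_of_nonneg_left hG16 hw
    have h2 : G * (16 * L * (p : ℝ) ^ (1 / q)) ≤ G * (2 * m * D) := by nlinarith
    have h3 := le_of_mul_le_mul_left h2 hG0
    linarith
  have hprob := measureReal_AMoM_le_le hG hm0 hp h hq1 hq2 (hm ▸ hk2) (θ := θ)
    (d := fun j => (μ₁ j - μ₂ j) / √2) (fun i hi j => by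
      rw [← hm] at hi
      rw [Zb, col, col, dif_pos (by omega : i < n), dif_pos (by omega : n - 1 - i < n),
        hμ₁ _ (by simp only; omega), hμ₂ _ (by simp only; omega)])
    hL hη0 hη1 hLη hd
  rw [← hm] at hprob
  refine (integral_le_measureReal (fun E => sub_nonneg.2 (phiPdense_le_one L _))
    (fun E => sub_le_self _ (phiPdense_nonneg L _)) fun E hE => ?_).trans
    (hprob.trans (pow_le_of_le_one hη0 hη1 hG.ne'))
  rw [phiPdense, if_pos, sub_self]
  refine ⟨2 ^ k, hmem, ?_⟩
  rw [hqα]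
  exact not_not.1 hE

lemma max_half_two_div_eq {α : ℝ} (hα : 2 ≤ α) :
    max ((1 : ℝ) / 2) (2 / α) = 1 / min (α / 2) 2 := by
  have hα0 : 0 < α := by linarith
  rcases le_total α 4 with h | h
  · rw [min_eq_left (by linarith), max_eq_right, one_div_div]
    rw [div_le_div_iff₀ two_pos hα0]; linarith
  · rw [min_eq_right (by linarith), max_eq_left]
    rw [div_le_div_iff₀ hα0 two_pos]; linarith

end DenseTest

/-- Theorem: dense median-of-means testing under finite-moment noise. -/
theorem statement_3 (α K ε : ℝ) (hα : 2 ≤ α) (hK : 0 < K) (hε0 : 0 < ε) (hε1 : ε < 1) :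
    ∃ C₁ C₂ : ℝ, 0 < C₁ ∧ 0 < C₂ ∧
      ∀ p n s : ℕ, 0 < p → 2 ≤ n → 1 ≤ s → s ≤ p → ∀ ρ : ℝ,
        C₂ * (p : ℝ) ^ max ((2 : ℝ) / α) ((1 : ℝ) / 2) * LL n ≤ ρ ^ 2 →
        risk p n (Pclass p n α K) (Theta1 p n s ρ) (phiPdense p n α C₁) ≤ ε := by
  set q := min (α / 2) 2 with hq
  have hq1 : 1 ≤ q := le_min (by linarith) one_le_two
  have hq2 : q ≤ 2 := min_le_right _ _
  have hq3 : 2 * q ≤ α := by linarith [min_le_left (α / 2) 2]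
  have hqα : max ((1 : ℝ) / 2) (2 / α) = 1 / q := max_half_two_div_eq hα
  set C := 1 + 16 * K ^ (2 * q) with hC
  have hC1 : 1 ≤ C := by
    have : 0 ≤ K ^ (2 * q) := by positivity
    linarith
  set η := ε / 8 with hη
  have hη0 : 0 < η := by positivity
  have hη1 : η ≤ 1 / 8 := by linarith
  have hη2 : (η / 2) ^ 2 ≤ 1 := by nlinarith
  set L := 16 * (C + 2) / (η / 2) ^ 2 with hL
  have hL2 : 2 ≤ L := by
    rw [hL, le_div_iff₀ (by positivity)]
    nlinarith
  have hLη : 16 * (C + 2) / L ≤ (η / 2) ^ 2 := by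
    rw [div_le_iff₀ (by linarith), hL]
    field_simp
    exact le_rfl
  have hLη' : 16 * (C + 1) / L ≤ (η / 2) ^ 2 := by
    refine le_trans ?_ hLη
    have : 0 ≤ L := by linarith
    gcongr
    norm_num
  refine ⟨L, 256 * L, by linarith, by linarith, ?_⟩
  intro p n s hp hn _ _ ρ hρ
  rw [max_comm, hqα] at hρ
  refine risk_le hε0.le ?_ ?_
  · rintro P ⟨ν, hν, hP⟩ θ hθ
    have := hP.1
    refine (integral_phiPdense_le hp hn
      (hP.stdFamily_Zb hν hK (by linarith) hq2 hq3) hq1 hq2 hqα hθ hL2 hη0.le hη1 hLη').trans ?_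
    linarith
  · rintro P ⟨ν, hν, hP⟩ θ hθ
    have := hP.1
    refine (integral_one_sub_phiPdense_le hp hn
      (hP.stdFamily_Zb hν hK (by linarith) hq2 hq3) hq1 hq2 hqα hθ hL2 hη0.le (by linarith)
      hLη hρ).trans ?_
    linarith

end ChangePoint
end
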